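/- For every ε > 0 there exists a constant C = C(ε) > 0 such that for every prime p, every interval I ⊂ F_p not containing 0 with |I| < p^{3/46}, and every λ ∈ F_p with λ ≠ 0 and λ ∉ I^{-1} = {x^{-1} : x ∈ I}, the number J of triples (x, y, z) ∈ I³ satisfying x^{-1} + y^{-1} + z^{-1} = λ in F_p satisfies J ≤ C·|I|^{2/3 + ε}. -/

import Mathlib

open Finset

/-- The interval `{a+1, a+2, …, a+N}` in `ZMod p`. -/
def interval (p : ℕ) (a : ZMod p) (N : ℕ) : Finset (ZMod p) :=
  (Finset.Icc 1 N).image (fun i : ℕ => a + (i : ZMod p))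

/-- The divisor bound `τ(n) ≪ n ^ ε`. -/
theorem exists_card_divisors_le_rpow (ε : ℝ) (hε : 0 < ε) :
    ∃ C : ℝ, 1 ≤ C ∧ ∀ n : ℕ, n ≠ 0 → (n.divisors.card : ℝ) ≤ C * (n : ℝ) ^ ε := by
  have hl : 0 < Real.log 2 := Real.log_pos (by norm_num)
  have hεl : 0 < ε * Real.log 2 := mul_pos hε hl
  set K : ℝ := 1 + 1 / (ε * Real.log 2) with hK
  have hK1 : 1 ≤ K := by rw [hK]; have := (one_div_pos.2 hεl).le; linarith
  set P : ℕ := ⌈(2 : ℝ) ^ (1 / ε)⌉₊ with hP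
  refine ⟨K ^ P, one_le_pow₀ hK1, fun n hn => ?_⟩
  have key : ∀ q ∈ n.primeFactors, ((n.factorization q + 1 : ℕ) : ℝ) ≤
      (if q < P then K else 1) * ((q : ℝ) ^ n.factorization q) ^ ε := by
    intro q hq
    have hq2 : (2 : ℝ) ≤ q := by exact_mod_cast (Nat.prime_of_mem_primeFactors hq).two_le
    have hcomm : ((q : ℝ) ^ n.factorization q) ^ ε = ((q : ℝ) ^ ε) ^ n.factorization q := by
      rw [← Real.rpow_natCast, ← Real.rpow_mul (by linarith), mul_comm,
        Real.rpow_mul (by linarith), Real.rpow_natCast]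
    rw [hcomm]
    set e := n.factorization q
    split_ifs with h
    · have h1 : 1 + ε * Real.log 2 ≤ (q : ℝ) ^ ε := by
        have : (2 : ℝ) ^ ε ≤ (q : ℝ) ^ ε := Real.rpow_le_rpow (by norm_num) hq2 hε.le
        rw [Real.rpow_def_of_pos (by norm_num)] at this
        have h2 := Real.add_one_le_exp (Real.log 2 * ε)
        nlinarith
      have h2 : 1 + e * (ε * Real.log 2) ≤ ((q : ℝ) ^ ε) ^ e :=
        (one_add_mul_le_pow (by linarith) e).trans (pow_le_pow_left₀ (by linarith) h1 e)
      have h3 : K * (1 + e * (ε * Real.log 2)) ≤ K * ((q : ℝ) ^ ε) ^ e :=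
        mul_le_mul_of_nonneg_left h2 (by linarith)
      have h4 : (1 / (ε * Real.log 2)) * (ε * Real.log 2) = 1 := by field_simp
      have h5 : 0 ≤ (e : ℝ) := Nat.cast_nonneg e
      have h6 : K * (1 + e * (ε * Real.log 2)) =
          K + e * (ε * Real.log 2) + e * ((1 / (ε * Real.log 2)) * (ε * Real.log 2)) := by
        rw [hK]; ring
      rw [h4] at h6
      push_cast
      have h7 : 0 ≤ e * (ε * Real.log 2) := by positivity
      linarith
    · have h1 : (2 : ℝ) ≤ (q : ℝ) ^ ε := by
        have h2 : (2 : ℝ) ^ (1 / ε) ≤ q := (Nat.le_ceil _).trans (by exact_mod_cast not_lt.1 h)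
        have h3 := Real.rpow_le_rpow (by positivity) h2 hε.le
        rwa [← Real.rpow_mul (by norm_num), one_div_mul_cancel hε.ne', Real.rpow_one] at h3
      rw [one_mul]
      have h2 : ((e + 1 : ℕ) : ℝ) ≤ (2 : ℝ) ^ e := by exact_mod_cast Nat.lt_two_pow_self
      exact h2.trans (pow_le_pow_left₀ (by norm_num) h1 e)
  rw [Nat.card_divisors hn]
  push_cast at key ⊢
  refine (prod_le_prod (fun _ _ => by positivity) key).trans ?_
  rw [prod_mul_distrib]
  refine mul_le_mul ?_ ?_ (prod_nonneg fun _ _ => by positivity) (by positivity)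
  · rw [prod_ite, prod_const, prod_const_one, mul_one]
    refine pow_le_pow_right₀ hK1 ?_
    calc _ ≤ (range P).card := card_le_card fun x hx => by simp at hx ⊢; exact hx.2
      _ = P := card_range P
  · rw [Real.finsetProd_rpow _ _ fun _ _ => by positivity]
    refine le_of_eq ?_
    congr 1
    have := Nat.prod_factorization_pow_eq_self hn
    conv_rhs => rw [← this]
    rw [Finsupp.prod]
    push_cast
    rfl

/-- `T` bounds the number of divisors of every positive integer up to `L`. -/
def DivisorBound (T L : ℕ) : Prop := ∀ k : ℕ, k ≠ 0 → k ≤ L → k.divisors.card ≤ T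

/-- The integer divisors, of either sign, of `k`. -/
def signedDivisors (k : ℤ) : Finset ℤ :=
  k.natAbs.divisors.image (fun d : ℕ => (d : ℤ)) ∪ k.natAbs.divisors.image (fun d : ℕ => -(d : ℤ))

theorem mem_signedDivisors {k d : ℤ} (hk : k ≠ 0) (h : d ∣ k) : d ∈ signedDivisors k := by
  have h1 : d.natAbs ∈ k.natAbs.divisors :=
    Nat.mem_divisors.2 ⟨Int.natAbs_dvd_natAbs.2 h, Int.natAbs_ne_zero.2 hk⟩
  simp only [signedDivisors, mem_union, mem_image]
  rcases Int.natAbs_eq d with h2 | h2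
  · exact Or.inl ⟨_, h1, h2.symm⟩
  · exact Or.inr ⟨_, h1, h2.symm⟩

theorem card_signedDivisors_le {T L : ℕ} (hT : DivisorBound T L) {k : ℤ} (hk : k ≠ 0)
    (hkL : |k| ≤ L) : (signedDivisors k).card ≤ 2 * T := by
  have h1 : k.natAbs.divisors.card ≤ T :=
    hT _ (Int.natAbs_ne_zero.2 hk) (by rw [Int.abs_eq_natAbs] at hkL; exact_mod_cast hkL)
  refine (card_union_le _ _).trans ?_
  have := card_image_le (s := k.natAbs.divisors) (f := fun d : ℕ => (d : ℤ))
  have := card_image_le (s := k.natAbs.divisors) (f := fun d : ℕ => -(d : ℤ))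
  omega

theorem DivisorBound.one_le {T L : ℕ} (hT : DivisorBound T L) (hL : 1 ≤ L) : 1 ≤ T := by
  simpa using hT 1 one_ne_zero hL

/-- The set of pairs `(u, v)` of integers with `u > 0`, `v ≠ 0` and `u * |v| ≤ K`. -/
noncomputable def hyperbolaPairs (K : ℕ) : Finset (ℤ × ℤ) :=
  (Icc (-(K : ℤ)) K ×ˢ Icc (-(K : ℤ)) K).filter fun q => 0 < q.1 ∧ q.2 ≠ 0 ∧ q.1 * |q.2| ≤ K

theorem mem_hyperbolaPairs {K : ℕ} {u v : ℤ} :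
    (u, v) ∈ hyperbolaPairs K ↔ 0 < u ∧ v ≠ 0 ∧ u * |v| ≤ K := by
  simp only [hyperbolaPairs, mem_filter, mem_product, mem_Icc, and_iff_right_iff_imp]
  rintro ⟨hu, hv, h⟩
  have h1 : 0 < |v| := abs_pos.2 hv
  have h2 : |v| ≤ K := by nlinarith
  have h3 : u ≤ K := by nlinarith
  exact ⟨⟨by linarith, h3⟩, abs_le.1 h2⟩

theorem card_hyperbolaPairs_le {T L : ℕ} (hT : DivisorBound T L) {K : ℕ} (hK : K ≤ L) :
    (hyperbolaPairs K).card ≤ 2 * T * K := by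
  have h := card_le_mul_card_image_of_maps_to (s := hyperbolaPairs K) (t := Icc (1 : ℤ) K)
    (f := fun q => q.1 * |q.2|) (n := 2 * T) ?_ ?_
  · simpa using h
  · rintro ⟨u, v⟩ h
    rw [mem_hyperbolaPairs] at h
    have : 0 < u * |v| := mul_pos h.1 (abs_pos.2 h.2.1)
    rw [mem_Icc]
    exact ⟨by linarith, h.2.2⟩
  · intro k hk
    rw [mem_Icc] at hk
    refine (card_le_card_of_injOn (fun q => q.2) (t := signedDivisors k) ?_ ?_).trans
      (card_signedDivisors_le hT (by linarith)
        (by rw [abs_of_nonneg (by linarith)]; exact hk.2.trans (by exact_mod_cast hK)))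
    · rintro ⟨u, v⟩ h
      simp only [coe_filter, Set.mem_ofPred_eq, mem_hyperbolaPairs] at h
      exact mem_signedDivisors (by linarith) (by rw [← h.2]; exact ((dvd_abs v v).2 dvd_rfl).mul_left u)
    · rintro ⟨u, v⟩ h ⟨u', v'⟩ h' e
      simp only [coe_filter, Set.mem_ofPred_eq, mem_hyperbolaPairs] at h h' e
      subst e
      have : u = u' := mul_right_cancel₀ (abs_pos.2 h.1.2.1).ne' (h.2.trans h'.2.symm)
      rw [this]

/-- Integer points on a nondegenerate hyperbola. -/
theorem card_hyperbola_le {T L : ℕ} (hT : DivisorBound T L) (P Q R S : ℤ) (hP : P ≠ 0)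
    (hL : |R * Q + P * S| ≤ L) (s : Finset (ℤ × ℤ))
    (hs : ∀ q ∈ s, P * q.1 * q.2 = Q * q.1 + R * q.2 + S ∧ P * q.1 ≠ R ∧ P * q.2 ≠ Q) :
    s.card ≤ 2 * T := by
  have key : ∀ q ∈ s, (P * q.1 - R) * (P * q.2 - Q) = R * Q + P * S := fun q hq => by
    linear_combination P * (hs q hq).1
  rcases s.eq_empty_or_nonempty with rfl | ⟨q₀, hq₀⟩
  · simp
  have hne : R * Q + P * S ≠ 0 := by
    rw [← key q₀ hq₀]
    exact mul_ne_zero (sub_ne_zero.2 (hs _ hq₀).2.1) (sub_ne_zero.2 (hs _ hq₀).2.2)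
  refine (card_le_card_of_injOn (fun q => P * q.1 - R) (t := signedDivisors (R * Q + P * S))
    (fun q hq => mem_signedDivisors hne ⟨_, (key q hq).symm⟩) ?_).trans
    (card_signedDivisors_le hT hne hL)
  rintro ⟨u, v⟩ h ⟨u', v'⟩ h' e
  have k1 := key _ h
  have k2 := key _ h'
  have hu := (hs _ h).2.1
  simp only at e k1 k2 hu
  rw [← e, ← k1] at k2
  have hv : v' = v := by
    have := mul_left_cancel₀ (sub_ne_zero.2 hu) k2
    exact mul_left_cancel₀ hP (by linarith)
  have hu : u = u' := mul_left_cancel₀ hP (by linarith)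
  rw [hv, hu]

/-- The quadruple `(d, a, b, c)` describes the mutual greatest common divisors of an integer solution
`X₁ = d b c x`, `X₂ = d a c y`, `X₃ = d a b z` of `n X₁ X₂ X₃ = m x y z (X₁ X₂ + X₁ X₃ + X₂ X₃)`
whose differences are `r` times integers of size at most `N`. -/
structure IsGcdData (B n m r x y z N d a b c : ℤ) : Prop where
  d_pos : 0 < d
  a_pos : 0 < a
  b_pos : 0 < b
  c_pos : 0 < c
  d_le : d ≤ B
  a_le : a ≤ B
  b_le : b ≤ B
  c_le : c ≤ B
  eq : n * d * a * b * c = m * (a * y * z + b * x * z + c * x * y)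
  ne₁ : n * d * b * c ≠ m * y * z
  ne₂ : n * d * a * c ≠ m * x * z
  ne₃ : n * d * a * b ≠ m * x * y
  diff₁ : ∃ h, h ≠ 0 ∧ r * h = c * y - b * z ∧ d * a * |h| ≤ N
  diff₂ : ∃ h, h ≠ 0 ∧ r * h = c * x - a * z ∧ d * b * |h| ≤ N
  le₂ : |b * x| ≤ |a * y|
  le₃ : |c * x| ≤ |a * z|

theorem card_le_of_pairs {α : Type*} [DecidableEq α] {s : Finset α} (f : α → ℤ × ℤ)
    {t : Finset (ℤ × ℤ)} {k l : ℕ} (ht : t.card ≤ l) (hst : ∀ q ∈ s, f q ∈ t)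
    (hf : ∀ w : ℤ × ℤ, {q ∈ s | f q = w}.card ≤ k) : s.card ≤ k * l :=
  (card_le_mul_card_image_of_maps_to (t := t) hst k fun w _ => hf w).trans
    (Nat.mul_le_mul_left k ht)

theorem card_le_of_hyperbola {T L : ℕ} (hT : DivisorBound T L) {α : Type*} [DecidableEq α]
    (P Q R S : ℤ) (s : Finset α) (g : α → ℤ × ℤ) (hg : Set.InjOn g s)
    (hP : s.Nonempty → P ≠ 0 ∧ |R * Q + P * S| ≤ L)
    (hs : ∀ q ∈ s, P * (g q).1 * (g q).2 = Q * (g q).1 + R * (g q).2 + S ∧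
      P * (g q).1 ≠ R ∧ P * (g q).2 ≠ Q) :
    s.card ≤ 2 * T := by
  rcases s.eq_empty_or_nonempty with rfl | hne
  · simp
  rw [← card_image_of_injOn hg]
  refine card_hyperbola_le hT P Q R S (hP hne).1 (hP hne).2 _ fun q hq => ?_
  obtain ⟨w, hw, rfl⟩ := mem_image.1 hq
  exact hs w hw

theorem card_le_three_of_cubic (k₃ k₂ k₁ k₀ : ℤ) (hk : k₃ ≠ 0 ∨ k₂ ≠ 0 ∨ k₁ ≠ 0) (s : Finset ℤ)
    (hs : ∀ t ∈ s, k₃ * t ^ 3 + k₂ * t ^ 2 + k₁ * t + k₀ = 0) : s.card ≤ 3 := by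
  let P : Cubic ℤ := ⟨k₃, k₂, k₁, k₀⟩
  have hP : P.toPoly ≠ 0 := by
    rcases hk with h | h | h
    · exact Cubic.ne_zero_of_a_ne_zero h
    · exact Cubic.ne_zero_of_b_ne_zero h
    · exact Cubic.ne_zero_of_c_ne_zero h
  refine (card_le_card fun t ht => ?_).trans (Cubic.card_roots_le (P := P))
  rw [Multiset.mem_toFinset]
  exact (Cubic.mem_roots_iff hP t).2 (hs t ht)

section fibers

variable {T L : ℕ} {B n m r x y z N : ℤ}

theorem abs_sum_mul_le {B a b : ℤ} {i j : ℕ} (hB : 1 ≤ B) (ha : |a| ≤ B ^ i) (hb : |b| ≤ 2 * B ^ j)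
    (hi : i ≤ 6) (hij : j ≤ 7) : |a + b| ≤ 3 * B ^ 7 := by
  have h1 : B ^ i ≤ B ^ 7 := pow_le_pow_right₀ hB (by omega)
  have h2 : B ^ j ≤ B ^ 7 := pow_le_pow_right₀ hB hij
  linarith [abs_add_le a b]

theorem card_fiber_db_le (hT : DivisorBound T L) (hB : 1 ≤ B) (hL : 3 * B ^ 7 ≤ L) (hn : 1 ≤ n)
    (hnB : n ≤ B) (hm : |m| ≤ B) (hx : |x| ≤ B) (hy : |y| ≤ B) (hz : |z| ≤ B)
    (s : Finset (ℤ × ℤ × ℤ × ℤ))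
    (hs : ∀ q ∈ s, IsGcdData B n m r x y z N q.1 q.2.1 q.2.2.1 q.2.2.2) (w : ℤ × ℤ) :
    {q ∈ s | (q.1, q.2.2.1) = w}.card ≤ 2 * T := by
  obtain ⟨d, b⟩ := w
  refine card_le_of_hyperbola hT (n * d * b) (m * y * z) (m * x * y) (m * b * x * z) _
    (fun q => (q.2.1, q.2.2.2)) ?_ ?_ ?_
  · rintro ⟨d1, a1, b1, c1⟩ h1 ⟨d2, a2, b2, c2⟩ h2 h
    simp_all
  · rintro ⟨⟨d', a, b', c⟩, hq⟩
    simp only [mem_filter, Prod.mk.injEq] at hq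
    obtain ⟨hq, rfl, rfl⟩ := hq
    have H := hs _ hq
    have hd := abs_of_pos H.d_pos
    have hb := abs_of_pos H.b_pos
    have hn' := abs_of_pos (show 0 < n by linarith)
    refine ⟨(mul_pos (mul_pos (by linarith) H.d_pos) H.b_pos).ne', le_trans ?_ hL⟩
    have h1 := H.d_le
    have h2 := H.b_le
    have := H.d_pos
    have := H.b_pos
    refine abs_sum_mul_le (i := 6) (j := 7) hB ?_ ?_ le_rfl le_rfl
    · simp only [abs_mul]
      calc _ ≤ B * B * B * (B * B * B) := by gcongr
        _ = _ := by ring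
    · simp only [abs_mul, hd, hb, hn']
      calc _ ≤ B * B * B * (B * B * B * B) := by gcongr
        _ ≤ _ := by have : 0 ≤ B ^ 7 := by positivity
                    linarith
  · rintro ⟨d', a, b', c⟩ hq
    simp only [mem_filter, Prod.mk.injEq] at hq
    obtain ⟨hq, rfl, rfl⟩ := hq
    have H := hs _ hq
    exact ⟨by linear_combination H.eq, fun h => H.ne₃ (by linear_combination h),
      fun h => H.ne₁ (by linear_combination h)⟩

theorem card_fiber_da_le (hT : DivisorBound T L) (hB : 1 ≤ B) (hL : 3 * B ^ 7 ≤ L) (hn : 1 ≤ n)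
    (hnB : n ≤ B) (hm : |m| ≤ B) (hx : |x| ≤ B) (hy : |y| ≤ B) (hz : |z| ≤ B)
    (s : Finset (ℤ × ℤ × ℤ × ℤ))
    (hs : ∀ q ∈ s, IsGcdData B n m r x y z N q.1 q.2.1 q.2.2.1 q.2.2.2) (w : ℤ × ℤ) :
    {q ∈ s | (q.1, q.2.1) = w}.card ≤ 2 * T := by
  obtain ⟨d, a⟩ := w
  refine card_le_of_hyperbola hT (n * d * a) (m * x * z) (m * x * y) (m * a * y * z) _
    (fun q => (q.2.2.1, q.2.2.2)) ?_ ?_ ?_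
  · rintro ⟨d1, a1, b1, c1⟩ h1 ⟨d2, a2, b2, c2⟩ h2 h
    simp_all
  · rintro ⟨⟨d', a', b, c⟩, hq⟩
    simp only [mem_filter, Prod.mk.injEq] at hq
    obtain ⟨hq, rfl, rfl⟩ := hq
    have H := hs _ hq
    have hd := abs_of_pos H.d_pos
    have ha := abs_of_pos H.a_pos
    have hn' := abs_of_pos (show 0 < n by linarith)
    refine ⟨(mul_pos (mul_pos (by linarith) H.d_pos) H.a_pos).ne', le_trans ?_ hL⟩
    have h1 := H.d_le
    have h2 := H.a_le
    have := H.d_pos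
    have := H.a_pos
    refine abs_sum_mul_le (i := 6) (j := 7) hB ?_ ?_ le_rfl le_rfl
    · simp only [abs_mul]
      calc _ ≤ B * B * B * (B * B * B) := by gcongr
        _ = _ := by ring
    · simp only [abs_mul, hd, ha, hn']
      calc _ ≤ B * B * B * (B * B * B * B) := by gcongr
        _ ≤ _ := by have : 0 ≤ B ^ 7 := by positivity
                    linarith
  · rintro ⟨d', a', b, c⟩ hq
    simp only [mem_filter, Prod.mk.injEq] at hq
    obtain ⟨hq, rfl, rfl⟩ := hq
    have H := hs _ hq
    exact ⟨by linear_combination H.eq, fun h => H.ne₃ (by linear_combination h),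
      fun h => H.ne₂ (by linear_combination h)⟩

theorem card_fiber_ab_le (hT : DivisorBound T L) (hB : 1 ≤ B) (hL : 3 * B ^ 7 ≤ L) (hn : 1 ≤ n)
    (hnB : n ≤ B) (hm : |m| ≤ B) (hx : |x| ≤ B) (hy : |y| ≤ B) (hz : |z| ≤ B)
    (s : Finset (ℤ × ℤ × ℤ × ℤ))
    (hs : ∀ q ∈ s, IsGcdData B n m r x y z N q.1 q.2.1 q.2.2.1 q.2.2.2) (w : ℤ × ℤ) :
    {q ∈ s | (q.2.1, q.2.2.1) = w}.card ≤ 2 * T := by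
  obtain ⟨a, b⟩ := w
  refine card_le_of_hyperbola hT (n * a * b) 0 (m * x * y) (m * z * (a * y + b * x)) _
    (fun q => (q.1, q.2.2.2)) ?_ ?_ ?_
  · rintro ⟨d1, a1, b1, c1⟩ h1 ⟨d2, a2, b2, c2⟩ h2 h
    simp_all
  · rintro ⟨⟨d, a', b', c⟩, hq⟩
    simp only [mem_filter, Prod.mk.injEq] at hq
    obtain ⟨hq, rfl, rfl⟩ := hq
    have H := hs _ hq
    have ha := abs_of_pos H.a_pos
    have hb := abs_of_pos H.b_pos
    have hn' := abs_of_pos (show 0 < n by linarith)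
    refine ⟨(mul_pos (mul_pos (by linarith) H.a_pos) H.b_pos).ne', le_trans ?_ hL⟩
    have h1 := H.a_le
    have h2 := H.b_le
    have := H.a_pos
    have := H.b_pos
    refine abs_sum_mul_le (i := 6) (j := 7) hB ?_ ?_ le_rfl le_rfl
    · rw [mul_zero, abs_zero]; positivity
    · have h3 : |a' * y + b' * x| ≤ 2 * (B * B) := by
        refine (abs_add_le _ _).trans ?_
        rw [abs_mul, abs_mul, ha, hb]
        have : a' * |y| ≤ B * B := by gcongr
        have : b' * |x| ≤ B * B := by gcongr
        linarith
      rw [abs_mul, abs_mul (m * z), abs_mul m, abs_mul _ b', abs_mul n, ha, hb, hn']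
      calc _ ≤ B * B * B * (B * B * (2 * (B * B))) := by gcongr
        _ = _ := by ring
  · rintro ⟨d, a', b', c⟩ hq
    simp only [mem_filter, Prod.mk.injEq] at hq
    obtain ⟨hq, rfl, rfl⟩ := hq
    have H := hs _ hq
    exact ⟨by linear_combination H.eq, fun h => H.ne₃ (by linear_combination h),
      (mul_pos (mul_pos (mul_pos (by linarith) H.a_pos) H.b_pos) H.c_pos).ne'⟩

theorem card_fiber_bc_le (hT : DivisorBound T L) (hB : 1 ≤ B) (hL : 3 * B ^ 7 ≤ L) (hn : 1 ≤ n)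
    (hnB : n ≤ B) (hm : |m| ≤ B) (hx : |x| ≤ B) (hy : |y| ≤ B) (hz : |z| ≤ B)
    (s : Finset (ℤ × ℤ × ℤ × ℤ))
    (hs : ∀ q ∈ s, IsGcdData B n m r x y z N q.1 q.2.1 q.2.2.1 q.2.2.2) (w : ℤ × ℤ) :
    {q ∈ s | (q.2.2.1, q.2.2.2) = w}.card ≤ 2 * T := by
  obtain ⟨b, c⟩ := w
  refine card_le_of_hyperbola hT (n * b * c) 0 (m * y * z) (m * x * (b * z + c * y)) _
    (fun q => (q.1, q.2.1)) ?_ ?_ ?_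
  · rintro ⟨d1, a1, b1, c1⟩ h1 ⟨d2, a2, b2, c2⟩ h2 h
    simp_all
  · rintro ⟨⟨d, a, b', c'⟩, hq⟩
    simp only [mem_filter, Prod.mk.injEq] at hq
    obtain ⟨hq, rfl, rfl⟩ := hq
    have H := hs _ hq
    have hb := abs_of_pos H.b_pos
    have hc := abs_of_pos H.c_pos
    have hn' := abs_of_pos (show 0 < n by linarith)
    refine ⟨(mul_pos (mul_pos (by linarith) H.b_pos) H.c_pos).ne', le_trans ?_ hL⟩
    have h1 := H.b_le
    have h2 := H.c_le
    have := H.b_pos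
    have := H.c_pos
    refine abs_sum_mul_le (i := 6) (j := 7) hB ?_ ?_ le_rfl le_rfl
    · rw [mul_zero, abs_zero]; positivity
    · have h3 : |b' * z + c' * y| ≤ 2 * (B * B) := by
        refine (abs_add_le _ _).trans ?_
        rw [abs_mul, abs_mul, hb, hc]
        have : b' * |z| ≤ B * B := by gcongr
        have : c' * |y| ≤ B * B := by gcongr
        linarith
      rw [abs_mul, abs_mul (m * x), abs_mul m, abs_mul _ c', abs_mul n, hb, hc, hn']
      calc _ ≤ B * B * B * (B * B * (2 * (B * B))) := by gcongr
        _ = _ := by ring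
  · rintro ⟨d, a, b', c'⟩ hq
    simp only [mem_filter, Prod.mk.injEq] at hq
    obtain ⟨hq, rfl, rfl⟩ := hq
    have H := hs _ hq
    exact ⟨by linear_combination H.eq, fun h => H.ne₁ (by linear_combination h),
      (mul_pos (mul_pos (mul_pos (by linarith) H.b_pos) H.c_pos) H.a_pos).ne'⟩

/-- For given `d` and given differences there are at most three gcd data. -/
theorem card_fiber_diff_le (hn : 1 ≤ n) (hx : x ≠ 0) (hy : y ≠ 0) (hz : z ≠ 0)
    (s : Finset (ℤ × ℤ × ℤ × ℤ))
    (hs : ∀ q ∈ s, IsGcdData B n m r x y z N q.1 q.2.1 q.2.2.1 q.2.2.2) (d h₁ h₂ : ℤ)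
    (hh : ∀ q ∈ s, q.1 = d ∧ r * h₁ = q.2.2.2 * y - q.2.2.1 * z ∧
      r * h₂ = q.2.2.2 * x - q.2.1 * z) :
    s.card ≤ 3 := by
  rcases s.eq_empty_or_nonempty with rfl | ⟨q₀, hq₀⟩
  · simp
  have hd : d ≠ 0 := by rw [← (hh _ hq₀).1]; exact (hs _ hq₀).d_pos.ne'
  rw [← card_image_of_injOn (f := fun q => q.2.2.2)]
  · refine card_le_three_of_cubic (n * d * x * y)
      (-(n * d * r * (h₁ * x + h₂ * y)))
      (n * d * r ^ 2 * h₁ * h₂ - 3 * m * z ^ 2 * x * y) (m * z ^ 2 * r * (h₁ * x + h₂ * y))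
      (Or.inl (mul_ne_zero (mul_ne_zero (mul_ne_zero (by linarith) hd) hx) hy)) _ ?_
    intro c hc
    obtain ⟨⟨d', a, b, c⟩, hq, rfl⟩ := mem_image.1 hc
    obtain ⟨rfl, e1, e2⟩ := hh _ hq
    have e := (hs _ hq).eq
    simp only at e1 e2 e ⊢
    have hb : b * z = c * y - r * h₁ := by linarith
    have ha : a * z = c * x - r * h₂ := by linarith
    have e' : n * d' * (a * z) * (b * z) * c =
        m * z ^ 2 * ((a * z) * y + (b * z) * x + c * x * y) := by
      linear_combination z ^ 2 * e
    rw [ha, hb] at e'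
    linear_combination e'
  · rintro ⟨d1, a1, b1, c1⟩ h1 ⟨d2, a2, b2, c2⟩ h2 h
    obtain ⟨hd1, e1, e2⟩ := hh _ h1
    obtain ⟨hd2, e3, e4⟩ := hh _ h2
    simp only at h hd1 hd2 e1 e2 e3 e4
    subst h hd1 hd2
    have hb : b1 = b2 := mul_right_cancel₀ hz (by linarith)
    have ha : a1 = a2 := mul_right_cancel₀ hz (by linarith)
    rw [ha, hb]

end fibers

theorem Int.eq_of_tdiv_eq_of_dvd_sub {h h' z : ℤ} (hz : z ≠ 0) (hj : h.tdiv z = h'.tdiv z)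
    (hsign : 0 ≤ h ↔ 0 ≤ h') (hdvd : z ∣ h - h') : h = h' := by
  have e1 := Int.mul_tdiv_add_tmod h z
  have e2 := Int.mul_tdiv_add_tmod h' z
  rw [hj] at e1
  have e3 : h.tmod z - h'.tmod z = h - h' := by linarith
  have hlt : ∀ k : ℤ, |k.tmod z| < |z| := fun k => by
    rw [Int.abs_eq_natAbs, Int.abs_eq_natAbs, Int.natAbs_tmod]
    exact_mod_cast Nat.mod_lt _ (Int.natAbs_pos.2 hz)
  have h1 := abs_lt.1 (hlt h)
  have h2 := abs_lt.1 (hlt h')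
  have h3 : |h - h'| < |z| := by
    rw [← e3, abs_lt]
    by_cases h0 : 0 ≤ h
    · have := Int.tmod_nonneg z h0
      have := Int.tmod_nonneg z (hsign.1 h0)
      constructor <;> linarith
    · have h0' : ¬ 0 ≤ h' := fun H => h0 (hsign.2 H)
      have := Int.tmod_nonneg z (show 0 ≤ -h by linarith)
      have := Int.tmod_nonneg z (show 0 ≤ -h' by linarith)
      rw [Int.neg_tmod] at *
      constructor <;> linarith
  have := Int.eq_zero_of_abs_lt_dvd ((abs_dvd z _).2 hdvd) h3
  linarith

theorem Int.abs_tdiv_mul_abs_le (h z : ℤ) : |h.tdiv z| * |z| ≤ |h| := by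
  rw [Int.abs_eq_natAbs, Int.abs_eq_natAbs, Int.abs_eq_natAbs, Int.natAbs_tdiv]
  exact_mod_cast Nat.div_mul_le_self _ _

section count

variable {T L M : ℕ} {B n m r x y z N : ℤ}

theorem exists_diffs (hr : r ≠ 0) (s : Finset (ℤ × ℤ × ℤ × ℤ))
    (hs : ∀ q ∈ s, IsGcdData B n m r x y z N q.1 q.2.1 q.2.2.1 q.2.2.2) :
    ∃ f g : ℤ × ℤ × ℤ × ℤ → ℤ, ∀ q ∈ s,
      (f q ≠ 0 ∧ r * f q = q.2.2.2 * y - q.2.2.1 * z ∧ q.1 * q.2.1 * |f q| ≤ N) ∧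
      (g q ≠ 0 ∧ r * g q = q.2.2.2 * x - q.2.1 * z ∧ q.1 * q.2.2.1 * |g q| ≤ N) := by
  refine ⟨fun q => (q.2.2.2 * y - q.2.2.1 * z) / r, fun q => (q.2.2.2 * x - q.2.1 * z) / r,
    fun q hq => ⟨?_, ?_⟩⟩
  · obtain ⟨h, h0, e, hle⟩ := (hs q hq).diff₁
    simp only
    rw [← e, Int.mul_ediv_cancel_left _ hr]
    exact ⟨h0, rfl, hle⟩
  · obtain ⟨h, h0, e, hle⟩ := (hs q hq).diff₂
    simp only
    rw [← e, Int.mul_ediv_cancel_left _ hr]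
    exact ⟨h0, rfl, hle⟩

theorem dvd_diffs (hrz : IsCoprime r z) {a b c f g : ℤ} (hf : r * f = c * y - b * z)
    (hg : r * g = c * x - a * z) : z ∣ x * f - y * g :=
  hrz.symm.dvd_of_dvd_mul_left ⟨a * y - b * x, by linear_combination x * hf - y * hg⟩

/-- A difference is determined by the other one up to a multiple of `z`. -/
theorem card_fiber_tdiv₂_le (hn : 1 ≤ n) (hx : x ≠ 0) (hy : y ≠ 0) (hz : z ≠ 0)
    (hrz : IsCoprime r z) (hyz : IsCoprime y z) (s : Finset (ℤ × ℤ × ℤ × ℤ))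
    (hs : ∀ q ∈ s, IsGcdData B n m r x y z N q.1 q.2.1 q.2.2.1 q.2.2.2)
    (f g : ℤ × ℤ × ℤ × ℤ → ℤ) (hfg : ∀ q ∈ s, r * f q = q.2.2.2 * y - q.2.2.1 * z ∧
      r * g q = q.2.2.2 * x - q.2.1 * z) (d h j : ℤ) (σ : Prop)
    (hs' : ∀ q ∈ s, q.1 = d ∧ f q = h ∧ (g q).tdiv z = j ∧ (0 ≤ g q ↔ σ)) : s.card ≤ 3 := by
  rcases s.eq_empty_or_nonempty with rfl | ⟨q₀, hq₀⟩
  · simp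
  refine card_fiber_diff_le hn hx hy hz s hs d h (g q₀) fun q hq => ?_
  obtain ⟨h1, h2, h3, h4⟩ := hs' q hq
  obtain ⟨h1', h2', h3', h4'⟩ := hs' q₀ hq₀
  have e : g q = g q₀ := by
    refine Int.eq_of_tdiv_eq_of_dvd_sub hz (h3.trans h3'.symm) (h4.trans h4'.symm) ?_
    refine hyz.symm.dvd_of_dvd_mul_left ?_
    have e1 := dvd_diffs hrz (hfg q hq).1 (hfg q hq).2
    have e2 := dvd_diffs hrz (hfg q₀ hq₀).1 (hfg q₀ hq₀).2
    rw [h2] at e1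
    rw [h2'] at e2
    have := dvd_sub e2 e1
    rwa [show x * h - y * g q₀ - (x * h - y * g q) = y * (g q - g q₀) by ring] at this
  rw [← h2, ← e]
  exact ⟨h1, hfg q hq⟩

theorem card_fiber_tdiv₁_le (hn : 1 ≤ n) (hx : x ≠ 0) (hy : y ≠ 0) (hz : z ≠ 0)
    (hrz : IsCoprime r z) (hxz : IsCoprime x z) (s : Finset (ℤ × ℤ × ℤ × ℤ))
    (hs : ∀ q ∈ s, IsGcdData B n m r x y z N q.1 q.2.1 q.2.2.1 q.2.2.2)
    (f g : ℤ × ℤ × ℤ × ℤ → ℤ) (hfg : ∀ q ∈ s, r * f q = q.2.2.2 * y - q.2.2.1 * z ∧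
      r * g q = q.2.2.2 * x - q.2.1 * z) (d h j : ℤ) (σ : Prop)
    (hs' : ∀ q ∈ s, q.1 = d ∧ g q = h ∧ (f q).tdiv z = j ∧ (0 ≤ f q ↔ σ)) : s.card ≤ 3 := by
  rcases s.eq_empty_or_nonempty with rfl | ⟨q₀, hq₀⟩
  · simp
  refine card_fiber_diff_le hn hx hy hz s hs d (f q₀) h fun q hq => ?_
  obtain ⟨h1, h2, h3, h4⟩ := hs' q hq
  obtain ⟨h1', h2', h3', h4'⟩ := hs' q₀ hq₀
  have e : f q = f q₀ := by
    refine Int.eq_of_tdiv_eq_of_dvd_sub hz (h3.trans h3'.symm) (h4.trans h4'.symm) ?_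
    refine hxz.symm.dvd_of_dvd_mul_left ?_
    have e1 := dvd_diffs hrz (hfg q hq).1 (hfg q hq).2
    have e2 := dvd_diffs hrz (hfg q₀ hq₀).1 (hfg q₀ hq₀).2
    rw [h2] at e1
    rw [h2'] at e2
    have := dvd_sub e1 e2
    rwa [show x * f q - y * h - (x * f q₀ - y * h) = x * (f q - f q₀) by ring] at this
  rw [← h2, ← e]
  exact ⟨h1, hfg q hq⟩

theorem card_le_of_diffs₁ {K : ℕ} (hT : DivisorBound T L) (hK : K ≤ L) (hn : 1 ≤ n)
    (hx : x ≠ 0) (hy : y ≠ 0) (hz : z ≠ 0)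
    (hrz : IsCoprime r z) (hyz : IsCoprime y z) (s : Finset (ℤ × ℤ × ℤ × ℤ))
    (hs : ∀ q ∈ s, IsGcdData B n m r x y z N q.1 q.2.1 q.2.2.1 q.2.2.2)
    (f g : ℤ × ℤ × ℤ × ℤ → ℤ) (hfg : ∀ q ∈ s, f q ≠ 0 ∧ r * f q = q.2.2.2 * y - q.2.2.1 * z ∧
      r * g q = q.2.2.2 * x - q.2.1 * z)
    (hf : ∀ q ∈ s, q.1 * |f q| ≤ K) (hg : ∀ q ∈ s, |g q| ≤ M) :
    s.card ≤ 12 * T * (K * (2 * (M / z.natAbs) + 1)) := by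
  classical
  have h := card_le_mul_card_image_of_maps_to (s := s) (n := 3)
    (t := hyperbolaPairs K ×ˢ Icc (-((M / z.natAbs : ℕ) : ℤ)) (M / z.natAbs : ℕ) ×ˢ
      (univ : Finset Bool))
    (f := fun q => ((q.1, f q), (g q).tdiv z, decide (0 ≤ g q))) ?_ ?_
  · refine h.trans ?_
    rw [card_product, card_product, Int.card_Icc, card_univ, Fintype.card_bool]
    have := card_hyperbolaPairs_le hT hK
    have h2 : (((M / z.natAbs : ℕ) : ℤ) + 1 - -((M / z.natAbs : ℕ) : ℤ)).toNat =
      2 * (M / z.natAbs) + 1 := by omega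
    rw [h2]
    calc _ ≤ 3 * (2 * T * K * ((2 * (M / z.natAbs) + 1) * 2)) := by gcongr
      _ = _ := by ring
  · intro q hq
    simp only [mem_product, mem_hyperbolaPairs, mem_Icc, mem_univ, and_true]
    refine ⟨⟨(hs q hq).d_pos, (hfg q hq).1, hf q hq⟩, abs_le.1 ?_⟩
    have h1 := (Int.abs_tdiv_mul_abs_le (g q) z).trans (hg q hq)
    rw [Int.abs_eq_natAbs, Int.abs_eq_natAbs] at h1
    rw [Int.abs_eq_natAbs]
    exact_mod_cast (Nat.le_div_iff_mul_le (Int.natAbs_pos.2 hz)).2 (by exact_mod_cast h1)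
  · rintro ⟨⟨d, h⟩, j, σ⟩ -
    refine card_fiber_tdiv₂_le hn hx hy hz hrz hyz _ (fun q hq => hs q (mem_filter.1 hq).1) f g
      (fun q hq => (hfg q (mem_filter.1 hq).1).2) d h j (σ = true) fun q hq => ?_
    have := (mem_filter.1 hq).2
    simp only [Prod.mk.injEq] at this
    obtain ⟨⟨h1, h2⟩, h3, h4⟩ := this
    exact ⟨h1, h2, h3, by rw [← h4]; simp⟩

theorem card_le_of_diffs₂ (hT : DivisorBound T L) (hM : 1 ≤ M) (hL : M ^ 2 ≤ L) (hn : 1 ≤ n)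
    (hx : x ≠ 0) (hy : y ≠ 0) (hz : z ≠ 0)
    (hrz : IsCoprime r z) (hxz : IsCoprime x z) (s : Finset (ℤ × ℤ × ℤ × ℤ))
    (hs : ∀ q ∈ s, IsGcdData B n m r x y z N q.1 q.2.1 q.2.2.1 q.2.2.2)
    (f g : ℤ × ℤ × ℤ × ℤ → ℤ) (hfg : ∀ q ∈ s, g q ≠ 0 ∧ r * f q = q.2.2.2 * y - q.2.2.1 * z ∧
      r * g q = q.2.2.2 * x - q.2.1 * z)
    (hf : ∀ q ∈ s, q.1 * |f q| ≤ M * |z|) (hg : ∀ q ∈ s, |g q| ≤ M)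
    (hg' : ∀ q ∈ s, q.1 * |g q| ≤ (M ^ 2 : ℕ)) :
    s.card ≤ 48 * T * M ^ 2 := by
  classical
  have hML : M ≤ L := le_trans (Nat.le_self_pow two_ne_zero M) hL
  rw [← card_filter_add_card_filter_not (s := s) (fun q => (f q).tdiv z = 0)]
  have h1 : {q ∈ s | (f q).tdiv z = 0}.card ≤ 12 * T * M ^ 2 := by
    have h := card_le_mul_card_image_of_maps_to (s := {q ∈ s | (f q).tdiv z = 0}) (n := 3)
      (t := hyperbolaPairs (M ^ 2) ×ˢ (univ : Finset Bool))
      (f := fun q => ((q.1, g q), decide (0 ≤ f q))) ?_ ?_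
    · refine h.trans ?_
      rw [card_product, card_univ, Fintype.card_bool]
      have := card_hyperbolaPairs_le hT hL
      calc _ ≤ 3 * (2 * T * M ^ 2 * 2) := by gcongr
        _ = _ := by ring
    · intro q hq
      have hq := (mem_filter.1 hq).1
      simp only [mem_product, mem_hyperbolaPairs, mem_univ, and_true]
      exact ⟨(hs q hq).d_pos, (hfg q hq).1, hg' q hq⟩
    · rintro ⟨⟨d, h⟩, σ⟩ -
      refine card_fiber_tdiv₁_le hn hx hy hz hrz hxz _
        (fun q hq => hs q (mem_filter.1 (mem_filter.1 hq).1).1) f g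
        (fun q hq => (hfg q (mem_filter.1 (mem_filter.1 hq).1).1).2) d h 0 (σ = true)
        fun q hq => ?_
      have := (mem_filter.1 hq).2
      simp only [Prod.mk.injEq] at this
      obtain ⟨⟨h1, h2⟩, h4⟩ := this
      exact ⟨h1, h2, (mem_filter.1 (mem_filter.1 hq).1).2, by rw [← h4]; simp⟩
  have h2 : {q ∈ s | ¬ (f q).tdiv z = 0}.card ≤ 36 * T * M ^ 2 := by
    have h := card_le_mul_card_image_of_maps_to (s := {q ∈ s | ¬ (f q).tdiv z = 0}) (n := 3)
      (t := hyperbolaPairs M ×ˢ Icc (-(M : ℤ)) M ×ˢ (univ : Finset Bool))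
      (f := fun q => ((q.1, (f q).tdiv z), g q, decide (0 ≤ f q))) ?_ ?_
    · refine h.trans ?_
      rw [card_product, card_product, card_univ, Fintype.card_bool, Int.card_Icc]
      have := card_hyperbolaPairs_le hT hML
      calc _ ≤ 3 * (2 * T * M * (3 * M * 2)) := by gcongr; omega
        _ = _ := by ring
    · intro q hq
      obtain ⟨hq, hj⟩ := mem_filter.1 hq
      simp only [mem_product, mem_hyperbolaPairs, mem_univ, and_true, mem_Icc]
      refine ⟨⟨(hs q hq).d_pos, hj, ?_⟩, abs_le.1 (hg q hq)⟩
      have h3 := Int.abs_tdiv_mul_abs_le (f q) z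
      refine le_of_mul_le_mul_right ?_ (abs_pos.2 hz)
      refine le_trans ?_ (hf q hq)
      rw [mul_assoc]
      exact mul_le_mul_of_nonneg_left h3 (hs q hq).d_pos.le
    · rintro ⟨⟨d, j⟩, h, σ⟩ -
      refine card_fiber_tdiv₁_le hn hx hy hz hrz hxz _
        (fun q hq => hs q (mem_filter.1 (mem_filter.1 hq).1).1) f g
        (fun q hq => (hfg q (mem_filter.1 (mem_filter.1 hq).1).1).2) d h j (σ = true)
        fun q hq => ?_
      have := (mem_filter.1 hq).2
      simp only [Prod.mk.injEq] at this
      obtain ⟨⟨h1, h2⟩, h3, h4⟩ := this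
      exact ⟨h1, h3, h2, by rw [← h4]; simp⟩
  linarith

end count

section count

variable {T L M : ℕ} {B n m r x y z N : ℤ}

/-- Contribution of the data with `a b` small. -/
theorem card_quads_le_of_ab (hT : DivisorBound T L) (hML : M ^ 2 ≤ L) (hB : 1 ≤ B)
    (hL : 3 * B ^ 7 ≤ L) (hn : 1 ≤ n)
    (hnB : n ≤ B) (hm : |m| ≤ B) (hx : |x| ≤ B) (hy : |y| ≤ B) (hz : |z| ≤ B)
    (s : Finset (ℤ × ℤ × ℤ × ℤ))
    (hs : ∀ q ∈ s, IsGcdData B n m r x y z N q.1 q.2.1 q.2.2.1 q.2.2.2)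
    (hab : ∀ q ∈ s, q.2.1 * q.2.2.1 ≤ (M ^ 2 : ℕ)) : s.card ≤ 4 * T ^ 2 * M ^ 2 := by
  have h := card_le_of_pairs (s := s) (fun q => (q.2.1, q.2.2.1)) (card_hyperbolaPairs_le hT hML)
    (fun q hq => mem_hyperbolaPairs.2 ⟨(hs q hq).a_pos, (hs q hq).b_pos.ne', by
      rw [abs_of_pos (hs q hq).b_pos]; exact hab q hq⟩)
    (card_fiber_ab_le hT hB hL hn hnB hm hx hy hz s hs)
  exact h.trans (le_of_eq (by ring))

/-- Contribution of the data with `d b` small. -/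
theorem card_quads_le_of_db (hT : DivisorBound T L) (hML : M ^ 2 ≤ L) (hB : 1 ≤ B)
    (hL : 3 * B ^ 7 ≤ L) (hn : 1 ≤ n)
    (hnB : n ≤ B) (hm : |m| ≤ B) (hx : |x| ≤ B) (hy : |y| ≤ B) (hz : |z| ≤ B)
    (s : Finset (ℤ × ℤ × ℤ × ℤ))
    (hs : ∀ q ∈ s, IsGcdData B n m r x y z N q.1 q.2.1 q.2.2.1 q.2.2.2)
    (hdb : ∀ q ∈ s, q.1 * q.2.2.1 ≤ (M ^ 2 : ℕ)) : s.card ≤ 4 * T ^ 2 * M ^ 2 := by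
  have h := card_le_of_pairs (s := s) (fun q => (q.1, q.2.2.1)) (card_hyperbolaPairs_le hT hML)
    (fun q hq => mem_hyperbolaPairs.2 ⟨(hs q hq).d_pos, (hs q hq).b_pos.ne', by
      rw [abs_of_pos (hs q hq).b_pos]; exact hdb q hq⟩)
    (card_fiber_db_le hT hB hL hn hnB hm hx hy hz s hs)
  exact h.trans (le_of_eq (by ring))

/-- The pairs `(|e u|, |f v|)` with `e`, `f` dividing `m` and `|u v|` at most `K`. -/
noncomputable def divisorPairs (m : ℤ) (K : ℕ) : Finset (ℤ × ℤ) :=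
  (signedDivisors m ×ˢ signedDivisors m ×ˢ hyperbolaPairs K).image
    fun q => (|q.1 * q.2.2.1|, |q.2.1 * q.2.2.2|)

theorem card_divisorPairs_le (hT : DivisorBound T L) {K : ℕ} (hK : K ≤ L) (hm : m ≠ 0)
    (hmL : |m| ≤ L) : (divisorPairs m K).card ≤ 8 * T ^ 3 * K := by
  refine card_image_le.trans ?_
  rw [card_product, card_product]
  have h1 := card_hyperbolaPairs_le hT hK
  have h2 := card_signedDivisors_le hT hm hmL
  calc _ ≤ 2 * T * (2 * T * (2 * T * K)) := by gcongr
    _ = _ := by ring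

theorem mem_divisorPairs {m₁ k u v : ℤ} {K : ℕ} (hm : m ≠ 0) (hm₁ : m₁ ∣ m) (hu : 0 < u)
    (hv : 0 < v) (h : u * v = m₁ * k) (hk : |k| ≤ K) : (u, v) ∈ divisorPairs m K := by
  obtain ⟨e, f, ⟨u', rfl⟩, ⟨v', rfl⟩, rfl⟩ := exists_dvd_and_dvd_of_dvd_mul ⟨k, h⟩
  have he : e ≠ 0 := by rintro rfl; simp at hu
  have hf : f ≠ 0 := by rintro rfl; simp at hv
  have hu' : u' ≠ 0 := by rintro rfl; simp at hu
  have hv' : v' ≠ 0 := by rintro rfl; simp at hv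
  have hk' : u' * v' = k := mul_left_cancel₀ (mul_ne_zero he hf) (by linear_combination h)
  refine mem_image.2 ⟨(e, f, |u'|, v'), ?_, ?_⟩
  · simp only [mem_product, mem_hyperbolaPairs]
    refine ⟨mem_signedDivisors hm ((dvd_mul_right e f).trans hm₁),
      mem_signedDivisors hm ((dvd_mul_left f e).trans hm₁), abs_pos.2 hu', hv', ?_⟩
    rwa [← abs_mul, hk']
  · simp only [Prod.mk.injEq]
    rw [abs_of_pos hv, abs_mul, abs_abs, ← abs_mul, abs_of_pos hu]
    exact ⟨rfl, rfl⟩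

/-- Contribution of the data with `a y z` small. -/
theorem card_quads_le_of_ayz (hT : DivisorBound T L) (hML : 2 * M ^ 2 ≤ L) (hB : 1 ≤ B)
    (hL : 3 * B ^ 7 ≤ L) (hn : 1 ≤ n) (hm0 : m ≠ 0) (hnm : IsCoprime n m)
    (hnB : n ≤ B) (hm : |m| ≤ B) (hx : |x| ≤ B) (hy : |y| ≤ B) (hz : |z| ≤ B)
    (s : Finset (ℤ × ℤ × ℤ × ℤ))
    (hs : ∀ q ∈ s, IsGcdData B n m r x y z N q.1 q.2.1 q.2.2.1 q.2.2.2)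
    (hayz : ∀ q ∈ s, |q.2.1 * y * z| ≤ (M ^ 4 : ℕ)) : s.card ≤ 64 * T ^ 4 * M ^ 2 := by
  classical
  have hmL : |m| ≤ L := by
    have : B ≤ B ^ 7 := le_self_pow₀ hB (by norm_num)
    have : 0 ≤ B ^ 7 := by positivity
    linarith
  have hcard := card_divisorPairs_le hT hML hm0 hmL
  have key : ∀ q ∈ s, (q.1, q.2.1) ∈ divisorPairs m (2 * M ^ 2) ∨
      (q.2.2.1, q.2.2.2) ∈ divisorPairs m (2 * M ^ 2) := by
    rintro ⟨d, a, b, c⟩ hq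
    have H := hs _ hq
    have h4 := hayz _ hq
    have e := H.eq
    have l2 := H.le₂
    have l3 := H.le₃
    simp only at e h4 l2 l3 H ⊢
    set S := a * y * z + b * x * z + c * x * y with hS
    have hS' : |S| ≤ 3 * (M ^ 4 : ℕ) := by
      have h1 : |b * x * z| ≤ |a * y * z| := by
        rw [abs_mul, abs_mul _ z]; exact mul_le_mul_of_nonneg_right l2 (abs_nonneg z)
      have h2 : |c * x * y| ≤ |a * y * z| := by
        rw [abs_mul, mul_right_comm, abs_mul _ y]
        exact mul_le_mul_of_nonneg_right l3 (abs_nonneg y)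
      have := abs_add_three (a * y * z) (b * x * z) (c * x * y)
      linarith
    have hdvd : m ∣ (d * a) * (b * c) :=
      hnm.symm.dvd_of_dvd_mul_left ⟨S, by linear_combination e⟩
    obtain ⟨m₁, m₂, ⟨k₁, hk₁⟩, ⟨k₂, hk₂⟩, rfl⟩ := exists_dvd_and_dvd_of_dvd_mul hdvd
    have e2 : n * (k₁ * k₂) = S := by
      refine mul_left_cancel₀ hm0 ?_
      rw [← e]
      linear_combination -n * (b * c) * hk₁ - n * m₁ * k₁ * hk₂
    have h5 : |k₁| * |k₂| ≤ 3 * (M ^ 4 : ℕ) := by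
      rw [← abs_mul]
      refine le_trans ?_ hS'
      rw [← e2, abs_mul n, abs_of_pos (by linarith : 0 < n)]
      exact le_mul_of_one_le_left (abs_nonneg _) hn
    rcases le_or_gt |k₁| (2 * M ^ 2 : ℕ) with h | h
    · exact Or.inl (mem_divisorPairs hm0 (dvd_mul_right m₁ m₂) H.d_pos H.a_pos hk₁ h)
    · refine Or.inr (mem_divisorPairs hm0 (dvd_mul_left m₂ m₁) H.b_pos H.c_pos hk₂ ?_)
      by_contra! h'
      push_cast at h h' h5
      have : (0 : ℤ) ≤ (M : ℤ) ^ 2 := by positivity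
      nlinarith
  rw [← card_filter_add_card_filter_not (s := s)
    (fun q => (q.1, q.2.1) ∈ divisorPairs m (2 * M ^ 2))]
  have h1 := card_le_of_pairs (s := {q ∈ s | (q.1, q.2.1) ∈ divisorPairs m (2 * M ^ 2)})
    (fun q => (q.1, q.2.1)) hcard (fun q hq => (mem_filter.1 hq).2)
    (card_fiber_da_le hT hB hL hn hnB hm hx hy hz _ fun q hq => hs q (mem_filter.1 hq).1)
  have h2 := card_le_of_pairs (s := {q ∈ s | ¬ (q.1, q.2.1) ∈ divisorPairs m (2 * M ^ 2)})
    (fun q => (q.2.2.1, q.2.2.2)) hcard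
    (fun q hq => (key q (mem_filter.1 hq).1).resolve_left (mem_filter.1 hq).2)
    (card_fiber_bc_le hT hB hL hn hnB hm hx hy hz _ fun q hq => hs q (mem_filter.1 hq).1)
  calc _ ≤ 2 * T * (8 * T ^ 3 * (2 * M ^ 2)) + 2 * T * (8 * T ^ 3 * (2 * M ^ 2)) :=
        Nat.add_le_add h1 h2
    _ = _ := by ring

/-- Contribution of the remaining data with `a` large. -/
theorem card_quads_le_of_le_a (hT : DivisorBound T L) (hM : 1 ≤ M) (hML : M ^ 2 ≤ L)
    (hNM : N ≤ M ^ 3) (hn : 1 ≤ n) (hr : r ≠ 0)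
    (hx : x ≠ 0) (hy : y ≠ 0) (hz : z ≠ 0) (hrz : IsCoprime r z) (hyz : IsCoprime y z)
    (s : Finset (ℤ × ℤ × ℤ × ℤ))
    (hs : ∀ q ∈ s, IsGcdData B n m r x y z N q.1 q.2.1 q.2.2.1 q.2.2.2)
    (hdb : ∀ q ∈ s, (M : ℤ) ^ 2 < q.1 * q.2.2.1)
    (haz : ∀ q ∈ s, (M : ℤ) ^ 4 < q.2.1 * z ^ 2) (ha : ∀ q ∈ s, (M : ℤ) ≤ q.2.1) :
    s.card ≤ 36 * T * M ^ 2 := by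
  obtain ⟨f, g, hfg⟩ := exists_diffs hr s hs
  have hM' : (0 : ℤ) < M := by exact_mod_cast hM
  have hg : ∀ q ∈ s, |g q| ≤ M := fun q hq => by
    have h1 := (hfg q hq).2.2.2
    have h2 := hdb q hq
    by_contra! h3
    have : (M : ℤ) ^ 2 * M < q.1 * q.2.2.1 * |g q| := by gcongr
    linarith [pow_succ (M : ℤ) 2]
  have hf1 : ∀ q ∈ s, q.1 * |f q| ≤ (M ^ 2 : ℕ) := fun q hq => by
    have h1 := (hfg q hq).1.2.2
    have h2 := ha q hq
    push_cast
    refine le_of_mul_le_mul_right ?_ hM'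
    have : q.1 * |f q| * M ≤ q.1 * |f q| * q.2.1 := by
      have := (hs q hq).d_pos
      gcongr
    linarith [pow_succ (M : ℤ) 2]
  have hf2 : ∀ q ∈ s, q.1 * |f q| * M ≤ z ^ 2 := fun q hq => by
    have h1 := (hfg q hq).1.2.2
    have h2 := haz q hq
    have h3 := (hs q hq).a_pos
    by_contra! h4
    have h5 : z ^ 2 * q.2.1 < q.1 * |f q| * M * q.2.1 := by gcongr
    have h6 : q.1 * q.2.1 * |f q| * M ≤ N * M := by gcongr
    have h7 : N * M ≤ (M : ℤ) ^ 3 * M := by gcongr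
    linarith [pow_succ (M : ℤ) 3, mul_right_comm q.1 |f q| q.2.1, mul_right_comm (q.1 * |f q|) (M : ℤ) q.2.1,
      congrArg (· * (M : ℤ)) (mul_right_comm q.1 |f q| q.2.1)]
  rcases le_or_gt (M : ℕ) z.natAbs with hz1 | hz1
  · have h := card_le_of_diffs₁ hT hML hn hx hy hz hrz hyz s hs f g
      (fun q hq => ⟨(hfg q hq).1.1, (hfg q hq).1.2.1, (hfg q hq).2.2.1⟩) hf1 hg
    have h2 : M / z.natAbs ≤ 1 := by
      rw [Nat.div_le_iff_le_mul_add_pred (by omega)]; omega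
    calc _ ≤ _ := h
      _ ≤ 12 * T * (M ^ 2 * (2 * 1 + 1)) := by gcongr
      _ = _ := by ring
  · have hz2 : 0 < z.natAbs := Int.natAbs_pos.2 hz
    set K := z.natAbs ^ 2 / M with hK
    have hKM : K * M ≤ z.natAbs ^ 2 := Nat.div_mul_le_self _ _
    have hKL : K ≤ L := by
      refine le_trans ?_ hML
      calc K ≤ z.natAbs ^ 2 := Nat.div_le_self _ _
        _ ≤ _ := by gcongr
    have h := card_le_of_diffs₁ (K := K) hT hKL hn hx hy hz hrz hyz s hs f g
      (fun q hq => ⟨(hfg q hq).1.1, (hfg q hq).1.2.1, (hfg q hq).2.2.1⟩) (fun q hq => ?_) hg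
    · refine h.trans ?_
      set j := M / z.natAbs with hj
      have hjz : j * z.natAbs ≤ M := Nat.div_mul_le_self _ _
      have hj1 : 1 ≤ j := (Nat.one_le_div_iff hz2).2 hz1.le
      have : K * j ≤ M ^ 2 := by
        have h1 : K * j * M ≤ M * M ^ 2 := by
          calc K * j * M = K * M * j := by ring
            _ ≤ z.natAbs ^ 2 * j := by gcongr
            _ = z.natAbs * (j * z.natAbs) := by ring
            _ ≤ M * M := by gcongr
            _ ≤ M * M ^ 2 := by gcongr; exact Nat.le_self_pow two_ne_zero M
        exact Nat.le_of_mul_le_mul_right (by linarith) hM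
      calc _ ≤ 12 * T * (K * (2 * j + j)) := by gcongr
        _ = 36 * T * (K * j) := by ring
        _ ≤ _ := by gcongr
    · have h1 := hf2 q hq
      rw [hK]
      push_cast
      rw [Int.le_ediv_iff_mul_le hM', sq_abs]
      exact h1

/-- Contribution of the remaining data with `b` large. -/
theorem card_quads_le_of_le_b (hT : DivisorBound T L) (hM : 1 ≤ M) (hML : M ^ 2 ≤ L)
    (hNM : N ≤ M ^ 3) (hn : 1 ≤ n) (hr : r ≠ 0)
    (hx : x ≠ 0) (hy : y ≠ 0) (hz : z ≠ 0) (hrz : IsCoprime r z) (hxz : IsCoprime x z)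
    (s : Finset (ℤ × ℤ × ℤ × ℤ))
    (hs : ∀ q ∈ s, IsGcdData B n m r x y z N q.1 q.2.1 q.2.2.1 q.2.2.2)
    (hdb : ∀ q ∈ s, (M : ℤ) ^ 2 < q.1 * q.2.2.1)
    (haz : ∀ q ∈ s, (M : ℤ) ^ 4 < q.2.1 * z ^ 2) (hb : ∀ q ∈ s, (M : ℤ) ≤ q.2.2.1) :
    s.card ≤ 48 * T * M ^ 2 := by
  obtain ⟨f, g, hfg⟩ := exists_diffs hr s hs
  have hM' : (0 : ℤ) < M := by exact_mod_cast hM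
  refine card_le_of_diffs₂ hT hM hML hn hx hy hz hrz hxz s hs f g
    (fun q hq => ⟨(hfg q hq).2.1, (hfg q hq).1.2.1, (hfg q hq).2.2.1⟩)
    (fun q hq => ?_) (fun q hq => ?_) (fun q hq => ?_)
  · have h1 := (hfg q hq).1.2.2
    have h2 := haz q hq
    have h3 := (hs q hq).a_pos
    have hd := (hs q hq).d_pos
    refine abs_le_of_sq_le_sq' (b := (M : ℤ) * |z|) ?_ (by positivity) |>.2
    refine le_of_mul_le_mul_right (a := (M : ℤ) ^ 4) ?_ (by positivity)
    have h4 : q.1 * q.2.1 * |f q| ≤ (M : ℤ) ^ 3 := h1.trans hNM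
    calc (q.1 * |f q|) ^ 2 * (M : ℤ) ^ 4 ≤ (q.1 * |f q|) ^ 2 * (q.2.1 * z ^ 2) := by gcongr
      _ ≤ (q.1 * |f q|) ^ 2 * (q.2.1 * z ^ 2) * q.2.1 := le_mul_of_one_le_right (by positivity) h3
      _ = (q.1 * q.2.1 * |f q|) ^ 2 * z ^ 2 := by ring
      _ ≤ ((M : ℤ) ^ 3) ^ 2 * z ^ 2 := by gcongr
      _ = _ := by rw [mul_pow, sq_abs]; ring
  · have h1 := (hfg q hq).2.2.2
    have h2 := hdb q hq
    by_contra! h3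
    have : (M : ℤ) ^ 2 * M < q.1 * q.2.2.1 * |g q| := by gcongr
    linarith [pow_succ (M : ℤ) 2]
  · have h1 := (hfg q hq).2.2.2
    have h2 := hb q hq
    push_cast
    refine le_of_mul_le_mul_right ?_ hM'
    have : q.1 * |g q| * M ≤ q.1 * |g q| * q.2.2.1 := by
      have := (hs q hq).d_pos
      gcongr
    linarith [pow_succ (M : ℤ) 2]

theorem card_quads_le (hT : DivisorBound T L) (hM : 1 ≤ M) (hML : 2 * M ^ 2 ≤ L)
    (hNM : N ≤ M ^ 3) (hB : 1 ≤ B) (hL : 3 * B ^ 7 ≤ L) (hn : 1 ≤ n) (hr : r ≠ 0) (hm0 : m ≠ 0)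
    (hx0 : x ≠ 0) (hy0 : y ≠ 0) (hz0 : z ≠ 0) (hnm : IsCoprime n m) (hrz : IsCoprime r z)
    (hyz : IsCoprime y z) (hxz : IsCoprime x z) (hlt : |y| ≤ |z|)
    (hnB : n ≤ B) (hm : |m| ≤ B) (hx : |x| ≤ B) (hy : |y| ≤ B) (hz : |z| ≤ B)
    (s : Finset (ℤ × ℤ × ℤ × ℤ))
    (hs : ∀ q ∈ s, IsGcdData B n m r x y z N q.1 q.2.1 q.2.2.1 q.2.2.2) :
    s.card ≤ 156 * T ^ 4 * M ^ 2 := by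
  classical
  have hM2L : M ^ 2 ≤ L := by omega
  have hT1 : 1 ≤ T := hT.one_le (le_trans (Nat.one_le_pow _ _ hM) hM2L)
  let P₁ : ℤ × ℤ × ℤ × ℤ → Prop := fun q => q.2.1 * q.2.2.1 ≤ (M ^ 2 : ℕ)
  let P₂ : ℤ × ℤ × ℤ × ℤ → Prop := fun q => q.1 * q.2.2.1 ≤ (M ^ 2 : ℕ)
  let P₃ : ℤ × ℤ × ℤ × ℤ → Prop := fun q => |q.2.1 * y * z| ≤ (M ^ 4 : ℕ)
  let P₄ : ℤ × ℤ × ℤ × ℤ → Prop := fun q => (M : ℤ) ≤ q.2.1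
  have c₁ := card_quads_le_of_ab hT hM2L hB hL hn hnB hm hx hy hz {q ∈ s | P₁ q}
    (fun q hq => hs q (mem_filter.1 hq).1) (fun q hq => (mem_filter.1 hq).2)
  have c₂ := card_quads_le_of_db hT hM2L hB hL hn hnB hm hx hy hz {q ∈ s | P₂ q}
    (fun q hq => hs q (mem_filter.1 hq).1) (fun q hq => (mem_filter.1 hq).2)
  have c₃ := card_quads_le_of_ayz hT hML hB hL hn hm0 hnm hnB hm hx hy hz {q ∈ s | P₃ q}
    (fun q hq => hs q (mem_filter.1 hq).1) (fun q hq => (mem_filter.1 hq).2)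
  have haz : ∀ q ∈ s, ¬ P₃ q → (M : ℤ) ^ 4 < q.2.1 * z ^ 2 := fun q hq h => by
    have h1 : (M : ℤ) ^ 4 < |q.2.1 * y * z| := by simpa [P₃] using h
    rw [abs_mul, abs_mul, abs_of_pos (hs q hq).a_pos] at h1
    have := (hs q hq).a_pos
    calc _ < _ := h1
      _ ≤ q.2.1 * |z| * |z| := by gcongr
      _ = _ := by rw [mul_assoc, abs_mul_abs_self]; ring
  have hdb : ∀ q ∈ s, ¬ P₂ q → (M : ℤ) ^ 2 < q.1 * q.2.2.1 := fun q _ h => by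
    simpa [P₂] using h
  have c₄ := card_quads_le_of_le_a hT hM hM2L hNM hn hr hx0 hy0 hz0 hrz hyz
    {q ∈ s | ¬ P₂ q ∧ ¬ P₃ q ∧ P₄ q} (fun q hq => hs q (mem_filter.1 hq).1)
    (fun q hq => hdb q (mem_filter.1 hq).1 (mem_filter.1 hq).2.1)
    (fun q hq => haz q (mem_filter.1 hq).1 (mem_filter.1 hq).2.2.1)
    (fun q hq => (mem_filter.1 hq).2.2.2)
  have c₅ := card_quads_le_of_le_b hT hM hM2L hNM hn hr hx0 hy0 hz0 hrz hxz
    {q ∈ s | ¬ P₁ q ∧ ¬ P₂ q ∧ ¬ P₃ q ∧ ¬ P₄ q} (fun q hq => hs q (mem_filter.1 hq).1)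
    (fun q hq => hdb q (mem_filter.1 hq).1 (mem_filter.1 hq).2.2.1)
    (fun q hq => haz q (mem_filter.1 hq).1 (mem_filter.1 hq).2.2.2.1) (fun q hq => ?_)
  · have hsub : s ⊆ {q ∈ s | P₁ q} ∪ ({q ∈ s | P₂ q} ∪ ({q ∈ s | P₃ q} ∪
        ({q ∈ s | ¬ P₂ q ∧ ¬ P₃ q ∧ P₄ q} ∪
          {q ∈ s | ¬ P₁ q ∧ ¬ P₂ q ∧ ¬ P₃ q ∧ ¬ P₄ q}))) := fun q hq => by
      simp only [mem_union, mem_filter]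
      tauto
    have h2 : T ^ 2 ≤ T ^ 4 := Nat.pow_le_pow_right hT1 (by norm_num)
    have h1 : T ≤ T ^ 4 := Nat.le_self_pow (by norm_num) T
    calc s.card ≤ _ := card_le_card hsub
      _ ≤ 4 * T ^ 2 * M ^ 2 + (4 * T ^ 2 * M ^ 2 + (64 * T ^ 4 * M ^ 2 +
          (36 * T * M ^ 2 + 48 * T * M ^ 2))) :=
        (card_union_le _ _).trans <| Nat.add_le_add c₁ <| (card_union_le _ _).trans <|
          Nat.add_le_add c₂ <| (card_union_le _ _).trans <| Nat.add_le_add c₃ <|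
          (card_union_le _ _).trans <| Nat.add_le_add c₄ c₅
      _ ≤ 4 * T ^ 4 * M ^ 2 + (4 * T ^ 4 * M ^ 2 + (64 * T ^ 4 * M ^ 2 +
          (36 * T ^ 4 * M ^ 2 + 48 * T ^ 4 * M ^ 2))) := by gcongr
      _ = _ := by ring
  · obtain ⟨hq, h1, -, -, h4⟩ := mem_filter.1 hq
    simp only [P₁, P₄, not_le, Nat.cast_pow] at h1 h4
    have := (hs q hq).b_pos
    have := (hs q hq).a_pos
    by_contra! h5
    nlinarith

end count

theorem exists_isCoprime_mul_gcd {a b : ℤ} (ha : a ≠ 0) :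
    ∃ g a' b' : ℤ, 0 < g ∧ a = g * a' ∧ b = g * b' ∧ IsCoprime a' b' := by
  have hg : 0 < Int.gcd a b := Int.gcd_pos_of_ne_zero_left b ha
  obtain ⟨a', b', h, h1, h2⟩ := Int.exists_gcd_one hg
  exact ⟨Int.gcd a b, a', b', by exact_mod_cast hg, by rwa [mul_comm], by rwa [mul_comm],
    Int.isCoprime_iff_gcd_eq_one.2 h⟩

/-- Three nonzero integers in terms of their mutual greatest common divisors. -/
theorem exists_gcd_factorization {X₁ X₂ X₃ : ℤ} (h₁ : X₁ ≠ 0) (h₂ : X₂ ≠ 0) :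
    ∃ d a b c x y z : ℤ, 0 < d ∧ 0 < a ∧ 0 < b ∧ 0 < c ∧
      X₁ = d * b * c * x ∧ X₂ = d * a * c * y ∧ X₃ = d * a * b * z ∧
      IsCoprime (b * x) (a * y) ∧ IsCoprime (c * x) (a * z) ∧ IsCoprime (c * y) (b * z) := by
  obtain ⟨e, A₁, A₂, he, rfl, rfl, hA⟩ := exists_isCoprime_mul_gcd (b := X₂) h₁
  obtain ⟨d, c, Y₃, hd, rfl, rfl, hc⟩ := exists_isCoprime_mul_gcd (b := X₃) he.ne'
  have hc0 : 0 < c := pos_of_mul_pos_right he hd.le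
  have hA₁ : A₁ ≠ 0 := right_ne_zero_of_mul h₁
  have hA₂ : A₂ ≠ 0 := right_ne_zero_of_mul h₂
  obtain ⟨b, x, Z₃, hb, rfl, rfl, hx⟩ := exists_isCoprime_mul_gcd (b := Y₃) hA₁
  obtain ⟨a, y, z, ha, rfl, rfl, hy⟩ := exists_isCoprime_mul_gcd (b := Z₃) hA₂
  refine ⟨d, a, b, c, x, y, z, hd, ha, hb, hc0, by ring, by ring, by ring, hA, ?_, ?_⟩
  · exact IsCoprime.mul_left hc.of_mul_right_right hx
  · refine IsCoprime.mul_left ?_ (IsCoprime.mul_right ?_ hy)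
    · exact IsCoprime.mul_right hc.of_mul_right_left hc.of_mul_right_right.of_mul_right_right
    · exact hA.symm.of_mul_left_right.of_mul_right_left

/-- `(X₁, X₂, X₃)` is a solution of `n X₁ X₂ X₃ = m (X₁ X₂ + X₁ X₃ + X₂ X₃)` of size at most `B`
lying in a progression of length `N` and difference `r` prime to its terms. -/
structure IsSol (B n m r N X₁ X₂ X₃ : ℤ) : Prop where
  ne_zero₁ : X₁ ≠ 0
  ne_zero₂ : X₂ ≠ 0
  ne_zero₃ : X₃ ≠ 0
  ne₁ : n * X₁ ≠ m
  ne₂ : n * X₂ ≠ m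
  ne₃ : n * X₃ ≠ m
  le₁ : |X₁| ≤ B
  le₂ : |X₂| ≤ B
  le₃ : |X₃| ≤ B
  coprime₁ : IsCoprime r X₁
  coprime₂ : IsCoprime r X₂
  coprime₃ : IsCoprime r X₃
  diff₁₂ : ∃ h, X₁ - X₂ = r * h ∧ |h| ≤ N
  diff₁₃ : ∃ h, X₁ - X₃ = r * h ∧ |h| ≤ N
  diff₂₃ : ∃ h, X₂ - X₃ = r * h ∧ |h| ≤ N
  eq : n * X₁ * X₂ * X₃ = m * (X₁ * X₂ + X₁ * X₃ + X₂ * X₃)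

namespace IsSol

variable {B n m r N X₁ X₂ X₃ : ℤ}

theorem swap₁₂ (h : IsSol B n m r N X₁ X₂ X₃) : IsSol B n m r N X₂ X₁ X₃ where
  ne_zero₁ := h.ne_zero₂
  ne_zero₂ := h.ne_zero₁
  ne_zero₃ := h.ne_zero₃
  ne₁ := h.ne₂
  ne₂ := h.ne₁
  ne₃ := h.ne₃
  le₁ := h.le₂
  le₂ := h.le₁
  le₃ := h.le₃
  coprime₁ := h.coprime₂
  coprime₂ := h.coprime₁
  coprime₃ := h.coprime₃
  diff₁₂ := by
    obtain ⟨k, h1, h2⟩ := h.diff₁₂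
    exact ⟨-k, by linear_combination -h1, by rwa [abs_neg]⟩
  diff₁₃ := h.diff₂₃
  diff₂₃ := h.diff₁₃
  eq := by linear_combination h.eq

theorem swap₂₃ (h : IsSol B n m r N X₁ X₂ X₃) : IsSol B n m r N X₁ X₃ X₂ where
  ne_zero₁ := h.ne_zero₁
  ne_zero₂ := h.ne_zero₃
  ne_zero₃ := h.ne_zero₂
  ne₁ := h.ne₁
  ne₂ := h.ne₃
  ne₃ := h.ne₂
  le₁ := h.le₁
  le₂ := h.le₃
  le₃ := h.le₂
  coprime₁ := h.coprime₁
  coprime₂ := h.coprime₃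
  coprime₃ := h.coprime₂
  diff₁₂ := h.diff₁₃
  diff₁₃ := h.diff₁₂
  diff₂₃ := by
    obtain ⟨k, h1, h2⟩ := h.diff₂₃
    exact ⟨-k, by linear_combination -h1, by rwa [abs_neg]⟩
  eq := by linear_combination h.eq

end IsSol

/-- Up to ordering, a triple with distinct entries satisfies this condition. -/
structure IsOrdered (X₁ X₂ X₃ : ℤ) : Prop where
  ne₁₃ : X₁ ≠ X₃
  ne₂₃ : X₂ ≠ X₃
  le₂ : |X₁| ≤ |X₂|
  le₃ : |X₁| ≤ |X₃|
  le : |X₂| * Int.gcd X₁ X₃ ≤ |X₃| * Int.gcd X₁ X₂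

theorem exists_diff_of_mul {N r e w h : ℤ} (he : 0 < e) (hr : IsCoprime r e) (hw : w ≠ 0)
    (hr0 : r ≠ 0) (hh : e * w = r * h) (hN : |h| ≤ N) :
    ∃ k, k ≠ 0 ∧ r * k = w ∧ e * |k| ≤ N := by
  obtain ⟨k, rfl⟩ := hr.dvd_of_dvd_mul_left ⟨h, hh⟩
  refine ⟨k, right_ne_zero_of_mul hw, rfl, ?_⟩
  have : e * k = h := mul_left_cancel₀ hr0 (by linear_combination hh)
  rwa [← this, abs_mul, abs_of_pos he] at hN

theorem IsSol.exists_isGcdData {B n m r N X₁ X₂ X₃ : ℤ} (hr : r ≠ 0)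
    (h : IsSol B n m r N X₁ X₂ X₃) (ho : IsOrdered X₁ X₂ X₃) :
    ∃ d a b c x y z m' : ℤ, IsGcdData B n m' r x y z N d a b c ∧ m = m' * (x * y * z) ∧
      IsCoprime r z ∧ IsCoprime y z ∧ IsCoprime x z ∧ |y| ≤ |z| ∧
      |x| ≤ B ∧ |y| ≤ B ∧ |z| ≤ B ∧
      X₁ = d * b * c * x ∧ X₂ = d * a * c * y ∧ X₃ = d * a * b * z := by
  obtain ⟨d, a, b, c, x, y, z, hd, ha, hb, hc, e₁, e₂, e₃, c₁, c₂, c₃⟩ :=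
    exists_gcd_factorization (X₃ := X₃) h.ne_zero₁ h.ne_zero₂
  have hx0 : x ≠ 0 := by rintro rfl; exact h.ne_zero₁ (by simpa using e₁)
  have hy0 : y ≠ 0 := by rintro rfl; exact h.ne_zero₂ (by simpa using e₂)
  have hz0 : z ≠ 0 := by rintro rfl; exact h.ne_zero₃ (by simpa using e₃)
  have cxy : IsCoprime x y := c₁.of_mul_left_right.of_mul_right_right
  have cxz : IsCoprime x z := c₂.of_mul_left_right.of_mul_right_right
  have cyz : IsCoprime y z := c₃.of_mul_left_right.of_mul_right_right
  have E : n * d * a * b * c * (x * y * z) = m * (a * y * z + b * x * z + c * x * y) := by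
    have := h.eq
    rw [e₁, e₂, e₃] at this
    refine mul_left_cancel₀ (a := d ^ 2 * a * b * c) (by positivity) ?_
    linear_combination this
  have dx : x ∣ m := by
    have : IsCoprime x (a * y * z) := IsCoprime.mul_right (IsCoprime.mul_right
      c₂.of_mul_left_right.of_mul_right_left cxy) cxz
    exact this.dvd_of_dvd_mul_right ⟨n * d * a * b * c * y * z - m * (b * z + c * y),
      by linear_combination -E⟩
  have dy : y ∣ m := by
    have : IsCoprime y (b * x * z) := IsCoprime.mul_right (IsCoprime.mul_right
      c₃.of_mul_left_right.of_mul_right_left cxy.symm) cyz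
    exact this.dvd_of_dvd_mul_right ⟨n * d * a * b * c * x * z - m * (a * z + c * x),
      by linear_combination -E⟩
  have dz : z ∣ m := by
    have : IsCoprime z (c * x * y) := IsCoprime.mul_right (IsCoprime.mul_right
      c₃.symm.of_mul_left_right.of_mul_right_left cxz.symm) cyz.symm
    exact this.dvd_of_dvd_mul_right ⟨n * d * a * b * c * x * y - m * (a * y + b * x),
      by linear_combination -E⟩
  obtain ⟨m', hm'⟩ := (cxz.mul_left cyz).mul_dvd (cxy.mul_dvd dx dy) dz
  have hm'' : m = m' * (x * y * z) := by rw [hm']; ring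
  have B1 : |d * b * c * x| ≤ B := e₁ ▸ h.le₁
  have B2 : |d * a * c * y| ≤ B := e₂ ▸ h.le₂
  have B3 : |d * a * b * z| ≤ B := e₃ ▸ h.le₃
  have bound : ∀ {k X : ℤ}, k ∣ X → X ≠ 0 → |X| ≤ B → |k| ≤ B := fun hk hX hB =>
    (Int.le_of_dvd (abs_pos.2 hX) ((abs_dvd_abs _ _).2 hk)).trans hB
  have r₂ : IsCoprime r (d * a * c * y) := e₂ ▸ h.coprime₂
  have r₃ : IsCoprime r (d * a * b * z) := e₃ ▸ h.coprime₃
  have g₁₂ : Int.gcd X₁ X₂ = d * c := by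
    rw [e₁, e₂, show d * b * c * x = d * c * (b * x) by ring,
      show d * a * c * y = d * c * (a * y) by ring, Int.gcd_mul_left,
      Int.isCoprime_iff_gcd_eq_one.1 c₁, mul_one, Int.natCast_natAbs, abs_of_pos (mul_pos hd hc)]
  have g₁₃ : Int.gcd X₁ X₃ = d * b := by
    rw [e₁, e₃, show d * b * c * x = d * b * (c * x) by ring,
      show d * a * b * z = d * b * (a * z) by ring, Int.gcd_mul_left,
      Int.isCoprime_iff_gcd_eq_one.1 c₂, mul_one, Int.natCast_natAbs, abs_of_pos (mul_pos hd hb)]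
  refine ⟨d, a, b, c, x, y, z, m', ⟨hd, ha, hb, hc, ?_, ?_, ?_, ?_, ?_, ?_, ?_, ?_, ?_, ?_, ?_, ?_⟩,
    hm'', r₃.of_mul_right_right, cyz, cxz, ?_, ?_, ?_, ?_, e₁, e₂, e₃⟩
  · rw [← abs_of_pos hd]
    exact bound ⟨b * c * x, by rw [e₁]; ring⟩ h.ne_zero₁ h.le₁
  · rw [← abs_of_pos ha]
    exact bound ⟨d * c * y, by rw [e₂]; ring⟩ h.ne_zero₂ h.le₂
  · rw [← abs_of_pos hb]
    exact bound ⟨d * c * x, by rw [e₁]; ring⟩ h.ne_zero₁ h.le₁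
  · rw [← abs_of_pos hc]
    exact bound ⟨d * b * x, by rw [e₁]; ring⟩ h.ne_zero₁ h.le₁
  · refine mul_left_cancel₀ (mul_ne_zero (mul_ne_zero hx0 hy0) hz0) ?_
    rw [hm''] at E
    linear_combination E
  · exact fun H => h.ne₁ (by rw [e₁, hm'']; linear_combination x * H)
  · exact fun H => h.ne₂ (by rw [e₂, hm'']; linear_combination y * H)
  · exact fun H => h.ne₃ (by rw [e₃, hm'']; linear_combination z * H)
  · obtain ⟨k, hk, hkN⟩ := h.diff₂₃
    refine exists_diff_of_mul (mul_pos hd ha) r₂.of_mul_right_left.of_mul_right_left ?_ hr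
      (by rw [← hk, e₂, e₃]; ring) hkN
    exact fun H => ho.ne₂₃ (by rw [e₂, e₃]; linear_combination d * a * H)
  · obtain ⟨k, hk, hkN⟩ := h.diff₁₃
    have r₄ : IsCoprime r (d * b) := by
      have := r₃.of_mul_right_left
      exact this.of_mul_right_left.of_mul_right_left.mul_right this.of_mul_right_right
    refine exists_diff_of_mul (mul_pos hd hb) r₄ ?_ hr
      (by rw [← hk, e₁, e₃]; ring) hkN
    exact fun H => ho.ne₁₃ (by rw [e₁, e₃]; linear_combination d * b * H)
  · have := ho.le₂
    rw [e₁, e₂, show d * b * c * x = d * c * (b * x) by ring,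
      show d * a * c * y = d * c * (a * y) by ring, abs_mul _ (b * x), abs_mul _ (a * y)] at this
    exact le_of_mul_le_mul_left this (abs_pos.2 (mul_pos hd hc).ne')
  · have := ho.le₃
    rw [e₁, e₃, show d * b * c * x = d * b * (c * x) by ring,
      show d * a * b * z = d * b * (a * z) by ring, abs_mul _ (c * x), abs_mul _ (a * z)] at this
    exact le_of_mul_le_mul_left this (abs_pos.2 (mul_pos hd hb).ne')
  · have := ho.le
    rw [g₁₂, g₁₃, e₂, e₃, abs_mul _ y, abs_mul _ z, abs_of_pos (show 0 < d * a * c by positivity),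
      abs_of_pos (show 0 < d * a * b by positivity)] at this
    refine le_of_mul_le_mul_left (a := d * a * c * (d * b)) ?_ (by positivity)
    linarith
  · exact bound ⟨d * b * c, by rw [e₁]; ring⟩ h.ne_zero₁ h.le₁
  · exact bound ⟨d * a * c, by rw [e₂]; ring⟩ h.ne_zero₂ h.le₂
  · exact bound ⟨d * a * b, by rw [e₃]; ring⟩ h.ne_zero₃ h.le₃

section solutions

variable {T L M : ℕ} {B n m r N : ℤ} {α : Type*}

theorem card_le_of_isOrdered (hT : DivisorBound T L) (hM : 1 ≤ M) (hML : 2 * M ^ 2 ≤ L)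
    (hNM : N ≤ M ^ 3) (hB : 1 ≤ B) (hL : 3 * B ^ 7 ≤ L) (hn : 1 ≤ n) (hr : r ≠ 0) (hm0 : m ≠ 0)
    (hnm : IsCoprime n m) (hnB : n ≤ B) (hm : |m| ≤ B)
    (s : Finset α) (g : α → ℤ × ℤ × ℤ) (hg : Set.InjOn g s)
    (hs : ∀ q ∈ s, IsSol B n m r N (g q).1 (g q).2.1 (g q).2.2 ∧
      IsOrdered (g q).1 (g q).2.1 (g q).2.2) :
    s.card ≤ 1248 * T ^ 7 * M ^ 2 := by
  classical
  have hmL : |m| ≤ L := by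
    have : B ≤ B ^ 7 := le_self_pow₀ hB (by norm_num)
    have : 0 ≤ B ^ 7 := by positivity
    linarith
  have key : ∀ q : α, ∃ w : (ℤ × ℤ × ℤ × ℤ) × (ℤ × ℤ × ℤ), q ∈ s → ∃ m' : ℤ,
      IsGcdData B n m' r w.2.1 w.2.2.1 w.2.2.2 N w.1.1 w.1.2.1 w.1.2.2.1 w.1.2.2.2 ∧
      m = m' * (w.2.1 * w.2.2.1 * w.2.2.2) ∧
      IsCoprime r w.2.2.2 ∧ IsCoprime w.2.2.1 w.2.2.2 ∧ IsCoprime w.2.1 w.2.2.2 ∧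
      |w.2.2.1| ≤ |w.2.2.2| ∧ |w.2.1| ≤ B ∧ |w.2.2.1| ≤ B ∧ |w.2.2.2| ≤ B ∧
      (g q).1 = w.1.1 * w.1.2.2.1 * w.1.2.2.2 * w.2.1 ∧
      (g q).2.1 = w.1.1 * w.1.2.1 * w.1.2.2.2 * w.2.2.1 ∧
      (g q).2.2 = w.1.1 * w.1.2.1 * w.1.2.2.1 * w.2.2.2 := fun q => by
    by_cases hq : q ∈ s
    · obtain ⟨d, a, b, c, x, y, z, m', H⟩ :=
        (hs q hq).1.exists_isGcdData hr (hs q hq).2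
      exact ⟨((d, a, b, c), (x, y, z)), fun _ => ⟨m', H⟩⟩
    · exact ⟨0, fun h => (hq h).elim⟩
  choose w hw using key
  have h := card_le_mul_card_image_of_maps_to (s := s) (n := 156 * T ^ 4 * M ^ 2)
    (t := signedDivisors m ×ˢ signedDivisors m ×ˢ signedDivisors m) (f := fun q => (w q).2) ?_ ?_
  · have h1 := card_signedDivisors_le hT hm0 hmL
    rw [card_product, card_product] at h
    calc _ ≤ _ := h
      _ ≤ 156 * T ^ 4 * M ^ 2 * (2 * T * (2 * T * (2 * T))) := by gcongr
      _ = _ := by ring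
  · intro q hq
    obtain ⟨m', -, h1, -⟩ := hw q hq
    simp only [mem_product]
    exact ⟨mem_signedDivisors hm0 ⟨m' * ((w q).2.2.1 * (w q).2.2.2), by linear_combination h1⟩,
      mem_signedDivisors hm0 ⟨m' * ((w q).2.1 * (w q).2.2.2), by linear_combination h1⟩,
      mem_signedDivisors hm0 ⟨m' * ((w q).2.1 * (w q).2.2.1), by linear_combination h1⟩⟩
  · rintro ⟨x, y, z⟩ -
    set s' := {q ∈ s | (w q).2 = (x, y, z)} with hs'
    rcases s'.eq_empty_or_nonempty with he | ⟨q₀, hq₀⟩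
    · rw [he]; simp
    have hsub : ∀ q ∈ s', q ∈ s ∧ (w q).2 = (x, y, z) := fun q hq => mem_filter.1 hq
    obtain ⟨m', -, h1, h2, h3, h4, h5, h6, h7, h8, -⟩ := hw q₀ (hsub q₀ hq₀).1
    rw [(hsub q₀ hq₀).2] at h1 h2 h3 h4 h5 h6 h7 h8
    simp only at h1 h2 h3 h4 h5 h6 h7 h8
    have hne : x * y * z ≠ 0 := fun H => hm0 (by rw [h1, H, mul_zero])
    have hm'0 : m' ≠ 0 := fun H => hm0 (by rw [h1, H, zero_mul])
    have hm'B : |m'| ≤ B := by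
      refine le_trans ?_ hm
      rw [h1, abs_mul]
      exact le_mul_of_one_le_right (abs_nonneg _) (Int.one_le_abs hne)
    have hz0 : z ≠ 0 := right_ne_zero_of_mul hne
    have hxy0 : x * y ≠ 0 := left_ne_zero_of_mul hne
    rw [← card_image_of_injOn (f := fun q => (w q).1) (s := s')]
    · refine card_quads_le hT hM hML hNM hB hL hn hr hm'0 (left_ne_zero_of_mul hxy0)
        (right_ne_zero_of_mul hxy0) hz0 ?_ h2 h3 h4 h5 hnB hm'B h6 h7 h8 _ fun q hq => ?_
      · rw [h1] at hnm
        exact hnm.of_mul_right_left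
      · obtain ⟨v, hv, rfl⟩ := mem_image.1 hq
        obtain ⟨m'', H, e, -⟩ := hw v (hsub v hv).1
        rw [(hsub v hv).2] at H e
        have : m'' = m' := mul_right_cancel₀ hne (e.symm.trans h1)
        rwa [this] at H
    · intro q hq q' hq' e
      have hq := hsub q hq
      have hq' := hsub q' hq'
      obtain ⟨-, -, -, -, -, -, -, -, -, -, e1, e2, e3⟩ := hw q hq.1
      obtain ⟨-, -, -, -, -, -, -, -, -, -, e1', e2', e3'⟩ := hw q' hq'.1
      simp only at e
      rw [← e, hq'.2, ← hq.2] at e1' e2' e3'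
      exact hg hq.1 hq'.1 (Prod.ext (e1.trans e1'.symm)
        (Prod.ext (e2.trans e2'.symm) (e3.trans e3'.symm)))

theorem card_le_of_eq (hT : DivisorBound T L) (hB : 1 ≤ B) (hL : 3 * B ^ 7 ≤ L) (hn : 1 ≤ n)
    (hm0 : m ≠ 0) (hm : |m| ≤ B)
    (s : Finset α) (g : α → ℤ × ℤ × ℤ) (hg : Set.InjOn g s)
    (hs : ∀ q ∈ s, IsSol B n m r N (g q).1 (g q).2.1 (g q).2.2 ∧ (g q).1 = (g q).2.1) :
    s.card ≤ 2 * T := by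
  classical
  refine card_le_of_hyperbola hT n m (2 * m) 0 s (fun q => ((g q).1, (g q).2.2)) ?_
    (fun _ => ⟨by linarith, ?_⟩) fun q hq => ?_
  · intro q hq q' hq' e
    simp only [Prod.mk.injEq] at e
    exact hg hq hq' (Prod.ext e.1 (Prod.ext
      ((hs q hq).2.symm.trans (e.1.trans (hs q' hq').2)) e.2))
  · refine le_trans ?_ hL
    have h2 : m ^ 2 ≤ B ^ 2 := sq_le_sq' (by linarith [neg_abs_le m]) (by linarith [le_abs_self m])
    have h3 : B ^ 2 ≤ B ^ 7 := pow_le_pow_right₀ hB (by norm_num)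
    rw [show 2 * m * m + n * 0 = 2 * m ^ 2 by ring, abs_of_nonneg (by positivity)]
    have : 0 ≤ B ^ 7 := by positivity
    linarith
  · obtain ⟨h, e⟩ := hs q hq
    have h1 := h.eq
    rw [← e] at h1
    have h2 : n * (g q).1 * (g q).2.2 = m * (g q).1 + 2 * m * (g q).2.2 + 0 :=
      mul_left_cancel₀ h.ne_zero₁ (by linear_combination h1)
    refine ⟨h2, fun H => h.ne_zero₁ ?_, h.ne₃⟩
    simp only at H
    rw [H] at h2
    exact mul_left_cancel₀ hm0 (by linarith)

theorem card_solutions_le (hT : DivisorBound T L) (hM : 1 ≤ M) (hML : 2 * M ^ 2 ≤ L)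
    (hNM : N ≤ M ^ 3) (hB : 1 ≤ B) (hL : 3 * B ^ 7 ≤ L) (hn : 1 ≤ n) (hr : r ≠ 0) (hm0 : m ≠ 0)
    (hnm : IsCoprime n m) (hnB : n ≤ B) (hm : |m| ≤ B)
    (s : Finset α) (g : α → ℤ × ℤ × ℤ) (hg : Set.InjOn g s)
    (hs : ∀ q ∈ s, IsSol B n m r N (g q).1 (g q).2.1 (g q).2.2) :
    s.card ≤ 7494 * T ^ 7 * M ^ 2 := by
  classical
  have hg' : ∀ q ∈ s, ∀ q' ∈ s, (g q).1 = (g q').1 → (g q).2.1 = (g q').2.1 →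
      (g q).2.2 = (g q').2.2 → q = q' := fun q hq q' hq' h1 h2 h3 =>
    hg hq hq' (Prod.ext h1 (Prod.ext h2 h3))
  have e₁₂ := card_le_of_eq (N := N) (r := r) hT hB hL hn hm0 hm {q ∈ s | (g q).1 = (g q).2.1} g
    (hg.mono (filter_subset _ _))
    fun q hq => ⟨hs q (mem_filter.1 hq).1, (mem_filter.1 hq).2⟩
  have e₁₃ := card_le_of_eq (N := N) (r := r) hT hB hL hn hm0 hm {q ∈ s | (g q).1 = (g q).2.2}
    (fun q => ((g q).1, (g q).2.2, (g q).2.1))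
    (fun q hq q' hq' e => by
      simp only [Prod.mk.injEq] at e
      exact hg' q (mem_filter.1 hq).1 q' (mem_filter.1 hq').1 e.1 e.2.2 e.2.1)
    fun q hq => ⟨(hs q (mem_filter.1 hq).1).swap₂₃, (mem_filter.1 hq).2⟩
  have e₂₃ := card_le_of_eq (N := N) (r := r) hT hB hL hn hm0 hm {q ∈ s | (g q).2.1 = (g q).2.2}
    (fun q => ((g q).2.1, (g q).2.2, (g q).1))
    (fun q hq q' hq' e => by
      simp only [Prod.mk.injEq] at e
      exact hg' q (mem_filter.1 hq).1 q' (mem_filter.1 hq').1 e.2.2 e.1 e.2.1)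
    fun q hq => ⟨(hs q (mem_filter.1 hq).1).swap₁₂.swap₂₃, (mem_filter.1 hq).2⟩
  have main : ∀ σ : ℤ × ℤ × ℤ → ℤ × ℤ × ℤ, Function.Injective σ →
      (∀ q ∈ s, IsSol B n m r N (σ (g q)).1 (σ (g q)).2.1 (σ (g q)).2.2) →
      {q ∈ s | IsOrdered (σ (g q)).1 (σ (g q)).2.1 (σ (g q)).2.2}.card ≤
        1248 * T ^ 7 * M ^ 2 := fun σ hσ h =>
    card_le_of_isOrdered hT hM hML hNM hB hL hn hr hm0 hnm hnB hm _ (fun q => σ (g q))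
      (fun q hq q' hq' e => hg (mem_filter.1 hq).1 (mem_filter.1 hq').1 (hσ e))
      fun q hq => ⟨h q (mem_filter.1 hq).1, (mem_filter.1 hq).2⟩
  have o₁ := main id Function.injective_id hs
  have o₂ := main (fun X => (X.1, X.2.2, X.2.1)) (fun ⟨_, _, _⟩ ⟨_, _, _⟩ e => by simp_all)
    fun q hq => (hs q hq).swap₂₃
  have o₃ := main (fun X => (X.2.1, X.1, X.2.2)) (fun ⟨_, _, _⟩ ⟨_, _, _⟩ e => by simp_all)
    fun q hq => (hs q hq).swap₁₂
  have o₄ := main (fun X => (X.2.1, X.2.2, X.1)) (fun ⟨_, _, _⟩ ⟨_, _, _⟩ e => by simp_all)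
    fun q hq => (hs q hq).swap₁₂.swap₂₃
  have o₅ := main (fun X => (X.2.2, X.1, X.2.1)) (fun ⟨_, _, _⟩ ⟨_, _, _⟩ e => by simp_all)
    fun q hq => (hs q hq).swap₂₃.swap₁₂
  have o₆ := main (fun X => (X.2.2, X.2.1, X.1)) (fun ⟨_, _, _⟩ ⟨_, _, _⟩ e => by simp_all)
    fun q hq => (hs q hq).swap₂₃.swap₁₂.swap₂₃
  simp only [id_eq] at o₁ o₂ o₃ o₄ o₅ o₆
  have hT1 : 1 ≤ T := hT.one_le (le_trans (Nat.one_le_pow _ _ hM) (by omega : M ^ 2 ≤ L))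
  have hT7 : T ≤ T ^ 7 * M ^ 2 := by
    calc T ≤ T ^ 7 := Nat.le_self_pow (by norm_num) T
      _ ≤ _ := Nat.le_mul_of_pos_right _ (by positivity)
  refine (card_le_card (t := {q ∈ s | (g q).1 = (g q).2.1} ∪ ({q ∈ s | (g q).1 = (g q).2.2} ∪
    ({q ∈ s | (g q).2.1 = (g q).2.2} ∪
    ({q ∈ s | IsOrdered (g q).1 (g q).2.1 (g q).2.2} ∪
    ({q ∈ s | IsOrdered (g q).1 (g q).2.2 (g q).2.1} ∪
    ({q ∈ s | IsOrdered (g q).2.1 (g q).1 (g q).2.2} ∪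
    ({q ∈ s | IsOrdered (g q).2.1 (g q).2.2 (g q).1} ∪
    ({q ∈ s | IsOrdered (g q).2.2 (g q).1 (g q).2.1} ∪
    {q ∈ s | IsOrdered (g q).2.2 (g q).2.1 (g q).1}))))))))
    fun q hq => ?_).trans <| (card_union_le _ _).trans <|
    (Nat.add_le_add e₁₂ <| (card_union_le _ _).trans <| Nat.add_le_add e₁₃ <|
    (card_union_le _ _).trans <| Nat.add_le_add e₂₃ <| (card_union_le _ _).trans <|
    Nat.add_le_add o₁ <| (card_union_le _ _).trans <| Nat.add_le_add o₂ <|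
    (card_union_le _ _).trans <| Nat.add_le_add o₃ <| (card_union_le _ _).trans <|
    Nat.add_le_add o₄ <| (card_union_le _ _).trans <| Nat.add_le_add o₅ o₆).trans ?_
  · simp only [mem_union, mem_filter, hq, true_and]
    by_contra! H
    obtain ⟨h1, h2, h3, h⟩ := H
    generalize (g q).1 = X at h h1 h2
    generalize (g q).2.1 = Y at h h1 h3
    generalize (g q).2.2 = Z at h h2 h3
    have tot : ∀ X Y Z : ℤ, X ≠ Y → X ≠ Z → Y ≠ Z → |X| ≤ |Y| → |X| ≤ |Z| →
        IsOrdered X Y Z ∨ IsOrdered X Z Y := fun X Y Z h1 h2 h3 h4 h5 => by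
      rcases le_total (|Y| * Int.gcd X Z) (|Z| * Int.gcd X Y) with h | h
      · exact Or.inl ⟨h2, h3, h4, h5, h⟩
      · exact Or.inr ⟨h1, h3.symm, h5, h4, h⟩
    have t1 := tot X Y Z h1 h2 h3
    have t2 := tot Y X Z h1.symm h3 h2
    have t3 := tot Z X Y h2.symm h3.symm h1
    obtain ⟨n1, n2, n3, n4, n5, n6⟩ := h
    rcases le_total |X| |Y| with a | a
    · rcases le_total |X| |Z| with b | b
      · exact (t1 a b).elim n1 n2
      · exact (t3 b (b.trans a)).elim n5 n6
    · rcases le_total |Y| |Z| with c | c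
      · exact (t2 a c).elim n3 n4
      · exact (t3 (c.trans a) c).elim n5 n6
  · nlinarith

end solutions

theorem ZMod.eq_zero_of_intCast_eq_zero_of_abs_lt {p : ℕ} {k : ℤ} (h : (k : ZMod p) = 0)
    (hk : |k| < p) : k = 0 :=
  Int.eq_zero_of_abs_lt_dvd ((ZMod.intCast_zmod_eq_zero_iff_dvd k p).1 h) hk

section modular

variable {p T L : ℕ} {N : ℤ} {α : Type*}

/-- Solutions of `(v + κ) (w + κ) = ν ^ 2` modulo `p` in a short interval. -/
theorem card_le_of_two_mod [Fact p.Prime] (hT : DivisorBound T L) (hN : 1 ≤ N)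
    (hp : 54 * N ^ 6 < p)
    (hL : 9 * N ^ 4 ≤ L) (κ ν : ZMod p) (hν : ν ≠ 0) (s : Finset α) (g : α → ℤ × ℤ)
    (hg : Set.InjOn g s)
    (hs : ∀ q ∈ s, (1 ≤ (g q).1 ∧ (g q).1 ≤ N) ∧ (1 ≤ (g q).2 ∧ (g q).2 ≤ N) ∧
      ((g q).1 + κ) * ((g q).2 + κ) = ν ^ 2) : s.card ≤ 2 * T := by
  classical
  have hN6 : ∀ k ≤ 6, N ^ k ≤ N ^ 6 := fun k hk => pow_le_pow_right₀ hN hk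
  have hN0 : 0 ≤ N := by linarith
  have hT1 : 1 ≤ T := hT.one_le (by
    have : 1 ≤ N ^ 4 := one_le_pow₀ hN
    have : (1 : ℤ) ≤ L := by linarith
    exact_mod_cast this)
  have b₁ : ∀ q ∈ s, 0 ≤ (g q).1 + (g q).2 ∧ (g q).1 + (g q).2 ≤ 2 * N := fun q hq => by
    obtain ⟨h1, h2, -⟩ := hs q hq
    constructor <;> linarith
  have b₂ : ∀ q ∈ s, 0 ≤ (g q).1 * (g q).2 ∧ (g q).1 * (g q).2 ≤ N ^ 2 := fun q hq => by
    obtain ⟨⟨h1, h2⟩, ⟨h3, h4⟩, -⟩ := hs q hq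
    exact ⟨mul_nonneg (by linarith) (by linarith), by rw [sq]; gcongr⟩
  have d₁ : ∀ q ∈ s, ∀ q' ∈ s, |((g q).1 + (g q).2) - ((g q').1 + (g q').2)| ≤ 2 * N :=
    fun q hq q' hq' => abs_sub_le_of_nonneg_of_le (b₁ q hq).1 (b₁ q hq).2 (b₁ q' hq').1 (b₁ q' hq').2
  have d₂ : ∀ q ∈ s, ∀ q' ∈ s, |(g q).1 * (g q).2 - (g q').1 * (g q').2| ≤ N ^ 2 :=
    fun q hq q' hq' => abs_sub_le_of_nonneg_of_le (b₂ q hq).1 (b₂ q hq).2 (b₂ q' hq').1 (b₂ q' hq').2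
  have rel : ∀ q ∈ s, ∀ q' ∈ s, (((g q).1 * (g q).2 - (g q').1 * (g q').2 : ℤ) : ZMod p) +
      κ * (((g q).1 + (g q).2) - ((g q').1 + (g q').2) : ℤ) = 0 := fun q hq q' hq' => by
    push_cast
    linear_combination (hs q hq).2.2 - (hs q' hq').2.2
  by_cases h : ∃ q₀ ∈ s, ∃ q₁ ∈ s, (g q₁).1 + (g q₁).2 ≠ (g q₀).1 + (g q₀).2
  · obtain ⟨q₀, hq₀, q₁, hq₁, hne⟩ := h
    set e₁ := ((g q₁).1 + (g q₁).2) - ((g q₀).1 + (g q₀).2) with he₁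
    set e₂ := (g q₁).1 * (g q₁).2 - (g q₀).1 * (g q₀).2 with he₂
    have he₁0 : e₁ ≠ 0 := sub_ne_zero.2 hne
    have he₁b : |e₁| ≤ 2 * N := d₁ q₁ hq₁ q₀ hq₀
    have he₂b : |e₂| ≤ N ^ 2 := d₂ q₁ hq₁ q₀ hq₀
    have hr : (e₂ : ZMod p) + κ * e₁ = 0 := rel q₁ hq₁ q₀ hq₀
    have he₁p : (e₁ : ZMod p) ≠ 0 := fun H => he₁0
      (ZMod.eq_zero_of_intCast_eq_zero_of_abs_lt H (by
        have := hN6 1 (by norm_num)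
        linarith))
    set k := e₁ * ((g q₀).1 * (g q₀).2) - e₂ * ((g q₀).1 + (g q₀).2) with hk
    have hline : ∀ q ∈ s, e₁ * ((g q).1 * (g q).2) - e₂ * ((g q).1 + (g q).2) = k := fun q hq => by
      refine sub_eq_zero.1 (ZMod.eq_zero_of_intCast_eq_zero_of_abs_lt (p := p) ?_ ?_)
      · have := rel q hq q₀ hq₀
        rw [hk]
        push_cast at this hr ⊢
        linear_combination e₁ * this - ((((g q).1 : ZMod p) + (g q).2) - ((g q₀).1 + (g q₀).2)) * hr
      · have h1 := d₁ q hq q₀ hq₀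
        have h2 := d₂ q hq q₀ hq₀
        have e : e₁ * ((g q).1 * (g q).2) - e₂ * ((g q).1 + (g q).2) - k =
          e₁ * ((g q).1 * (g q).2 - (g q₀).1 * (g q₀).2) -
            e₂ * (((g q).1 + (g q).2) - ((g q₀).1 + (g q₀).2)) := by rw [hk]; ring
        rw [e]
        refine (abs_sub _ _).trans_lt ?_
        rw [abs_mul, abs_mul]
        have h3 : |e₁| * |(g q).1 * (g q).2 - (g q₀).1 * (g q₀).2| ≤ 2 * N * N ^ 2 := by gcongr
        have h4 : |e₂| * |(g q).1 + (g q).2 - ((g q₀).1 + (g q₀).2)| ≤ N ^ 2 * (2 * N) := by gcongr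
        have := hN6 3 (by norm_num)
        have : 0 ≤ N ^ 3 := by positivity
        linarith [show 2 * N * N ^ 2 = 2 * N ^ 3 by ring, show N ^ 2 * (2 * N) = 2 * N ^ 3 by ring]
    refine card_le_of_hyperbola hT e₁ e₂ e₂ k s g hg (fun _ => ⟨he₁0, le_trans ?_ hL⟩)
      fun q hq => ⟨by linear_combination hline q hq, ?_⟩
    · have hkb : |k| ≤ 4 * N ^ 3 := by
        refine (abs_sub _ _).trans ?_
        rw [abs_mul e₁, abs_mul e₂, abs_of_nonneg (b₁ q₀ hq₀).1, abs_of_nonneg (b₂ q₀ hq₀).1]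
        have h1 := (b₁ q₀ hq₀).1
        have h2 := (b₂ q₀ hq₀).1
        have h3 := (b₁ q₀ hq₀).2
        have h4 := (b₂ q₀ hq₀).2
        calc _ ≤ 2 * N * N ^ 2 + N ^ 2 * (2 * N) := by gcongr
          _ = _ := by ring
      refine (abs_add_le _ _).trans ?_
      rw [abs_mul, abs_mul]
      calc _ ≤ N ^ 2 * N ^ 2 + 2 * N * (4 * N ^ 3) := by gcongr
        _ = _ := by ring
    · have hprod : ∀ v : ℤ, (v + κ : ZMod p) ≠ 0 → e₁ * v ≠ e₂ := fun v hv H => by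
        refine mul_ne_zero he₁p hv ?_
        have : (e₁ : ZMod p) * v = e₂ := by exact_mod_cast congrArg (Int.cast : ℤ → ZMod p) H
        linear_combination this + hr
      have h1 : ((g q).1 + κ : ZMod p) * ((g q).2 + κ) ≠ 0 := by
        rw [(hs q hq).2.2]; exact pow_ne_zero 2 hν
      exact ⟨hprod _ (left_ne_zero_of_mul h1), hprod _ (right_ne_zero_of_mul h1)⟩
  · push Not at h
    rcases s.eq_empty_or_nonempty with rfl | ⟨q₀, hq₀⟩
    · simp
    have h2 : ∀ q ∈ s, (g q).1 * (g q).2 = (g q₀).1 * (g q₀).2 := fun q hq => by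
      have := rel q hq q₀ hq₀
      rw [h q₀ hq₀ q hq, sub_self, Int.cast_zero, mul_zero, add_zero] at this
      refine sub_eq_zero.1 (ZMod.eq_zero_of_intCast_eq_zero_of_abs_lt this
        ((d₂ q hq q₀ hq₀).trans_lt ?_))
      have := hN6 2 (by norm_num)
      have : 0 ≤ N ^ 2 := by positivity
      linarith
    have : s.card ≤ ({(g q₀).1, (g q₀).2} : Finset ℤ).card := by
      refine card_le_card_of_injOn (fun q => (g q).1) (fun q hq => ?_) fun q hq q' hq' e => ?_
      · have h3 := h q₀ hq₀ q hq
        have h4 : ((g q).1 - (g q₀).1) * ((g q).1 - (g q₀).2) = 0 := by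
          linear_combination (g q).1 * h3 - h2 q hq
        simp only [coe_insert, coe_singleton, Set.mem_insert_iff, Set.mem_singleton_iff]
        rcases mul_eq_zero.1 h4 with h5 | h5
        · exact Or.inl (by linarith)
        · exact Or.inr (by linarith)
      · simp only at e
        exact hg hq hq' (Prod.ext e (by
          have := h q₀ hq₀ q hq
          have := h q₀ hq₀ q' hq'
          linarith))
    have := this.trans card_le_two
    omega

/-- The integers `u₁, u₂, u₃` lie in `[1, N]` and `x i = a + u i` is a solution modulo `p` of
`x₁⁻¹ + x₂⁻¹ + x₃⁻¹ = μ⁻¹`, with no `x i` equal to `0` or `μ`. -/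
structure IsModSol (p : ℕ) (N : ℤ) (a μ : ZMod p) (u₁ u₂ u₃ : ℤ) : Prop where
  pos₁ : 1 ≤ u₁
  pos₂ : 1 ≤ u₂
  pos₃ : 1 ≤ u₃
  le₁ : u₁ ≤ N
  le₂ : u₂ ≤ N
  le₃ : u₃ ≤ N
  ne_zero₁ : a + u₁ ≠ 0
  ne_zero₂ : a + u₂ ≠ 0
  ne_zero₃ : a + u₃ ≠ 0
  ne₁ : a + u₁ ≠ μ
  ne₂ : a + u₂ ≠ μ
  ne₃ : a + u₃ ≠ μ
  eq : (a + u₁) * (a + u₂) * (a + u₃) =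
    μ * ((a + u₁) * (a + u₂) + (a + u₁) * (a + u₃) + (a + u₂) * (a + u₃))

theorem mul_sub_eq_sq {F : Type*} [Field F] {μ x y z : F} (hxμ : x ≠ μ)
    (h : x * y * z = μ * (x * y + x * z + y * z)) :
    (y - μ * x / (x - μ)) * (z - μ * x / (x - μ)) = (μ * x / (x - μ)) ^ 2 := by
  have hx : x - μ ≠ 0 := sub_ne_zero.2 hxμ
  have h1 : (μ * x / (x - μ)) * (x - μ) = μ * x := div_mul_cancel₀ _ hx
  generalize μ * x / (x - μ) = ν at *
  refine mul_left_cancel₀ hx ?_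
  linear_combination h - (y + z) * h1

theorem card_fiber_modSol_le [Fact p.Prime] (hT : DivisorBound T L) (hN : 1 ≤ N)
    (hp : 54 * N ^ 6 < p)
    (hL : 9 * N ^ 4 ≤ L) {a μ : ZMod p} (hμ : μ ≠ 0) (s : Finset α)
    (g : α → ℤ × ℤ × ℤ) (hg : Set.InjOn g s)
    (hs : ∀ q ∈ s, IsModSol p N a μ (g q).1 (g q).2.1 (g q).2.2) (w : ℤ)
    (hw : ∀ q ∈ s, (g q).1 = w) : s.card ≤ 2 * T := by
  rcases s.eq_empty_or_nonempty with rfl | ⟨q₀, hq₀⟩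
  · simp
  have hw0 : a + w ≠ 0 := by rw [← hw _ hq₀]; exact (hs _ hq₀).ne_zero₁
  have hwμ : a + w ≠ μ := by rw [← hw _ hq₀]; exact (hs _ hq₀).ne₁
  refine card_le_of_two_mod hT hN hp hL (a - μ * (a + w) / (a + w - μ)) (μ * (a + w) / (a + w - μ))
    (div_ne_zero (mul_ne_zero hμ hw0) (sub_ne_zero.2 hwμ)) s (fun q => (g q).2)
    (fun q hq q' hq' e => hg hq hq' (Prod.ext ((hw q hq).trans (hw q' hq').symm) e))
    fun q hq => ?_
  have h := hs q hq
  refine ⟨⟨h.pos₂, h.le₂⟩, ⟨h.pos₃, h.le₃⟩, ?_⟩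
  have e := h.eq
  rw [hw q hq] at e
  rw [← mul_sub_eq_sq hwμ e]
  ring

end modular

/-- The elementary symmetric functions of a triple. -/
def esymm₃ (u : ℤ × ℤ × ℤ) : ℤ × ℤ × ℤ :=
  (u.1 + u.2.1 + u.2.2, u.1 * u.2.1 + u.1 * u.2.2 + u.2.1 * u.2.2, u.1 * u.2.1 * u.2.2)

theorem card_fiber_esymm₃_le (s : Finset (ℤ × ℤ × ℤ)) (w : ℤ × ℤ × ℤ) :
    {u ∈ s | esymm₃ u = w}.card ≤ 6 := by
  rcases {u ∈ s | esymm₃ u = w}.eq_empty_or_nonempty with h | ⟨⟨a, b, c⟩, hq⟩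
  · rw [h]; simp
  have hw := (mem_filter.1 hq).2
  refine (card_le_card (t := {(a, b, c), (a, c, b), (b, a, c), (b, c, a), (c, a, b), (c, b, a)})
    fun ⟨x, y, z⟩ hu => ?_).trans card_le_six
  have hu := (mem_filter.1 hu).2
  rw [← hw] at hu
  simp only [esymm₃, Prod.mk.injEq] at hu
  obtain ⟨h1, h2, h3⟩ := hu
  have two : ∀ {b c y z : ℤ}, y + z = b + c → y * z = b * c → (y = b ∧ z = c) ∨ (y = c ∧ z = b) :=
    fun {b c y z} h h' => by
      have : (y - b) * (y - c) = 0 := by linear_combination y * h - h'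
      rcases mul_eq_zero.1 this with H | H
      · exact Or.inl ⟨by linarith, by linarith⟩
      · exact Or.inr ⟨by linarith, by linarith⟩
  have hx : (x - a) * ((x - b) * (x - c)) = 0 := by
    linear_combination x ^ 2 * h1 - x * h2 + h3
  simp only [mem_insert, mem_singleton, Prod.mk.injEq]
  rcases mul_eq_zero.1 hx with H | H
  · obtain rfl : x = a := by linarith
    have := two (b := b) (c := c) (y := y) (z := z) (by linarith)
      (by linear_combination h2 - x * h1)
    rcases this with ⟨rfl, rfl⟩ | ⟨rfl, rfl⟩ <;> simp
  · rcases mul_eq_zero.1 H with H | H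
    · obtain rfl : x = b := by linarith
      have := two (b := a) (c := c) (y := y) (z := z) (by linarith)
        (by linear_combination h2 - x * h1)
      rcases this with ⟨rfl, rfl⟩ | ⟨rfl, rfl⟩ <;> simp
    · obtain rfl : x = c := by linarith
      have := two (b := a) (c := b) (y := y) (z := z) (by linarith)
        (by linear_combination h2 - x * h1)
      rcases this with ⟨rfl, rfl⟩ | ⟨rfl, rfl⟩ <;> simp

/-- The resultant of a monic cubic and a quadratic `q` is unchanged when a multiple of `q` is added
to the cubic. -/
theorem prod_quadratic_eq {F : Type*} [CommRing F] {e₁ e₂ e₃ u₁ u₂ u₃ v₁ v₂ v₃ τ : F}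
    (h₁ : u₁ + u₂ + u₃ = v₁ + v₂ + v₃ + τ * e₁)
    (h₂ : u₁ * u₂ + u₁ * u₃ + u₂ * u₃ = v₁ * v₂ + v₁ * v₃ + v₂ * v₃ + τ * e₂)
    (h₃ : u₁ * u₂ * u₃ = v₁ * v₂ * v₃ + τ * e₃) :
    (e₁ * u₁ ^ 2 - e₂ * u₁ + e₃) * (e₁ * u₂ ^ 2 - e₂ * u₂ + e₃) * (e₁ * u₃ ^ 2 - e₂ * u₃ + e₃) =
    (e₁ * v₁ ^ 2 - e₂ * v₁ + e₃) * (e₁ * v₂ ^ 2 - e₂ * v₂ + e₃) *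
      (e₁ * v₃ ^ 2 - e₂ * v₃ + e₃) := by
  have key : ∀ u₁ u₂ u₃ s₁ s₂ s₃ : F, u₁ + u₂ + u₃ = s₁ → u₁ * u₂ + u₁ * u₃ + u₂ * u₃ = s₂ →
      u₁ * u₂ * u₃ = s₃ →
      (e₁ * u₁ ^ 2 - e₂ * u₁ + e₃) * (e₁ * u₂ ^ 2 - e₂ * u₂ + e₃) *
        (e₁ * u₃ ^ 2 - e₂ * u₃ + e₃) =
      e₁ ^ 3 * s₃ ^ 2 - e₁ ^ 2 * e₂ * s₃ * s₂ + e₁ ^ 2 * e₃ * (s₂ ^ 2 - 2 * s₁ * s₃) +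
        e₁ * e₂ ^ 2 * s₁ * s₃ - e₁ * e₂ * e₃ * (s₁ * s₂ - 3 * s₃) +
        e₁ * e₃ ^ 2 * (s₁ ^ 2 - 2 * s₂) - e₂ ^ 3 * s₃ + e₂ ^ 2 * e₃ * s₂ - e₂ * e₃ ^ 2 * s₁ +
        e₃ ^ 3 := by
    rintro u₁ u₂ u₃ _ _ _ rfl rfl rfl
    ring
  rw [key u₁ u₂ u₃ _ _ _ h₁ h₂ h₃, key v₁ v₂ v₃ _ _ _ rfl rfl rfl]
  ring

theorem exists_eq_mul_of_cross {F : Type*} [Field F] {e₁ e₂ e₃ f₁ f₂ f₃ : F}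
    (he : e₁ ≠ 0 ∨ e₂ ≠ 0) (h₁ : e₁ * f₂ = e₂ * f₁) (h₂ : e₁ * f₃ = e₃ * f₁)
    (h₃ : e₂ * f₃ = e₃ * f₂) : ∃ τ, f₁ = τ * e₁ ∧ f₂ = τ * e₂ ∧ f₃ = τ * e₃ := by
  rcases he with h | h
  · refine ⟨f₁ / e₁, ?_, ?_, ?_⟩ <;> field_simp
    · linear_combination h₁
    · linear_combination h₂
  · refine ⟨f₂ / e₂, ?_, ?_, ?_⟩ <;> field_simp
    · linear_combination -h₁
    · linear_combination h₃

section modular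

variable {p T L : ℕ} {N : ℤ} {a μ : ZMod p}

namespace IsModSol

variable {u₁ u₂ u₃ : ℤ}

theorem swap₁₂ (h : IsModSol p N a μ u₁ u₂ u₃) : IsModSol p N a μ u₂ u₁ u₃ where
  pos₁ := h.pos₂
  pos₂ := h.pos₁
  pos₃ := h.pos₃
  le₁ := h.le₂
  le₂ := h.le₁
  le₃ := h.le₃
  ne_zero₁ := h.ne_zero₂
  ne_zero₂ := h.ne_zero₁
  ne_zero₃ := h.ne_zero₃
  ne₁ := h.ne₂
  ne₂ := h.ne₁
  ne₃ := h.ne₃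
  eq := by linear_combination h.eq

theorem swap₁₃ (h : IsModSol p N a μ u₁ u₂ u₃) : IsModSol p N a μ u₃ u₂ u₁ where
  pos₁ := h.pos₃
  pos₂ := h.pos₂
  pos₃ := h.pos₁
  le₁ := h.le₃
  le₂ := h.le₂
  le₃ := h.le₁
  ne_zero₁ := h.ne_zero₃
  ne_zero₂ := h.ne_zero₂
  ne_zero₃ := h.ne_zero₁
  ne₁ := h.ne₃
  ne₂ := h.ne₂
  ne₃ := h.ne₁
  eq := by linear_combination h.eq

theorem one_le (h : IsModSol p N a μ u₁ u₂ u₃) : 1 ≤ N := h.pos₁.trans h.le₁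

theorem esymm₃_bounds (h : IsModSol p N a μ u₁ u₂ u₃) :
    (0 ≤ (esymm₃ (u₁, u₂, u₃)).1 ∧ (esymm₃ (u₁, u₂, u₃)).1 ≤ 3 * N) ∧
    (0 ≤ (esymm₃ (u₁, u₂, u₃)).2.1 ∧ (esymm₃ (u₁, u₂, u₃)).2.1 ≤ 3 * N ^ 2) ∧
    (0 ≤ (esymm₃ (u₁, u₂, u₃)).2.2 ∧ (esymm₃ (u₁, u₂, u₃)).2.2 ≤ N ^ 3) := by
  have h1 : 0 ≤ u₁ := by linarith [h.pos₁]
  have h2 : 0 ≤ u₂ := by linarith [h.pos₂]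
  have h3 : 0 ≤ u₃ := by linarith [h.pos₃]
  have h4 := h.le₁
  have h5 := h.le₂
  have h6 := h.le₃
  have h7 : 0 ≤ N := h1.trans h4
  refine ⟨⟨by simp only [esymm₃]; positivity, by simp only [esymm₃]; linarith⟩,
    ⟨by simp only [esymm₃]; positivity, ?_⟩, ⟨by simp only [esymm₃]; positivity, ?_⟩⟩
  · calc u₁ * u₂ + u₁ * u₃ + u₂ * u₃ ≤ N * N + N * N + N * N := by gcongr
      _ = _ := by ring
  · calc u₁ * u₂ * u₃ ≤ N * N * N := by gcongr
      _ = _ := by ring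

theorem esymm₃_eq (h : IsModSol p N a μ u₁ u₂ u₃) :
    ((esymm₃ (u₁, u₂, u₃)).2.2 : ZMod p) + (a - μ) * (esymm₃ (u₁, u₂, u₃)).2.1 +
      (a ^ 2 - 2 * a * μ) * (esymm₃ (u₁, u₂, u₃)).1 + (a ^ 3 - 3 * a ^ 2 * μ) = 0 := by
  simp only [esymm₃]
  push_cast
  linear_combination h.eq

end IsModSol

/-- Differences of symmetric functions of solutions. -/
theorem abs_esymm₃_sub_le {P Q : ℤ × ℤ × ℤ} (hP : IsModSol p N a μ P.1 P.2.1 P.2.2)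
    (hQ : IsModSol p N a μ Q.1 Q.2.1 Q.2.2) :
    |(esymm₃ P - esymm₃ Q).1| ≤ 3 * N ∧ |(esymm₃ P - esymm₃ Q).2.1| ≤ 3 * N ^ 2 ∧
      |(esymm₃ P - esymm₃ Q).2.2| ≤ N ^ 3 := by
  obtain ⟨⟨p1, p2⟩, ⟨p3, p4⟩, p5, p6⟩ := hP.esymm₃_bounds
  obtain ⟨⟨q1, q2⟩, ⟨q3, q4⟩, q5, q6⟩ := hQ.esymm₃_bounds
  exact ⟨abs_sub_le_of_nonneg_of_le p1 p2 q1 q2, abs_sub_le_of_nonneg_of_le p3 p4 q3 q4,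
    abs_sub_le_of_nonneg_of_le p5 p6 q5 q6⟩

theorem esymm₃_sub_eq {P Q : ℤ × ℤ × ℤ} (hP : IsModSol p N a μ P.1 P.2.1 P.2.2)
    (hQ : IsModSol p N a μ Q.1 Q.2.1 Q.2.2) :
    ((esymm₃ P - esymm₃ Q).2.2 : ZMod p) + (a - μ) * (esymm₃ P - esymm₃ Q).2.1 +
      (a ^ 2 - 2 * a * μ) * (esymm₃ P - esymm₃ Q).1 = 0 := by
  have h1 := hP.esymm₃_eq
  have h2 := hQ.esymm₃_eq
  simp only [Prod.fst_sub, Prod.snd_sub]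
  push_cast
  linear_combination h1 - h2

theorem card_le_of_root [Fact p.Prime] (hT : DivisorBound T L)
    (hp : 54 * N ^ 6 < p) (hL : 343 * N ^ 9 ≤ L) (hμ : μ ≠ 0) {e₁ e₂ e₃ : ℤ}
    (he : e₁ ≠ 0 ∨ e₂ ≠ 0) (s : Finset (ℤ × ℤ × ℤ)) (g : ℤ × ℤ × ℤ → ℤ × ℤ × ℤ)
    (hg : Set.InjOn g s) (hs : ∀ q ∈ s, IsModSol p N a μ (g q).1 (g q).2.1 (g q).2.2)
    (h0 : ∀ q ∈ s, e₁ * (g q).1 ^ 2 - e₂ * (g q).1 + e₃ = 0) : s.card ≤ 6 * T := by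
  rcases s.eq_empty_or_nonempty with rfl | ⟨q₀, hq₀⟩
  · simp
  have hN := (hs _ hq₀).one_le
  have hN4 : N ^ 4 ≤ N ^ 9 := pow_le_pow_right₀ hN (by norm_num)
  have hN0 : 0 ≤ N ^ 9 := by positivity
  have h3 : (s.image fun q => (g q).1).card ≤ 3 := by
    refine card_le_three_of_cubic 0 e₁ (-e₂) e₃ (Or.inr (by simpa using he)) _ fun t ht => ?_
    obtain ⟨q, hq, rfl⟩ := mem_image.1 ht
    linear_combination h0 q hq
  have := card_le_mul_card_image_of_maps_to (fun q hq => mem_image_of_mem (fun q => (g q).1) hq)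
    (2 * T) fun w _ => card_fiber_modSol_le hT hN hp (by linarith) hμ
    {q ∈ s | (g q).1 = w} g (hg.mono (filter_subset _ _)) (fun q hq => hs q (mem_filter.1 hq).1) w
    (fun q hq => (mem_filter.1 hq).2)
  calc _ ≤ _ := this
    _ ≤ 2 * T * 3 := by gcongr
    _ = _ := by ring

/-- Solutions whose symmetric functions lie on a line. -/
theorem card_le_of_collinear [Fact p.Prime] (hT : DivisorBound T L)
    (hp : 54 * N ^ 6 < p) (hL : 343 * N ^ 9 ≤ L) (hμ : μ ≠ 0) (s : Finset (ℤ × ℤ × ℤ))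
    (hs : ∀ P ∈ s, IsModSol p N a μ P.1 P.2.1 P.2.2) {P₀ P₁ : ℤ × ℤ × ℤ} (hP₀ : P₀ ∈ s)
    (hP₁ : P₁ ∈ s) (hne : esymm₃ P₁ ≠ esymm₃ P₀) {e : ℤ × ℤ × ℤ} (he : esymm₃ P₁ - esymm₃ P₀ = e)
    (h₁ : ∀ P ∈ s, e.1 * (esymm₃ P - esymm₃ P₀).2.1 = e.2.1 * (esymm₃ P - esymm₃ P₀).1)
    (h₂ : ∀ P ∈ s, e.1 * (esymm₃ P - esymm₃ P₀).2.2 = e.2.2 * (esymm₃ P - esymm₃ P₀).1)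
    (h₃ : ∀ P ∈ s, e.2.1 * (esymm₃ P - esymm₃ P₀).2.2 = e.2.2 * (esymm₃ P - esymm₃ P₀).2.1) :
    s.card ≤ 216 * T ^ 3 := by
  classical
  obtain ⟨e₁, e₂, e₃⟩ := e
  simp only at h₁ h₂ h₃
  have hN := (hs _ hP₀).one_le
  have hN0 : 0 ≤ N := by linarith
  have hT1 : 1 ≤ T := hT.one_le (by
    have : 1 ≤ N ^ 9 := one_le_pow₀ hN
    have : (1 : ℤ) ≤ L := by linarith
    exact_mod_cast this)
  obtain ⟨b1, b2, b3⟩ := abs_esymm₃_sub_le (hs _ hP₁) (hs _ hP₀)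
  have rel := esymm₃_sub_eq (hs _ hP₁) (hs _ hP₀)
  rw [he] at b1 b2 b3 rel
  simp only at b1 b2 b3 rel
  have he' : e₁ ≠ 0 ∨ e₂ ≠ 0 := by
    by_contra! H
    obtain ⟨rfl, rfl⟩ := H
    refine hne (sub_eq_zero.1 ?_)
    have : e₃ = 0 := by
      refine ZMod.eq_zero_of_intCast_eq_zero_of_abs_lt (p := p) (by simpa using rel)
        (b3.trans_lt ?_)
      have : N ^ 3 ≤ N ^ 6 := pow_le_pow_right₀ hN (by norm_num)
      have : 0 ≤ N ^ 6 := by positivity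
      linarith
    rw [he, this]
    rfl
  let f : ℤ → ℤ := fun t => e₁ * t ^ 2 - e₂ * t + e₃
  set R := f P₀.1 * f P₀.2.1 * f P₀.2.2 with hR
  have hprod : ∀ P ∈ s, f P.1 * f P.2.1 * f P.2.2 = R := fun P hP => by
    have k1 := congrArg (Int.cast : ℤ → ℚ) (h₁ P hP)
    have k2 := congrArg (Int.cast : ℤ → ℚ) (h₂ P hP)
    have k3 := congrArg (Int.cast : ℤ → ℚ) (h₃ P hP)
    rw [Int.cast_mul, Int.cast_mul] at k1 k2 k3
    obtain ⟨τ, t1, t2, t3⟩ := exists_eq_mul_of_cross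
      (by simpa only [ne_eq, Int.cast_eq_zero] using he') k1 k2 k3
    simp only [Prod.fst_sub, Prod.snd_sub, esymm₃] at t1 t2 t3
    push_cast at t1 t2 t3
    have := prod_quadratic_eq (F := ℚ) (e₁ := e₁) (e₂ := e₂) (e₃ := e₃) (τ := τ)
      (u₁ := P.1) (u₂ := P.2.1) (u₃ := P.2.2) (v₁ := P₀.1) (v₂ := P₀.2.1) (v₃ := P₀.2.2)
      (by linarith) (by linarith) (by linarith)
    simp only [hR, f]
    exact_mod_cast this
  have hfb : ∀ t, 1 ≤ t → t ≤ N → |f t| ≤ 7 * N ^ 3 := fun t ht htN => by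
    have ht0 : 0 ≤ t := by linarith
    refine (abs_add_le _ _).trans (le_trans (add_le_add (abs_sub _ _) b3) ?_)
    rw [abs_mul, abs_mul, abs_of_nonneg ht0, abs_of_nonneg (pow_nonneg ht0 2)]
    calc _ ≤ 3 * N * N ^ 2 + 3 * N ^ 2 * N + N ^ 3 := by gcongr
      _ = _ := by ring
  have hRL : |R| ≤ L := by
    have H := hs _ hP₀
    refine le_trans ?_ hL
    rw [hR, abs_mul, abs_mul]
    calc _ ≤ 7 * N ^ 3 * (7 * N ^ 3) * (7 * N ^ 3) := by
          gcongr
          exacts [hfb _ H.pos₁ H.le₁, hfb _ H.pos₂ H.le₂, hfb _ H.pos₃ H.le₃]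
      _ = _ := by ring
  by_cases hR0 : R = 0
  · have c₁ := card_le_of_root hT hp hL hμ he' (e₃ := e₃) {P ∈ s | f P.1 = 0} id
      (Set.injOn_id _) (fun q hq => hs q (mem_filter.1 hq).1) fun q hq => (mem_filter.1 hq).2
    have c₂ := card_le_of_root hT hp hL hμ he' (e₃ := e₃) {P ∈ s | f P.2.1 = 0}
      (fun P => (P.2.1, P.1, P.2.2)) (fun ⟨_, _, _⟩ _ ⟨_, _, _⟩ _ e => by simp_all)
      (fun q hq => (hs q (mem_filter.1 hq).1).swap₁₂) fun q hq => (mem_filter.1 hq).2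
    have c₃ := card_le_of_root hT hp hL hμ he' (e₃ := e₃) {P ∈ s | f P.2.2 = 0}
      (fun P => (P.2.2, P.2.1, P.1)) (fun ⟨_, _, _⟩ _ ⟨_, _, _⟩ _ e => by simp_all)
      (fun q hq => (hs q (mem_filter.1 hq).1).swap₁₃) fun q hq => (mem_filter.1 hq).2
    have hsub : s ⊆ {P ∈ s | f P.1 = 0} ∪ ({P ∈ s | f P.2.1 = 0} ∪ {P ∈ s | f P.2.2 = 0}) :=
      fun P hP => by
        have := (hprod P hP).trans hR0
        simp only [mem_union, mem_filter, hP, true_and]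
        rcases mul_eq_zero.1 this with h | h
        · exact (mul_eq_zero.1 h).imp_right Or.inl
        · exact Or.inr (Or.inr h)
    have hT3 : T ≤ T ^ 3 := Nat.le_self_pow (by norm_num) T
    have := (card_le_card hsub).trans ((card_union_le _ _).trans
      (Nat.add_le_add c₁ ((card_union_le _ _).trans (Nat.add_le_add c₂ c₃))))
    linarith
  · set W := {t ∈ Icc 1 N | f t ∣ R} with hW
    have hWc : W.card ≤ 6 * T := by
      have := card_le_mul_card_image_of_maps_to (s := W) (t := signedDivisors R) (f := f)
        (fun t ht => mem_signedDivisors hR0 (mem_filter.1 ht).2) 3 fun w _ =>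
          card_le_three_of_cubic 0 e₁ (-e₂) (e₃ - w) (Or.inr (by simpa using he')) _
            fun t ht => by
              have : e₁ * t ^ 2 - e₂ * t + e₃ = w := (mem_filter.1 ht).2
              linear_combination this
      have h2 := card_signedDivisors_le hT hR0 hRL
      omega
    have hsub : s ⊆ W ×ˢ W ×ˢ W := fun P hP => by
      have H := hs P hP
      have := hprod P hP
      simp only [mem_product, hW, mem_filter, mem_Icc]
      exact ⟨⟨⟨H.pos₁, H.le₁⟩, ⟨f P.2.1 * f P.2.2, by linear_combination -this⟩⟩,
        ⟨⟨H.pos₂, H.le₂⟩, ⟨f P.1 * f P.2.2, by linear_combination -this⟩⟩,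
        ⟨⟨H.pos₃, H.le₃⟩, ⟨f P.1 * f P.2.1, by linear_combination -this⟩⟩⟩
    calc _ ≤ _ := card_le_card hsub
      _ = W.card * (W.card * W.card) := by rw [card_product, card_product]
      _ ≤ 6 * T * (6 * T * (6 * T)) := by gcongr
      _ = _ := by ring

end modular

theorem exists_primitive {w₁ w₂ w₃ : ℤ} (hw : ¬(w₁ = 0 ∧ w₂ = 0 ∧ w₃ = 0)) :
    ∃ g e₁ e₂ e₃ r₁ r₂ r₃ : ℤ, 0 < g ∧ w₁ = g * e₁ ∧ w₂ = g * e₂ ∧ w₃ = g * e₃ ∧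
      r₁ * e₁ + r₂ * e₂ + r₃ * e₃ = 1 := by
  have h₁ := Int.gcd_eq_gcd_ab w₂ w₃
  set d : ℤ := (Int.gcd w₂ w₃ : ℤ) with hd
  have h₂ := Int.gcd_eq_gcd_ab w₁ d
  set g : ℤ := (Int.gcd w₁ d : ℤ) with hg
  have hd₂ : d ∣ w₂ := Int.gcd_dvd_left ..
  have hd₃ : d ∣ w₃ := Int.gcd_dvd_right ..
  have hgd : g ∣ d := Int.gcd_dvd_right ..
  obtain ⟨e₁, he₁⟩ : g ∣ w₁ := Int.gcd_dvd_left ..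
  obtain ⟨e₂, he₂⟩ := hgd.trans hd₂
  obtain ⟨e₃, he₃⟩ := hgd.trans hd₃
  have hg0 : g ≠ 0 := fun h => hw (by rw [he₁, he₂, he₃, h]; simp)
  have hpos : 0 < g := lt_of_le_of_ne (by rw [hg]; positivity) hg0.symm
  refine ⟨g, e₁, e₂, e₃, w₁.gcdA d, w₂.gcdA w₃ * w₁.gcdB d, w₂.gcdB w₃ * w₁.gcdB d, hpos, he₁,
    he₂, he₃, mul_left_cancel₀ hg0 ?_⟩
  linear_combination -h₂ - w₁.gcdB d * h₁ - w₁.gcdA d * he₁ -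
    w₂.gcdA w₃ * w₁.gcdB d * he₂ - w₂.gcdB w₃ * w₁.gcdB d * he₃

/-- The scalar product of integer vectors. -/
def dot₃ (c X : ℤ × ℤ × ℤ) : ℤ := c.1 * X.1 + c.2.1 * X.2.1 + c.2.2 * X.2.2

/-- The triple product of integer vectors. -/
def triple₃ (q X Y : ℤ × ℤ × ℤ) : ℤ :=
  q.1 * (X.2.1 * Y.2.2 - X.2.2 * Y.2.1) + q.2.1 * (X.2.2 * Y.1 - X.1 * Y.2.2) +
    q.2.2 * (X.1 * Y.2.1 - X.2.1 * Y.1)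

/-- The number of points of a two-dimensional lattice in a region bounded by the triangle
`P₀, P₁, P₂` of normalised area `t`. -/
theorem card_le_of_coplanar (s : Finset (ℤ × ℤ × ℤ)) {c q P₀ P₁ P₂ : ℤ × ℤ × ℤ}
    (hqc : dot₃ q c = 1) (h₁ : dot₃ c (P₁ - P₀) = 0) (h₂ : dot₃ c (P₂ - P₀) = 0)
    (hs : ∀ P ∈ s, dot₃ c (P - P₀) = 0) {t : ℤ} (ht : triple₃ q (P₁ - P₀) (P₂ - P₀) = t)
    (ht0 : t ≠ 0) (ha : ∀ P ∈ s, |triple₃ q (P - P₀) (P₁ - P₀)| ≤ |t|)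
    (hb : ∀ P ∈ s, |triple₃ q (P - P₁) (P₂ - P₁)| ≤ |t|) : (s.card : ℤ) ≤ 9 * |t| := by
  obtain ⟨c₁, c₂, c₃⟩ := c
  obtain ⟨q₁, q₂, q₃⟩ := q
  obtain ⟨x₀, y₀, z₀⟩ := P₀
  obtain ⟨x₁, y₁, z₁⟩ := P₁
  obtain ⟨x₂, y₂, z₂⟩ := P₂
  simp only [dot₃, triple₃, Prod.fst_sub, Prod.snd_sub] at *
  have hw : ¬(x₂ - x₁ = 0 ∧ y₂ - y₁ = 0 ∧ z₂ - z₁ = 0) := fun ⟨e1, e2, e3⟩ => ht0 <| by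
    rw [← ht, sub_eq_zero.1 e1, sub_eq_zero.1 e2, sub_eq_zero.1 e3]
    ring
  obtain ⟨g, e₁, e₂, e₃, r₁, r₂, r₃, hg, hx, hy, hz, hr⟩ := exists_primitive hw
  have hce : c₁ * e₁ + c₂ * e₂ + c₃ * e₃ = 0 := by
    refine (mul_eq_zero.1 (?_ : g * _ = 0)).resolve_left hg.ne'
    linear_combination h₂ - h₁ - c₁ * hx - c₂ * hy - c₃ * hz
  set f : ℤ := q₁ * ((y₁ - y₀) * e₃ - (z₁ - z₀) * e₂) + q₂ * ((z₁ - z₀) * e₁ - (x₁ - x₀) * e₃) +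
    q₃ * ((x₁ - x₀) * e₂ - (y₁ - y₀) * e₁) with hf
  have hgf : t = g * f := by
    rw [← ht, hf]
    linear_combination (q₂ * (z₁ - z₀) - q₃ * (y₁ - y₀)) * hx +
      (q₃ * (x₁ - x₀) - q₁ * (z₁ - z₀)) * hy + (q₁ * (y₁ - y₀) - q₂ * (x₁ - x₀)) * hz
  have hf0 : f ≠ 0 := fun h => ht0 (by rw [hgf, h, mul_zero])
  have htabs : |t| = g * |f| := by rw [hgf, abs_mul, abs_of_pos hg]
  have hfpos : 0 < |f| := abs_pos.2 hf0
  let k : ℤ × ℤ × ℤ → ℤ := fun P => q₁ * ((P.2.1 - y₁) * e₃ - (P.2.2 - z₁) * e₂) +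
    q₂ * ((P.2.2 - z₁) * e₁ - (P.1 - x₁) * e₃) + q₃ * ((P.1 - x₁) * e₂ - (P.2.1 - y₁) * e₁)
  let j : ℤ × ℤ × ℤ → ℤ := fun P => q₁ * ((P.2.1 - y₀) * (z₁ - z₀) - (P.2.2 - z₀) * (y₁ - y₀)) +
    q₂ * ((P.2.2 - z₀) * (x₁ - x₀) - (P.1 - x₀) * (z₁ - z₀)) +
    q₃ * ((P.1 - x₀) * (y₁ - y₀) - (P.2.1 - y₀) * (x₁ - x₀))
  have hmaps : ∀ P ∈ s, (k P, j P / |f|) ∈ Icc (-|f|) |f| ×ˢ Icc (-g) g := fun P hP => by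
    have hk : |k P| ≤ |f| := by
      have := hb P hP
      rw [hx, hy, hz, htabs] at this
      refine le_of_mul_le_mul_left (le_trans (le_of_eq ?_) this) hg
      rw [← abs_of_pos hg, ← abs_mul, abs_of_pos hg]
      simp only [k]
      ring_nf
    have hj : |j P| ≤ g * |f| := htabs ▸ ha P hP
    rw [mem_product, mem_Icc, mem_Icc]
    refine ⟨abs_le.1 hk, ?_, ?_⟩
    · rw [Int.le_ediv_iff_mul_le hfpos]
      linarith [(abs_le.1 hj).1]
    · exact Int.ediv_le_of_le_mul hfpos (abs_le.1 hj).2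
  have hinj : Set.InjOn (fun P => (k P, j P / |f|)) s := by
    rintro ⟨x, y, z⟩ hP ⟨x', y', z'⟩ hP' h
    obtain ⟨hk, hj⟩ := Prod.mk.inj h
    have hc := hs _ hP
    have hc' := hs _ hP'
    simp only at hc hc'
    have hk0 : q₁ * ((y - y') * e₃ - (z - z') * e₂) + q₂ * ((z - z') * e₁ - (x - x') * e₃) +
        q₃ * ((x - x') * e₂ - (y - y') * e₁) = 0 := by
      simp only [k] at hk
      linear_combination hk
    have hX : c₁ * (x - x') + c₂ * (y - y') + c₃ * (z - z') = 0 := by linear_combination hc - hc'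
    have u₁ : (y - y') * e₃ - (z - z') * e₂ = 0 := by
      linear_combination c₁ * hk0 - ((y - y') * e₃ - (z - z') * e₂) * hqc +
        (q₂ * e₃ - q₃ * e₂) * hX - (q₂ * (z - z') - q₃ * (y - y')) * hce
    have u₂ : (z - z') * e₁ - (x - x') * e₃ = 0 := by
      linear_combination c₂ * hk0 - ((z - z') * e₁ - (x - x') * e₃) * hqc +
        (q₃ * e₁ - q₁ * e₃) * hX - (q₃ * (x - x') - q₁ * (z - z')) * hce
    have u₃ : (x - x') * e₂ - (y - y') * e₁ = 0 := by
      linear_combination c₃ * hk0 - ((x - x') * e₂ - (y - y') * e₁) * hqc +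
        (q₁ * e₂ - q₂ * e₁) * hX - (q₁ * (y - y') - q₂ * (x - x')) * hce
    set l := r₁ * (x - x') + r₂ * (y - y') + r₃ * (z - z') with hl
    have l₁ : x - x' = l * e₁ := by
      linear_combination -(x - x') * hr + r₂ * u₃ - r₃ * u₂
    have l₂ : y - y' = l * e₂ := by
      linear_combination -(y - y') * hr - r₁ * u₃ + r₃ * u₁
    have l₃ : z - z' = l * e₃ := by
      linear_combination -(z - z') * hr + r₁ * u₂ - r₂ * u₁
    have hjj : j (x, y, z) - j (x', y', z') = -(l * f) := by
      simp only [j, hf]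
      linear_combination (q₃ * (y₁ - y₀) - q₂ * (z₁ - z₀)) * l₁ +
        (q₁ * (z₁ - z₀) - q₃ * (x₁ - x₀)) * l₂ + (q₂ * (x₁ - x₀) - q₁ * (y₁ - y₀)) * l₃
    have hdvd : |f| ∣ j (x, y, z) - j (x', y', z') := by
      rw [hjj, abs_dvd]
      exact (dvd_mul_left _ _).neg_right
    have heq : j (x, y, z) = j (x', y', z') := by
      rw [← Int.mul_ediv_add_emod (j (x, y, z)) |f|, ← Int.mul_ediv_add_emod (j (x', y', z')) |f|,
        hj, Int.emod_eq_emod_iff_emod_sub_eq_zero.2 (Int.emod_eq_zero_of_dvd hdvd)]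
    have hl0 : l = 0 := by
      rw [heq, sub_self] at hjj
      exact (mul_eq_zero.1 (neg_eq_zero.1 hjj.symm)).resolve_right hf0
    rw [hl0, zero_mul] at l₁ l₂ l₃
    rw [sub_eq_zero.1 l₁, sub_eq_zero.1 l₂, sub_eq_zero.1 l₃]
  have := card_le_card_of_injOn _ hmaps hinj
  rw [card_product, Int.card_Icc, Int.card_Icc] at this
  have h3 : (s.card : ℤ) ≤ (2 * |f| + 1) * (2 * g + 1) := by
    zify at this
    rw [Int.toNat_of_nonneg (by linarith), Int.toNat_of_nonneg (by linarith)] at this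
    linarith
  rw [htabs]
  calc _ ≤ _ := h3
    _ ≤ (2 * |f| + |f|) * (2 * g + g) := by gcongr <;> linarith
    _ = _ := by ring

/-- The vector product of integer vectors. -/
def cross₃ (X Y : ℤ × ℤ × ℤ) : ℤ × ℤ × ℤ :=
  (X.2.1 * Y.2.2 - X.2.2 * Y.2.1, X.2.2 * Y.1 - X.1 * Y.2.2, X.1 * Y.2.1 - X.2.1 * Y.1)

theorem triple₃_mul_of_dot₃_eq_zero {c q X Y : ℤ × ℤ × ℤ} (hqc : dot₃ q c = 1)
    (hX : dot₃ c X = 0) (hY : dot₃ c Y = 0) : triple₃ q X Y * c.2.2 = (cross₃ X Y).2.2 := by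
  simp only [dot₃, triple₃, cross₃] at *
  linear_combination (X.1 * Y.2.1 - X.2.1 * Y.1) * hqc - (q.1 * Y.2.1 - q.2.1 * Y.1) * hX +
    (q.1 * X.2.1 - q.2.1 * X.1) * hY

theorem abs_mul_sub_mul_le {x y z w a b c d : ℤ} (hx : |x| ≤ a) (hy : |y| ≤ b) (hz : |z| ≤ c)
    (hw : |w| ≤ d) : |x * y - z * w| ≤ a * b + c * d := by
  refine (abs_sub _ _).trans ?_
  rw [abs_mul, abs_mul]
  have := abs_nonneg x
  have := abs_nonneg z
  gcongr <;> linarith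

theorem abs_dot₃_le {c X : ℤ × ℤ × ℤ} {a₁ a₂ a₃ b₁ b₂ b₃ : ℤ} (h₁ : |c.1| ≤ a₁)
    (h₂ : |c.2.1| ≤ a₂) (h₃ : |c.2.2| ≤ a₃) (k₁ : |X.1| ≤ b₁) (k₂ : |X.2.1| ≤ b₂)
    (k₃ : |X.2.2| ≤ b₃) : |dot₃ c X| ≤ a₁ * b₁ + a₂ * b₂ + a₃ * b₃ := by
  refine (abs_add_le _ _).trans (add_le_add ((abs_add_le _ _).trans ?_) ?_)
  all_goals simp only [abs_mul]
  · have := abs_nonneg c.1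
    have := abs_nonneg c.2.1
    gcongr <;> linarith
  · have := abs_nonneg c.2.2
    gcongr
    linarith

section modular

variable {p T L : ℕ} {N : ℤ} {a μ : ZMod p}

section triples

variable {P Q R : ℤ × ℤ × ℤ}

theorem abs_cross₃_le (hP : IsModSol p N a μ P.1 P.2.1 P.2.2)
    (hQ : IsModSol p N a μ Q.1 Q.2.1 Q.2.2) (hR : IsModSol p N a μ R.1 R.2.1 R.2.2) :
    |(cross₃ (esymm₃ Q - esymm₃ P) (esymm₃ R - esymm₃ P)).1| ≤ 6 * N ^ 5 ∧
    |(cross₃ (esymm₃ Q - esymm₃ P) (esymm₃ R - esymm₃ P)).2.1| ≤ 6 * N ^ 4 ∧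
    |(cross₃ (esymm₃ Q - esymm₃ P) (esymm₃ R - esymm₃ P)).2.2| ≤ 18 * N ^ 3 := by
  obtain ⟨a1, a2, a3⟩ := abs_esymm₃_sub_le hQ hP
  obtain ⟨b1, b2, b3⟩ := abs_esymm₃_sub_le hR hP
  exact ⟨(abs_mul_sub_mul_le a2 b3 a3 b2).trans_eq (by ring),
    (abs_mul_sub_mul_le a3 b1 a1 b3).trans_eq (by ring),
    (abs_mul_sub_mul_le a1 b2 a2 b1).trans_eq (by ring)⟩

theorem cross₃_fst_eq (hP : IsModSol p N a μ P.1 P.2.1 P.2.2)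
    (hQ : IsModSol p N a μ Q.1 Q.2.1 Q.2.2) (hR : IsModSol p N a μ R.1 R.2.1 R.2.2) :
    ((cross₃ (esymm₃ Q - esymm₃ P) (esymm₃ R - esymm₃ P)).1 : ZMod p) =
    (a ^ 2 - 2 * a * μ) * (cross₃ (esymm₃ Q - esymm₃ P) (esymm₃ R - esymm₃ P)).2.2 := by
  have h1 := esymm₃_sub_eq hQ hP
  have h2 := esymm₃_sub_eq hR hP
  simp only [cross₃, Int.cast_sub, Int.cast_mul]
  linear_combination ((esymm₃ Q - esymm₃ P).2.1 : ZMod p) * h2 - (esymm₃ R - esymm₃ P).2.1 * h1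

theorem cross₃_snd_eq (hP : IsModSol p N a μ P.1 P.2.1 P.2.2)
    (hQ : IsModSol p N a μ Q.1 Q.2.1 Q.2.2) (hR : IsModSol p N a μ R.1 R.2.1 R.2.2) :
    ((cross₃ (esymm₃ Q - esymm₃ P) (esymm₃ R - esymm₃ P)).2.1 : ZMod p) =
    (a - μ) * (cross₃ (esymm₃ Q - esymm₃ P) (esymm₃ R - esymm₃ P)).2.2 := by
  have h1 := esymm₃_sub_eq hQ hP
  have h2 := esymm₃_sub_eq hR hP
  simp only [cross₃, Int.cast_sub, Int.cast_mul]
  linear_combination ((esymm₃ R - esymm₃ P).1 : ZMod p) * h1 - (esymm₃ Q - esymm₃ P).1 * h2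

theorem cross₃_eq_zero (hP : IsModSol p N a μ P.1 P.2.1 P.2.2)
    (hQ : IsModSol p N a μ Q.1 Q.2.1 Q.2.2) (hR : IsModSol p N a μ R.1 R.2.1 R.2.2)
    (hp : 54 * N ^ 6 < p)
    (h : (cross₃ (esymm₃ Q - esymm₃ P) (esymm₃ R - esymm₃ P)).2.2 = 0) :
    cross₃ (esymm₃ Q - esymm₃ P) (esymm₃ R - esymm₃ P) = 0 := by
  have hN := hP.one_le
  have k1 : N ^ 5 ≤ N ^ 6 := pow_le_pow_right₀ hN (by norm_num)
  have k2 : N ^ 4 ≤ N ^ 6 := pow_le_pow_right₀ hN (by norm_num)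
  have k3 : 1 ≤ N ^ 6 := one_le_pow₀ hN
  obtain ⟨a1, a2, a3⟩ := abs_cross₃_le hP hQ hR
  have e1 := cross₃_fst_eq hP hQ hR
  have e2 := cross₃_snd_eq hP hQ hR
  rw [h, Int.cast_zero, mul_zero] at e1 e2
  exact Prod.ext (ZMod.eq_zero_of_intCast_eq_zero_of_abs_lt e1 (by linarith))
    (Prod.ext (ZMod.eq_zero_of_intCast_eq_zero_of_abs_lt e2 (by linarith)) h)

theorem dot₃_cross₃_eq_zero (hP : IsModSol p N a μ P.1 P.2.1 P.2.2)
    (hQ : IsModSol p N a μ Q.1 Q.2.1 Q.2.2) (hR : IsModSol p N a μ R.1 R.2.1 R.2.2)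
    (hp : 54 * N ^ 6 < p) {U : ℤ × ℤ × ℤ}
    (hU : IsModSol p N a μ U.1 U.2.1 U.2.2) :
    dot₃ (cross₃ (esymm₃ Q - esymm₃ P) (esymm₃ R - esymm₃ P)) (esymm₃ U - esymm₃ P) = 0 := by
  obtain ⟨a1, a2, a3⟩ := abs_cross₃_le hP hQ hR
  obtain ⟨b1, b2, b3⟩ := abs_esymm₃_sub_le hU hP
  refine ZMod.eq_zero_of_intCast_eq_zero_of_abs_lt (p := p) ?_
    ((abs_dot₃_le a1 a2 a3 b1 b2 b3).trans_lt (lt_of_eq_of_lt (by ring) hp))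
  have e1 := cross₃_fst_eq hP hQ hR
  have e2 := cross₃_snd_eq hP hQ hR
  have h := esymm₃_sub_eq hU hP
  simp only [dot₃, Int.cast_add, Int.cast_mul]
  rw [e1, e2]
  linear_combination
    ((cross₃ (esymm₃ Q - esymm₃ P) (esymm₃ R - esymm₃ P)).2.2 : ZMod p) * h

end triples

/-- The integer plane containing the symmetric functions of the solutions. -/
structure IsPlane (p : ℕ) (N : ℤ) (a μ : ZMod p) (s : Finset (ℤ × ℤ × ℤ))
    (t α β γ δ : ℤ) : Prop where
  pos : 0 < t
  card_le : s.card ≤ 54 * t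
  hα : t * |α| ≤ 18 * N ^ 3
  hβ : t * |β| ≤ 6 * N ^ 4
  hγ : t * |γ| ≤ 6 * N ^ 5
  hδ : t * |δ| ≤ 54 * N ^ 6
  ne_zero : (α : ZMod p) ≠ 0
  β_eq : (β : ZMod p) = (a - μ) * α
  γ_eq : (γ : ZMod p) = (a ^ 2 - 2 * a * μ) * α
  δ_eq : (δ : ZMod p) = (a ^ 3 - 3 * a ^ 2 * μ) * α
  eq : ∀ P ∈ s, α * (esymm₃ P).2.2 + β * (esymm₃ P).2.1 + γ * (esymm₃ P).1 + δ = 0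

theorem card_le_or_exists_isPlane [Fact p.Prime] (hT : DivisorBound T L)
    (hp : 54 * N ^ 6 < p) (hL : 343 * N ^ 9 ≤ L) (hμ : μ ≠ 0) (s : Finset (ℤ × ℤ × ℤ))
    (hs : ∀ P ∈ s, IsModSol p N a μ P.1 P.2.1 P.2.2) :
    s.card ≤ 216 * T ^ 3 ∨ ∃ t α β γ δ, IsPlane p N a μ s t α β γ δ := by
  classical
  rcases s.eq_empty_or_nonempty with rfl | hne
  · simp
  have hN : 1 ≤ N := (hs _ hne.choose_spec).one_le
  have hT1 : 1 ≤ T := hT.one_le (by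
    have : 1 ≤ N ^ 9 := one_le_pow₀ hN
    have : (1 : ℤ) ≤ L := by linarith
    exact_mod_cast this)
  let m : (ℤ × ℤ × ℤ) × (ℤ × ℤ × ℤ) × (ℤ × ℤ × ℤ) → ℤ := fun x =>
    |(cross₃ (esymm₃ x.2.1 - esymm₃ x.1) (esymm₃ x.2.2 - esymm₃ x.1)).2.2|
  obtain ⟨⟨P₀, P₁, P₂⟩, hx, hmax⟩ := exists_max_image (s ×ˢ s ×ˢ s) m
    (hne.product (hne.product hne))
  obtain ⟨hP₀, hP₁, hP₂⟩ : P₀ ∈ s ∧ P₁ ∈ s ∧ P₂ ∈ s := by simpa using hx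
  replace hmax : ∀ P ∈ s, ∀ Q ∈ s, ∀ R ∈ s, m (P, Q, R) ≤ m (P₀, P₁, P₂) :=
    fun P hP Q hQ R hR => hmax _ (by simp [hP, hQ, hR])
  by_cases h0 : (cross₃ (esymm₃ P₁ - esymm₃ P₀) (esymm₃ P₂ - esymm₃ P₀)).2.2 = 0
  · left
    have hzero : ∀ P ∈ s, ∀ Q ∈ s, ∀ R ∈ s,
        cross₃ (esymm₃ Q - esymm₃ P) (esymm₃ R - esymm₃ P) = 0 := fun P hP Q hQ R hR => by
      refine cross₃_eq_zero (hs P hP) (hs Q hQ) (hs R hR) hp (abs_eq_zero.1 (le_antisymm ?_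
        (abs_nonneg _)))
      refine (hmax P hP Q hQ R hR).trans_eq ?_
      simp only [m, h0, abs_zero]
    by_cases hall : ∀ P ∈ s, esymm₃ P = esymm₃ P₀
    · have := card_fiber_esymm₃_le s (esymm₃ P₀)
      rw [filter_true_of_mem hall] at this
      have : 1 ≤ T ^ 3 := Nat.one_le_pow _ _ hT1
      omega
    · push Not at hall
      obtain ⟨Q, hQ, hQne⟩ := hall
      have hz := fun P hP => hzero P₀ hP₀ Q hQ P hP
      refine card_le_of_collinear hT hp hL hμ s hs hP₀ hQ hQne rfl (fun P hP => ?_)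
        (fun P hP => ?_) fun P hP => ?_
      · have := congrArg (fun x => x.2.2) (hz P hP)
        exact sub_eq_zero.1 this
      · have := congrArg (fun x => x.2.1) (hz P hP)
        exact (sub_eq_zero.1 this).symm
      · have := congrArg (fun x => x.1) (hz P hP)
        exact sub_eq_zero.1 this
  right
  obtain ⟨b₁, b₂, b₃⟩ := abs_cross₃_le (hs _ hP₀) (hs _ hP₁) (hs _ hP₂)
  have e₁ := cross₃_fst_eq (hs _ hP₀) (hs _ hP₁) (hs _ hP₂)
  have e₂ := cross₃_snd_eq (hs _ hP₀) (hs _ hP₁) (hs _ hP₂)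
  have hdot := fun P hP => dot₃_cross₃_eq_zero (hs _ hP₀) (hs _ hP₁) (hs _ hP₂) hp (hs P hP)
  have hm0 : m (P₀, P₁, P₂) = |(cross₃ (esymm₃ P₁ - esymm₃ P₀) (esymm₃ P₂ - esymm₃ P₀)).2.2| := rfl
  obtain ⟨t, γ, β, α, q₁, q₂, q₃, ht, hγ, hβ, hα, hq⟩ := exists_primitive 
    (w₁ := (cross₃ (esymm₃ P₁ - esymm₃ P₀) (esymm₃ P₂ - esymm₃ P₀)).1)
    (w₂ := (cross₃ (esymm₃ P₁ - esymm₃ P₀) (esymm₃ P₂ - esymm₃ P₀)).2.1)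
    (w₃ := (cross₃ (esymm₃ P₁ - esymm₃ P₀) (esymm₃ P₂ - esymm₃ P₀)).2.2) (fun h => h0 h.2.2)
  have htri : triple₃ (q₁, q₂, q₃) (esymm₃ P₁ - esymm₃ P₀) (esymm₃ P₂ - esymm₃ P₀) =
    dot₃ (q₁, q₂, q₃) (cross₃ (esymm₃ P₁ - esymm₃ P₀) (esymm₃ P₂ - esymm₃ P₀)) := rfl
  have hdot' : ∀ P ∈ s, dot₃ (γ, β, α) (esymm₃ P - esymm₃ P₀) = 0 := fun P hP => by
    have := hdot P hP
    simp only [dot₃] at this ⊢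
    rw [hγ, hβ, hα] at this
    refine (mul_eq_zero.1 (?_ : t * _ = 0)).resolve_left ht.ne'
    linear_combination this
  rw [hα] at b₃ e₁ e₂ h0 hm0
  rw [hβ] at b₂ e₂
  rw [hγ] at b₁ e₁
  rw [dot₃, hγ, hβ, hα] at htri
  have htri : triple₃ (q₁, q₂, q₃) (esymm₃ P₁ - esymm₃ P₀) (esymm₃ P₂ - esymm₃ P₀) = t := by
    linear_combination htri + t * hq
  have hα0 : α ≠ 0 := fun h => h0 (by rw [h, mul_zero])
  have hα1 : 1 ≤ |α| := Int.one_le_abs hα0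
  rw [abs_mul, abs_of_pos ht] at b₁ b₂ b₃ hm0
  have hN3 : N ^ 3 ≤ N ^ 6 := pow_le_pow_right₀ hN (by norm_num)
  have hN6 : 1 ≤ N ^ 6 := one_le_pow₀ hN
  have ht1 : 1 * |α| ≤ t * |α| := by gcongr; linarith
  have ht2 : t * 1 ≤ t * |α| := by gcongr
  have hαp : (α : ZMod p) ≠ 0 := fun h =>
    hα0 (ZMod.eq_zero_of_intCast_eq_zero_of_abs_lt h (by linarith))
  have htp : (t : ZMod p) ≠ 0 := fun h => ht.ne'
    (ZMod.eq_zero_of_intCast_eq_zero_of_abs_lt h (by rw [abs_of_pos ht]; linarith))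
  push_cast at e₁ e₂
  have hβ_eq : (β : ZMod p) = (a - μ) * α := mul_left_cancel₀ htp (by linear_combination e₂)
  have hγ_eq : (γ : ZMod p) = (a ^ 2 - 2 * a * μ) * α :=
    mul_left_cancel₀ htp (by linear_combination e₁)
  have htriple : ∀ P ∈ s, ∀ Q ∈ s, ∀ R ∈ s,
      |triple₃ (q₁, q₂, q₃) (esymm₃ Q - esymm₃ P) (esymm₃ R - esymm₃ P)| ≤ |t| :=
    fun P hP Q hQ R hR => by
      have sub : ∀ Q ∈ s, dot₃ (γ, β, α) (esymm₃ Q - esymm₃ P) = 0 := fun Q hQ => by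
        have h1 := hdot' Q hQ
        have h2 := hdot' P hP
        simp only [dot₃, Prod.fst_sub, Prod.snd_sub] at h1 h2 ⊢
        linear_combination h1 - h2
      have h1 := triple₃_mul_of_dot₃_eq_zero (c := (γ, β, α)) (q := (q₁, q₂, q₃)) hq (sub Q hQ) (sub R hR)
      have h2 := hmax P hP Q hQ R hR
      rw [hm0] at h2
      simp only [m] at h2
      rw [← h1, abs_mul] at h2
      rw [abs_of_pos ht]
      exact le_of_mul_le_mul_right h2 (by linarith)
  have himage : ∀ v ∈ s.image esymm₃, ∃ P ∈ s, esymm₃ P = v := fun v hv => mem_image.1 hv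
  have hcard := card_le_of_coplanar (s.image esymm₃) (c := (γ, β, α)) (q := (q₁, q₂, q₃))
    (P₀ := esymm₃ P₀) (P₁ := esymm₃ P₁) (P₂ := esymm₃ P₂) hq (hdot' _ hP₁) (hdot' _ hP₂)
    (fun v hv => by obtain ⟨P, hP, rfl⟩ := himage v hv; exact hdot' P hP) htri ht.ne'
    (fun v hv => by
      obtain ⟨P, hP, rfl⟩ := himage v hv; exact htriple P₀ hP₀ P hP P₁ hP₁)
    (fun v hv => by
      obtain ⟨P, hP, rfl⟩ := himage v hv; exact htriple P₁ hP₁ P hP P₂ hP₂)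
  rw [abs_of_pos ht] at hcard
  have hcard2 := card_le_mul_card_image s (f := esymm₃) 6 fun w _ => card_fiber_esymm₃_le s w
  refine ⟨t, α, β, γ, -dot₃ (γ, β, α) (esymm₃ P₀), ht, ?_, b₃, b₂, b₁, ?_, hαp, hβ_eq, hγ_eq, ?_,
    fun P hP => ?_⟩
  · zify at hcard2
    linarith
  · obtain ⟨⟨p1, p2⟩, ⟨p3, p4⟩, p5, p6⟩ := (hs _ hP₀).esymm₃_bounds
    have hd := abs_dot₃_le (c := (t * γ, t * β, t * α)) (X := esymm₃ P₀)
      ((abs_mul _ _).trans_le ((abs_of_pos ht).symm ▸ b₁))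
      ((abs_mul _ _).trans_le ((abs_of_pos ht).symm ▸ b₂))
      ((abs_mul _ _).trans_le ((abs_of_pos ht).symm ▸ b₃)) ((abs_of_nonneg p1).trans_le p2)
      ((abs_of_nonneg p3).trans_le p4) ((abs_of_nonneg p5).trans_le p6)
    calc t * |-dot₃ (γ, β, α) (esymm₃ P₀)| = |dot₃ (t * γ, t * β, t * α) (esymm₃ P₀)| := by
          rw [abs_neg]
          nth_rw 1 [← abs_of_pos ht]
          rw [← abs_mul]
          simp only [dot₃]
          ring_nf
      _ ≤ _ := hd
      _ = _ := by ring
  · have := (hs _ hP₀).esymm₃_eq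
    simp only [dot₃]
    push_cast
    rw [hβ_eq, hγ_eq]
    linear_combination -(α : ZMod p) * this
  · have := hdot' P hP
    simp only [dot₃, Prod.fst_sub, Prod.snd_sub] at this ⊢
    linear_combination this

end modular

section modular

variable {p T L M : ℕ} {N : ℤ} {a μ : ZMod p} {s : Finset (ℤ × ℤ × ℤ)} {t α β γ δ : ℤ}

namespace IsPlane

theorem hessian₁_eq (h : IsPlane p N a μ s t α β γ δ) :
    ((β ^ 2 - α * γ : ℤ) : ZMod p) = α ^ 2 * μ ^ 2 := by
  push_cast
  rw [h.β_eq, h.γ_eq]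
  ring

theorem hessian₂_eq (h : IsPlane p N a μ s t α β γ δ) :
    ((α * δ - β * γ : ℤ) : ZMod p) = -2 * α ^ 2 * a * μ ^ 2 := by
  push_cast
  rw [h.β_eq, h.γ_eq, h.δ_eq]
  ring

theorem hessian₃_eq (h : IsPlane p N a μ s t α β γ δ) :
    ((γ ^ 2 - β * δ : ℤ) : ZMod p) = α ^ 2 * a ^ 2 * μ ^ 2 := by
  push_cast
  rw [h.β_eq, h.γ_eq, h.δ_eq]
  ring

theorem abs_hessian₁_le (h : IsPlane p N a μ s t α β γ δ) :
    t ^ 2 * |β ^ 2 - α * γ| ≤ 144 * N ^ 8 := by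
  have hβ := h.hβ
  have hα := h.hα
  have hγ := h.hγ
  rw [← abs_of_pos h.pos, ← abs_mul] at hβ hα hγ
  have := abs_mul_sub_mul_le hβ hβ hα hγ
  rw [← abs_of_pos (pow_pos h.pos 2), ← abs_mul]
  calc _ = |t * β * (t * β) - t * α * (t * γ)| := by ring_nf
    _ ≤ _ := this
    _ = _ := by ring

theorem abs_hessian₂_le (h : IsPlane p N a μ s t α β γ δ) :
    t ^ 2 * |α * δ - β * γ| ≤ 1008 * N ^ 9 := by
  have hβ := h.hβ
  have hα := h.hα
  have hγ := h.hγ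
  have hδ := h.hδ
  rw [← abs_of_pos h.pos, ← abs_mul] at hβ hα hγ hδ
  have := abs_mul_sub_mul_le hα hδ hβ hγ
  rw [← abs_of_pos (pow_pos h.pos 2), ← abs_mul]
  calc _ = |t * α * (t * δ) - t * β * (t * γ)| := by ring_nf
    _ ≤ _ := this
    _ = _ := by ring

theorem abs_hessian₃_le (h : IsPlane p N a μ s t α β γ δ) :
    t ^ 2 * |γ ^ 2 - β * δ| ≤ 360 * N ^ 10 := by
  have hβ := h.hβ
  have hγ := h.hγ
  have hδ := h.hδ
  rw [← abs_of_pos h.pos, ← abs_mul] at hβ hγ hδ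
  have := abs_mul_sub_mul_le hγ hγ hβ hδ
  rw [← abs_of_pos (pow_pos h.pos 2), ← abs_mul]
  calc _ = |t * γ * (t * γ) - t * β * (t * δ)| := by ring_nf
    _ ≤ _ := this
    _ = _ := by ring

/-- The case where the cubic form attached to the plane has nonzero discriminant. -/
theorem card_le_of_discrim_ne_zero (h : IsPlane p N a μ s t α β γ δ) (hN : 1 ≤ N)
    (hp : N ^ 46 < (p : ℤ) ^ 3) (hM : N ≤ M ^ 3)
    (hD : (α * δ - β * γ) ^ 2 - 4 * (β ^ 2 - α * γ) * (γ ^ 2 - β * δ) ≠ 0) :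
    s.card ≤ 1836 * M ^ 2 := by
  have ht := h.pos
  have hpD : (p : ℤ) ≤ |(α * δ - β * γ) ^ 2 - 4 * (β ^ 2 - α * γ) * (γ ^ 2 - β * δ)| := by
    by_contra! H
    refine hD (ZMod.eq_zero_of_intCast_eq_zero_of_abs_lt (p := p) ?_ H)
    have h1 := h.hessian₁_eq
    have h2 := h.hessian₂_eq
    have h3 := h.hessian₃_eq
    rw [Int.cast_sub, Int.cast_pow, Int.cast_mul, Int.cast_mul, h1, h2, h3]
    push_cast
    ring
  have h1 := h.abs_hessian₁_le
  have h2 := h.abs_hessian₂_le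
  have h3 := h.abs_hessian₃_le
  have ht2 : 0 < t ^ 2 := by positivity
  rw [← abs_of_pos ht2, ← abs_mul] at h1 h2 h3
  have h4 : |4 * (t ^ 2 * (β ^ 2 - α * γ))| ≤ 4 * (144 * N ^ 8) := by
    rw [abs_mul]
    simpa using h1
  have hb := abs_mul_sub_mul_le h2 h2 h4 h3
  have h5 : t ^ 4 * p ≤ 1223424 * N ^ 18 := by
    calc t ^ 4 * p ≤ t ^ 4 *
          |(α * δ - β * γ) ^ 2 - 4 * (β ^ 2 - α * γ) * (γ ^ 2 - β * δ)| := by gcongr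
      _ = |t ^ 2 * (α * δ - β * γ) * (t ^ 2 * (α * δ - β * γ)) -
          4 * (t ^ 2 * (β ^ 2 - α * γ)) * (t ^ 2 * (γ ^ 2 - β * δ))| := by
          rw [← abs_of_pos (pow_pos ht 4), ← abs_mul]
          ring_nf
      _ ≤ _ := hb
      _ = _ := by ring
  have h6 : (t ^ 4) ^ 3 * N ^ 46 ≤ (1223424 * (M : ℤ) ^ 8) ^ 3 * N ^ 46 := by
    calc (t ^ 4) ^ 3 * N ^ 46 ≤ (t ^ 4) ^ 3 * (p : ℤ) ^ 3 := by gcongr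
      _ = (t ^ 4 * p) ^ 3 := by ring
      _ ≤ (1223424 * N ^ 18) ^ 3 := by gcongr
      _ = 1223424 ^ 3 * N ^ 8 * N ^ 46 := by ring
      _ ≤ 1223424 ^ 3 * ((M : ℤ) ^ 3) ^ 8 * N ^ 46 := by gcongr
      _ = _ := by ring
  have h7 : t ^ 4 ≤ 1223424 * (M : ℤ) ^ 8 :=
    le_of_pow_le_pow_left₀ (by norm_num) (by positivity)
      (le_of_mul_le_mul_right h6 (by positivity))
  have h8 : t ≤ 34 * (M : ℤ) ^ 2 := by
    refine le_of_pow_le_pow_left₀ (n := 4) (by norm_num) (by positivity) (h7.trans ?_)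
    calc 1223424 * (M : ℤ) ^ 8 ≤ 34 ^ 4 * (M : ℤ) ^ 8 := by gcongr; norm_num
      _ = _ := by ring
  have := h.card_le
  zify
  linarith

/-- The case where the cubic form attached to the plane has a double root. -/
theorem card_le_of_discrim_eq_zero [Fact p.Prime] (h : IsPlane p N a μ s t α β γ δ)
    (hT : DivisorBound T L) (hM : 1 ≤ M) (hML : 2 * M ^ 2 ≤ L) (hN : 1 ≤ N) (hNM : N ≤ M ^ 3)
    (hp : 54 * N ^ 6 < p) (hL : 3 * (20000 * N ^ 12) ^ 7 ≤ L) (hμ : μ ≠ 0)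
    (hs : ∀ P ∈ s, IsModSol p N a μ P.1 P.2.1 P.2.2)
    (hD : (α * δ - β * γ) ^ 2 - 4 * (β ^ 2 - α * γ) * (γ ^ 2 - β * δ) = 0) :
    s.card ≤ 7494 * T ^ 7 * M ^ 2 := by
  have ht : 1 ≤ t := h.pos
  have drop : ∀ {k : ℕ} {x y : ℤ}, t ^ k * |x| ≤ y → |x| ≤ y := fun {k x y} hx =>
    (le_mul_of_one_le_left (abs_nonneg x) (one_le_pow₀ ht)).trans hx
  have hαb : |α| ≤ 18 * N ^ 3 := drop (k := 1) (by simpa using h.hα)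
  have hβb : |β| ≤ 6 * N ^ 4 := drop (k := 1) (by simpa using h.hβ)
  have hGb := drop h.abs_hessian₁_le
  have hHb := drop h.abs_hessian₂_le
  have hG := h.hessian₁_eq
  have hH := h.hessian₂_eq
  have hα0 : α ≠ 0 := fun h0 => h.ne_zero (by rw [h0, Int.cast_zero])
  have h2 : (2 : ZMod p) ≠ 0 := fun h2 => by
    have : 1 ≤ N ^ 6 := one_le_pow₀ hN
    have := ZMod.eq_zero_of_intCast_eq_zero_of_abs_lt (p := p) (k := 2) (by exact_mod_cast h2)
      (by rw [abs_of_pos two_pos]; linarith)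
    norm_num at this
  have hrel : ∀ P ∈ s, ∀ X₁ X₂ X₃ : ℤ, X₁ = 2 * (β ^ 2 - α * γ) * P.1 - (α * δ - β * γ) →
      X₂ = 2 * (β ^ 2 - α * γ) * P.2.1 - (α * δ - β * γ) →
      X₃ = 2 * (β ^ 2 - α * γ) * P.2.2 - (α * δ - β * γ) →
      α * X₁ * X₂ * X₃ = -(α * (α * δ - β * γ) + 2 * (β ^ 2 - α * γ) * β) *
        (X₁ * X₂ + X₁ * X₃ + X₂ * X₃) := by
    rintro P hP _ _ _ rfl rfl rfl
    have := h.eq P hP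
    simp only [esymm₃] at this
    linear_combination 8 * (β ^ 2 - α * γ) ^ 3 * this -
      (α * (2 * (β ^ 2 - α * γ) * (P.1 + P.2.1 + P.2.2) - 3 * (α * δ - β * γ)) +
        (α * (α * δ - β * γ) + 2 * (β ^ 2 - α * γ) * β)) * hD
  have hE : ((-(α * (α * δ - β * γ) + 2 * (β ^ 2 - α * γ) * β) : ℤ) : ZMod p) =
      2 * α ^ 3 * μ ^ 3 := by
    rw [Int.cast_neg, Int.cast_add, Int.cast_mul, Int.cast_mul, Int.cast_mul, hG, hH, h.β_eq]
    push_cast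
    ring
  have hEb : |-(α * (α * δ - β * γ) + 2 * (β ^ 2 - α * γ) * β)| ≤ 20000 * N ^ 12 := by
    rw [abs_neg]
    refine (abs_add_le _ _).trans ?_
    rw [abs_mul, abs_mul, abs_mul, abs_two]
    calc _ ≤ 18 * N ^ 3 * (1008 * N ^ 9) + 2 * (144 * N ^ 8) * (6 * N ^ 4) := by gcongr
      _ = 19872 * N ^ 12 := by ring
      _ ≤ _ := by gcongr; norm_num
  have hG0 : 2 * (β ^ 2 - α * γ) ≠ 0 := mul_ne_zero two_ne_zero fun h0 => by
    rw [h0, Int.cast_zero] at hG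
    exact mul_ne_zero (pow_ne_zero 2 h.ne_zero) (pow_ne_zero 2 hμ) hG.symm
  generalize -(α * (α * δ - β * γ) + 2 * (β ^ 2 - α * γ) * β) = E at *
  generalize β ^ 2 - α * γ = G at *
  generalize α * δ - β * γ = H at *
  have hE0 : E ≠ 0 := fun h0 => by
    rw [h0, Int.cast_zero] at hE
    exact mul_ne_zero (mul_ne_zero h2 (pow_ne_zero 3 h.ne_zero)) (pow_ne_zero 3 hμ) hE.symm
  obtain ⟨g, r, b, hg, hgr, hgb, hrb⟩ := exists_isCoprime_mul_gcd (b := -H) hG0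
  obtain ⟨k, n, m, hk, hn, hkn, hkm, hnm⟩ : ∃ k n m : ℤ, k ≠ 0 ∧ 1 ≤ n ∧ α * g = k * n ∧
      E = k * m ∧ IsCoprime n m := by
    obtain ⟨k, n, m, hk, hkn, hkm, hnm⟩ := exists_isCoprime_mul_gcd (b := E)
      (mul_ne_zero hα0 hg.ne')
    have hn0 : n ≠ 0 := fun h0 => mul_ne_zero hα0 hg.ne' (by rw [hkn, h0, mul_zero])
    rcases hn0.lt_or_gt with hn | hn
    · exact ⟨-k, -n, -m, neg_ne_zero.2 hk.ne', by linarith, by rw [hkn]; ring, by rw [hkm]; ring,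
        hnm.neg_neg⟩
    · exact ⟨k, n, m, hk.ne', hn, hkn, hkm, hnm⟩
  have hr0 : r ≠ 0 := fun h0 => hG0 (by rw [hgr, h0, mul_zero])
  have hX : ∀ u, g * (r * u + b) = 2 * G * u - H := fun u => by
    linear_combination -u * hgr - hgb
  have hXp : ∀ u : ℤ, ((g * (r * u + b) : ℤ) : ZMod p) = 2 * α ^ 2 * μ ^ 2 * (a + u) := fun u => by
    rw [hX, Int.cast_sub, Int.cast_mul, Int.cast_mul, hG, hH]
    push_cast
    ring
  have key : ∀ u : ℤ, 1 ≤ u → u ≤ N → a + u ≠ 0 → a + u ≠ μ → r * u + b ≠ 0 ∧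
      n * (r * u + b) ≠ m ∧ |r * u + b| ≤ 20000 * N ^ 12 ∧ IsCoprime r (r * u + b) := by
    intro u hu1 huN hu0 huμ
    refine ⟨fun h0 => ?_, fun h0 => huμ ?_, ?_, ?_⟩
    · have := hXp u
      rw [h0, mul_zero, Int.cast_zero] at this
      exact mul_ne_zero (mul_ne_zero (mul_ne_zero h2 (pow_ne_zero 2 h.ne_zero))
        (pow_ne_zero 2 hμ)) hu0 this.symm
    · have h3 : α * (g * (r * u + b)) = E := by
        rw [hkm, ← h0]
        linear_combination (r * u + b) * hkn
      have h4 := congrArg (Int.cast : ℤ → ZMod p) h3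
      rw [Int.cast_mul, hXp, hE] at h4
      exact mul_left_cancel₀ (mul_ne_zero (mul_ne_zero h2 (pow_ne_zero 3 h.ne_zero))
        (pow_ne_zero 2 hμ)) (by linear_combination h4)
    · calc |r * u + b| ≤ g * |r * u + b| := le_mul_of_one_le_left (abs_nonneg _) hg
        _ = |2 * G * u - H| := by rw [← hX, abs_mul, abs_of_pos hg]
        _ ≤ 2 * |G| * u + |H| := by
          refine (abs_sub _ _).trans_eq ?_
          rw [abs_mul, abs_mul, abs_two, abs_of_pos (by linarith : 0 < u)]
        _ ≤ 2 * (144 * N ^ 8) * N + 1008 * N ^ 9 := by gcongr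
        _ = 1296 * N ^ 9 := by ring
        _ ≤ 20000 * N ^ 12 := by
          gcongr <;> norm_num
    · exact hrb.mul_add_left_right u
  have hNN : (1 : ℤ) ≤ N ^ 12 := one_le_pow₀ hN
  refine card_solutions_le hT hM hML hNM (B := 20000 * N ^ 12) (r := r) (n := n) (m := m)
    (by linarith) hL hn hr0 (fun h0 => hE0 (by rw [hkm, h0, mul_zero])) hnm ?_ ?_ s
    (fun P => (r * P.1 + b, r * P.2.1 + b, r * P.2.2 + b)) ?_ fun P hP => ?_
  · have hgb : g ≤ 2 * |G| := by
      have := Int.le_of_dvd (abs_pos.2 hG0) ((dvd_abs _ _).2 ⟨r, hgr⟩)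
      rwa [abs_mul, abs_two] at this
    calc n ≤ |k| * n := le_mul_of_one_le_left (by linarith) (Int.one_le_abs hk)
      _ = |α| * g := by
        rw [← abs_of_pos (by linarith : 0 < n), ← abs_mul, ← hkn, abs_mul, abs_of_pos hg]
      _ ≤ 18 * N ^ 3 * (2 * (144 * N ^ 8)) := by gcongr; linarith
      _ = 5184 * N ^ 11 := by ring
      _ ≤ 20000 * N ^ 12 := by
        gcongr <;> norm_num
  · refine le_trans ?_ hEb
    rw [hkm, abs_mul]
    exact le_mul_of_one_le_left (abs_nonneg _) (Int.one_le_abs hk)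
  · rintro ⟨x, y, z⟩ - ⟨x', y', z'⟩ - h
    simpa [hr0] using h
  · obtain ⟨a₁, a₂, a₃, a₄⟩ := key _ (hs P hP).pos₁ (hs P hP).le₁ (hs P hP).ne_zero₁ (hs P hP).ne₁
    obtain ⟨b₁, b₂, b₃, b₄⟩ := key _ (hs P hP).pos₂ (hs P hP).le₂ (hs P hP).ne_zero₂ (hs P hP).ne₂
    obtain ⟨c₁, c₂, c₃, c₄⟩ := key _ (hs P hP).pos₃ (hs P hP).le₃ (hs P hP).ne_zero₃ (hs P hP).ne₃
    have hd : ∀ {u v : ℤ}, 1 ≤ u → u ≤ N → 1 ≤ v → v ≤ N →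
        ∃ h, (r * u + b) - (r * v + b) = r * h ∧ |h| ≤ N := fun {u v} h1 h2 h3 h4 =>
      ⟨u - v, by ring, abs_sub_le_of_nonneg_of_le (by linarith) h2 (by linarith) h4⟩
    refine ⟨a₁, b₁, c₁, a₂, b₂, c₂, a₃, b₃, c₃, a₄, b₄, c₄,
      hd (hs P hP).pos₁ (hs P hP).le₁ (hs P hP).pos₂ (hs P hP).le₂,
      hd (hs P hP).pos₁ (hs P hP).le₁ (hs P hP).pos₃ (hs P hP).le₃,
      hd (hs P hP).pos₂ (hs P hP).le₂ (hs P hP).pos₃ (hs P hP).le₃,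
      mul_left_cancel₀ (mul_ne_zero (pow_ne_zero 2 hg.ne') hk) ?_⟩
    have := hrel P hP _ _ _ (hX P.1) (hX P.2.1) (hX P.2.2)
    simp only
    generalize r * P.1 + b = x at *
    generalize r * P.2.1 + b = y at *
    generalize r * P.2.2 + b = z at *
    linear_combination this - g ^ 2 * x * y * z * hkn + g ^ 2 * (x * y + x * z + y * z) * hkm

end IsPlane

theorem card_le_of_isModSol [Fact p.Prime] (hT : DivisorBound T L) (hM : 1 ≤ M)
    (hML : 2 * M ^ 2 ≤ L) (hN : 1 ≤ N) (hNM : N ≤ M ^ 3) (hp : 54 * N ^ 6 < p)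
    (hp' : N ^ 46 < (p : ℤ) ^ 3) (hL : 3 * (20000 * N ^ 12) ^ 7 ≤ L) (hμ : μ ≠ 0)
    (hs : ∀ P ∈ s, IsModSol p N a μ P.1 P.2.1 P.2.2) : s.card ≤ 7494 * T ^ 7 * M ^ 2 := by
  have hL1 : 343 * N ^ 9 ≤ L := by
    refine le_trans ?_ hL
    calc 343 * N ^ 9 ≤ 3 * 20000 ^ 7 * N ^ 84 := by gcongr <;> norm_num
      _ = _ := by ring
  have hT1 : 1 ≤ T := hT.one_le (by
    have : 1 ≤ N ^ 9 := one_le_pow₀ hN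
    have : (1 : ℤ) ≤ L := by linarith
    exact_mod_cast this)
  rcases card_le_or_exists_isPlane hT hp hL1 hμ s hs with h | ⟨t, α, β, γ, δ, h⟩
  · calc s.card ≤ 216 * T ^ 3 := h
      _ = 216 * T ^ 3 * 1 ^ 2 := by ring
      _ ≤ _ := by gcongr <;> norm_num
  · by_cases hD : (α * δ - β * γ) ^ 2 - 4 * (β ^ 2 - α * γ) * (γ ^ 2 - β * δ) = 0
    · exact h.card_le_of_discrim_eq_zero hT hM hML hN hNM hp hL hμ hs hD
    · calc s.card ≤ 1836 * M ^ 2 := h.card_le_of_discrim_ne_zero hN hp' hNM hD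
        _ = 1836 * 1 ^ 7 * M ^ 2 := by ring
        _ ≤ _ := by gcongr; norm_num

end modular

theorem lt_of_zero_notMem_interval {p : ℕ} [NeZero p] {a : ZMod p} {N : ℕ}
    (h : 0 ∉ interval p a N) : N < p := by
  by_contra! H
  have ha := ZMod.val_lt a
  refine h (mem_image.2 ⟨p - a.val, mem_Icc.2 ⟨by omega, by omega⟩, ?_⟩)
  rw [Nat.cast_sub ha.le, ZMod.natCast_self, ZMod.natCast_zmod_val]
  ring

theorem card_interval {p : ℕ} {a : ZMod p} {N : ℕ} (h : N < p) : (interval p a N).card = N := by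
  rw [interval, card_image_of_injOn, Nat.card_Icc, Nat.add_sub_cancel]
  intro i hi j hj hij
  have hi := mem_Icc.1 hi
  have hj := mem_Icc.1 hj
  have := (ZMod.natCast_eq_natCast_iff' i j p).1 (add_left_cancel hij)
  rwa [Nat.mod_eq_of_lt (by omega), Nat.mod_eq_of_lt (by omega)] at this

theorem card_inv_add_le {p T L M N : ℕ} (hp : p.Prime) (hT : DivisorBound T L) (hM : 1 ≤ M)
    (hML : 2 * M ^ 2 ≤ L) (hN : 2 ≤ N) (hNM : N ≤ M ^ 3) (hNp : N ^ 46 < p ^ 3)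
    (hL : 3 * (20000 * N ^ 12) ^ 7 ≤ L) {a lam : ZMod p} (h0 : 0 ∉ interval p a N)
    (hlam : lam ≠ 0) (hlam' : lam ∉ (interval p a N).image (fun x => x⁻¹)) :
    ((interval p a N ×ˢ interval p a N ×ˢ interval p a N).filter
      (fun t => t.1⁻¹ + t.2.1⁻¹ + t.2.2⁻¹ = lam)).card ≤ 7494 * T ^ 7 * M ^ 2 := by
  have : Fact p.Prime := ⟨hp⟩
  let φ : ℤ × ℤ × ℤ → ZMod p × ZMod p × ZMod p := fun u => (a + u.1, a + u.2.1, a + u.2.2)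
  set s : Finset (ℤ × ℤ × ℤ) := {u ∈ Icc (1 : ℤ) N ×ˢ Icc (1 : ℤ) N ×ˢ Icc (1 : ℤ) N |
    (φ u).1⁻¹ + (φ u).2.1⁻¹ + (φ u).2.2⁻¹ = lam} with hs
  have hmem : ∀ x ∈ interval p a N, ∃ u : ℤ, u ∈ Icc (1 : ℤ) N ∧ a + u = x := fun x hx => by
    obtain ⟨i, hi, rfl⟩ := mem_image.1 hx
    have := mem_Icc.1 hi
    exact ⟨i, mem_Icc.2 ⟨by exact_mod_cast this.1, by exact_mod_cast this.2⟩, by push_cast; rfl⟩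
  have hmem' : ∀ u : ℤ, u ∈ Icc (1 : ℤ) N → a + u ∈ interval p a N := fun u hu => by
    have := mem_Icc.1 hu
    lift u to ℕ using by linarith
    exact mem_image.2 ⟨u, mem_Icc.2 ⟨by exact_mod_cast this.1, by exact_mod_cast this.2⟩,
      by push_cast; rfl⟩
  have hsub : (interval p a N ×ˢ interval p a N ×ˢ interval p a N).filter
      (fun t => t.1⁻¹ + t.2.1⁻¹ + t.2.2⁻¹ = lam) ⊆ s.image φ := by
    rintro ⟨x, y, z⟩ h
    simp only [mem_filter, mem_product] at h
    obtain ⟨⟨hx, hy, hz⟩, h⟩ := h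
    obtain ⟨u, hu, rfl⟩ := hmem _ hx
    obtain ⟨v, hv, rfl⟩ := hmem _ hy
    obtain ⟨w, hw, rfl⟩ := hmem _ hz
    exact mem_image.2 ⟨(u, v, w), by simp [hs, φ, -mem_Icc, hu, hv, hw, h], rfl⟩
  have hne : ∀ u : ℤ, u ∈ Icc (1 : ℤ) N → a + u ≠ 0 ∧ a + u ≠ lam⁻¹ := fun u hu =>
    ⟨fun h => h0 (h ▸ hmem' u hu),
      fun h => hlam' (mem_image.2 ⟨_, hmem' u hu, by rw [h, inv_inv]⟩)⟩
  refine (card_le_card hsub).trans (card_image_le.trans ?_)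
  have hN15 : N ^ 15 < p := by
    refine lt_of_pow_lt_pow_left₀ 3 (Nat.zero_le _) (lt_of_le_of_lt ?_ hNp)
    rw [← pow_mul]
    exact Nat.pow_le_pow_right (by omega) (by norm_num)
  have hN6 : 54 * N ^ 6 < p := by
    refine lt_of_le_of_lt ?_ hN15
    calc 54 * N ^ 6 ≤ 2 ^ 9 * N ^ 6 := by gcongr; norm_num
      _ ≤ N ^ 9 * N ^ 6 := by gcongr
      _ = _ := by ring
  refine card_le_of_isModSol (N := N) (a := a) (μ := lam⁻¹) hT hM hML
    (by exact_mod_cast (by omega : 1 ≤ N)) (by exact_mod_cast hNM) (by exact_mod_cast hN6)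
    (by exact_mod_cast hNp) (by exact_mod_cast hL) (inv_ne_zero hlam) fun P hP => ?_
  obtain ⟨hP, hsum⟩ := mem_filter.1 hP
  obtain ⟨h₁, h₂₃⟩ := mem_product.1 hP
  obtain ⟨h₂, h₃⟩ := mem_product.1 h₂₃
  obtain ⟨n₁, m₁⟩ := hne _ h₁
  obtain ⟨n₂, m₂⟩ := hne _ h₂
  obtain ⟨n₃, m₃⟩ := hne _ h₃
  rw [mem_Icc] at h₁ h₂ h₃
  refine ⟨h₁.1, h₂.1, h₃.1, h₁.2, h₂.2, h₃.2, n₁, n₂, n₃, m₁, m₂, m₃, ?_⟩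
  rw [← hsum] at hlam ⊢
  simp only [φ] at hlam ⊢
  rw [eq_inv_mul_iff_mul_eq₀ hlam]
  field_simp
  ring

theorem natCast_pow_lt_of_lt_rpow {N p : ℕ} (h : (N : ℝ) < (p : ℝ) ^ ((3 : ℝ) / 46)) :
    N ^ 46 < p ^ 3 := by
  have h1 := pow_lt_pow_left₀ h (Nat.cast_nonneg N) (by norm_num : 46 ≠ 0)
  rw [← Real.rpow_natCast, ← Real.rpow_natCast, ← Real.rpow_mul (Nat.cast_nonneg p)] at h1
  norm_num at h1
  exact_mod_cast h1

theorem exists_le_cube {N : ℕ} (hN : 1 ≤ N) :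
    ∃ M : ℕ, 1 ≤ M ∧ M ≤ N ∧ N ≤ M ^ 3 ∧ (M : ℝ) ^ 2 ≤ 4 * (N : ℝ) ^ ((2 : ℝ) / 3) := by
  have hN1 : (1 : ℝ) ≤ N := by exact_mod_cast hN
  have hx1 : (1 : ℝ) ≤ (N : ℝ) ^ ((1 : ℝ) / 3) := Real.one_le_rpow hN1 (by norm_num)
  have hc : ((N : ℝ) ^ ((1 : ℝ) / 3)) ^ 3 = N := by
    rw [← Real.rpow_natCast, ← Real.rpow_mul (by linarith)]
    norm_num
  have hq : ((N : ℝ) ^ ((1 : ℝ) / 3)) ^ 2 = (N : ℝ) ^ ((2 : ℝ) / 3) := by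
    rw [← Real.rpow_natCast, ← Real.rpow_mul (by linarith)]
    norm_num
  rw [← hq]
  generalize (N : ℝ) ^ ((1 : ℝ) / 3) = x at *
  have hle := Nat.le_ceil x
  have hlt := Nat.ceil_lt_add_one (by linarith : 0 ≤ x)
  refine ⟨⌈x⌉₊, Nat.one_le_ceil_iff.2 (by linarith), Nat.ceil_le.2 ?_, ?_, ?_⟩
  · rw [← hc]
    exact le_self_pow₀ hx1 (by norm_num)
  · have : (N : ℝ) ≤ (⌈x⌉₊ : ℝ) ^ 3 := by
      rw [← hc]
      gcongr
    exact_mod_cast this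
  · calc (⌈x⌉₊ : ℝ) ^ 2 ≤ (2 * x) ^ 2 := by gcongr; linarith
      _ = _ := by ring

/-- for every `ε > 0` there is `C > 0` such that for every prime `p`, every
interval `I ⊂ F_p` not containing `0` with `|I| < p^{3/46}`, and every `λ ∈ F_p` with
`λ ≠ 0` and `λ ∉ I⁻¹`, the number `J` of triples `(x,y,z) ∈ I³` with
`x⁻¹+y⁻¹+z⁻¹ = λ` satisfies `J ≤ C·|I|^{2/3+ε}`. -/
theorem stmt_2 (ε : ℝ) (hε : 0 < ε) :
    ∃ C : ℝ, 0 < C ∧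
      ∀ (p : ℕ), p.Prime → ∀ (a : ZMod p) (N : ℕ),
        (0 : ZMod p) ∉ interval p a N →
        ((interval p a N).card : ℝ) < (p : ℝ) ^ ((3 : ℝ) / 46) →
        ∀ lam : ZMod p, lam ≠ 0 →
          lam ∉ (interval p a N).image (fun x => x⁻¹) →
          (((interval p a N ×ˢ interval p a N ×ˢ interval p a N).filter
              (fun t => t.1⁻¹ + t.2.1⁻¹ + t.2.2⁻¹ = lam)).card : ℝ) ≤
            C * ((interval p a N).card : ℝ) ^ ((2 : ℝ) / 3 + ε) := by
  obtain ⟨C₀, hC₀, hdiv⟩ := exists_card_divisors_le_rpow (ε / 588) (by positivity)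
  set B : ℝ := 3 * 20000 ^ 7 with hB
  have hC : 0 ≤ 29976 * (C₀ ^ 7 * B ^ (ε / 84)) := by positivity
  refine ⟨1 + 29976 * (C₀ ^ 7 * B ^ (ε / 84)), by linarith, fun p hp a N h0 hNp lam hlam hlam' => ?_⟩
  have : NeZero p := ⟨hp.ne_zero⟩
  have hcard := card_interval (a := a) (lt_of_zero_notMem_interval h0)
  rw [hcard] at hNp
  rcases lt_or_ge N 2 with hN | hN
  · have hle := card_filter_le (interval p a N ×ˢ interval p a N ×ˢ interval p a N)
      (fun t => t.1⁻¹ + t.2.1⁻¹ + t.2.2⁻¹ = lam)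
    rw [card_product, card_product, hcard] at hle
    rw [hcard]
    refine (Nat.cast_le.2 hle).trans ?_
    interval_cases N
    · simp only [Nat.mul_zero, Nat.cast_zero]
      positivity
    · simpa using hC
  obtain ⟨M, hM, hMN, hNM, hM2⟩ := exists_le_cube (by omega : 1 ≤ N)
  set L : ℕ := 3 * (20000 * N ^ 12) ^ 7 with hL
  have hN0 : (0 : ℝ) < N := by exact_mod_cast (by omega : 0 < N)
  have hT : DivisorBound ⌊C₀ * (L : ℝ) ^ (ε / 588)⌋₊ L := fun k hk hkL => by
    refine Nat.le_floor ((hdiv k hk).trans ?_)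
    gcongr
  have hT7 : (⌊C₀ * (L : ℝ) ^ (ε / 588)⌋₊ : ℝ) ^ 7 ≤ C₀ ^ 7 * B ^ (ε / 84) * (N : ℝ) ^ ε := by
    calc (⌊C₀ * (L : ℝ) ^ (ε / 588)⌋₊ : ℝ) ^ 7 ≤ (C₀ * (L : ℝ) ^ (ε / 588)) ^ 7 := by
          gcongr
          exact Nat.floor_le (by positivity)
      _ = C₀ ^ 7 * (L : ℝ) ^ (ε / 84) := by
        rw [mul_pow, ← Real.rpow_mul_natCast (by positivity)]
        congr 2
        push_cast
        ring
      _ = C₀ ^ 7 * (B * (N : ℝ) ^ (84 : ℕ)) ^ (ε / 84) := by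
        congr 2
        rw [hL, hB]
        push_cast
        ring
      _ = C₀ ^ 7 * B ^ (ε / 84) * (N : ℝ) ^ ε := by
        rw [Real.mul_rpow (by positivity) (by positivity), ← Real.rpow_natCast_mul hN0.le,
          mul_assoc]
        congr 3
        push_cast
        ring
  have hML : 2 * M ^ 2 ≤ L := by
    calc 2 * M ^ 2 ≤ 3 * 20000 ^ 7 * N ^ 84 := by gcongr <;> omega
      _ = L := by rw [hL]; ring
  have hmain := card_inv_add_le hp hT hM hML hN hNM (natCast_pow_lt_of_lt_rpow hNp) le_rfl h0 hlam
    hlam'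
  rw [hcard, Real.rpow_add hN0]
  refine (Nat.cast_le.2 hmain).trans ?_
  push_cast
  calc 7494 * (⌊C₀ * (L : ℝ) ^ (ε / 588)⌋₊ : ℝ) ^ 7 * (M : ℝ) ^ 2 ≤
      7494 * (C₀ ^ 7 * B ^ (ε / 84) * (N : ℝ) ^ ε) * (4 * (N : ℝ) ^ ((2 : ℝ) / 3)) := by gcongr
    _ = 29976 * (C₀ ^ 7 * B ^ (ε / 84)) * ((N : ℝ) ^ ((2 : ℝ) / 3) * (N : ℝ) ^ ε) := by ring
    _ ≤ _ := by gcongr; linarith
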